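/- arXiv:2603.26223 — 3 statements merged into one kernel-verified Lean document; each statement's English description precedes it below -/
import Mathlib

section
/- Let n be a positive odd integer and let M = (n-1)/2. Then modulo [n]Φ_n(q)^4 one has Σ_{k=0}^{M} [4k+1] (q;q^2)_k^4/(q^2;q^2)_k^4 ≡ q^{(1-n)/2} ([n] - ([n]^3 + [n]^4(1-q)) Σ_{k=1}^{(n-1)/2} q^{2k}/[2k]^2) + [n]^4 Σ_{k=1}^{(n-1)/2} q^{2k} (q^2;q^2)_{k-1}^2 / ([2k-1]^3 (q;q^2)_{k-1}^2). -/
open Finset Polynomial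

/-- The indeterminate `q`, as a rational function over `ℚ`. -/
noncomputable def q : RatFunc ℚ := RatFunc.X

/-- The q-shifted factorial `(q^r; q^d)_m = ∏_{j=0}^{m-1} (1 - q^{r+dj})`. -/
noncomputable def qPoch (r d : ℤ) (m : ℕ) : RatFunc ℚ :=
  ∏ j ∈ Finset.range m, (1 - q ^ (r + d * (j : ℤ)))

/-- The q-integer `[m] = (1-q^m)/(1-q)`. -/
noncomputable def qint (m : ℤ) : RatFunc ℚ := (1 - q ^ m) / (1 - q)

/-- Congruence of rational functions modulo a polynomial `P`: the difference can be
written with numerator divisible by `P` and denominator coprime to `P`. -/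
def modCong (A B : RatFunc ℚ) (P : Polynomial ℚ) : Prop :=
  ∃ c e : Polynomial ℚ, IsCoprime e P ∧
    A - B = algebraMap (Polynomial ℚ) (RatFunc ℚ) (P * c) /
            algebraMap (Polynomial ℚ) (RatFunc ℚ) e

/-- The q-integer `[n]` as a polynomial: `1 + q + ⋯ + q^{n-1}`. -/
noncomputable def qintPoly (n : ℕ) : Polynomial ℚ := ∑ i ∈ Finset.range n, Polynomial.X ^ i

section Field
variable {K : Type*} [Field K]

theorem one_sub_pow_div_pow_ne_zero {z : K} (hz0 : z ≠ 0) (hz : ∀ m : ℕ, 0 < m → 1 - z ^ m ≠ 0)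
    {a b : ℕ} (hab : a ≠ b) : 1 - z ^ a / z ^ b ≠ 0 := by
  intro h
  have hb : z ^ b ≠ 0 := pow_ne_zero _ hz0
  have h1 : z ^ a = z ^ b := by
    field_simp at h
    linear_combination -h
  rcases lt_or_gt_of_ne hab with h2 | h2
  · obtain ⟨c, rfl⟩ := Nat.exists_eq_add_of_lt h2
    apply hz (c + 1) (by omega)
    have ha : z ^ a ≠ 0 := pow_ne_zero _ hz0
    apply mul_left_cancel₀ ha
    rw [mul_zero]
    linear_combination h1
  · obtain ⟨c, rfl⟩ := Nat.exists_eq_add_of_lt h2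
    apply hz (c + 1) (by omega)
    apply mul_left_cancel₀ hb
    rw [mul_zero]
    linear_combination -h1

/-- The quotient `(zb; z²)_k (z/b; z²)_k / ((z²b; z²)_k (z²/b; z²)_k)`. -/
def wellPoised (z b : K) (k : ℕ) : K :=
  ∏ j ∈ range k, ((1 - z ^ (2 * j + 1) * b) * (1 - z ^ (2 * j + 1) / b)) /
    ((1 - z ^ (2 * j + 2) * b) * (1 - z ^ (2 * j + 2) / b))

/-- The quotient `(P; z²)_k (1/P; z²)_k / ((z³P; z²)_k (z³/P; z²)_k)`. -/
def shiftedWellPoised (z P : K) (k : ℕ) : K :=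
  ∏ j ∈ range k, ((1 - z ^ (2 * j) * P) * (1 - z ^ (2 * j) / P)) /
    ((1 - z ^ (2 * j + 3) * P) * (1 - z ^ (2 * j + 3) / P))

theorem wellPoised_mul_eq_shiftedWellPoised {z P : K} (hz : z ≠ 0) (hP : P ≠ 0)
    (h1 : ∀ j : ℕ, 1 - z ^ (2 * j + 1) * P ≠ 0) (h2 : ∀ j : ℕ, 1 - z ^ (2 * j + 1) / P ≠ 0)
    (k : ℕ) :
    (1 - P) * (1 - z / P) * wellPoised z (z * P) k =
      shiftedWellPoised z P k * ((1 - z ^ (2 * k) * P) * (1 - z ^ (2 * k + 1) / P)) := by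
  induction k with
  | zero => simp [wellPoised, shiftedWellPoised]
  | succ k ih =>
    have e1 := h1 (k + 1)
    have e2 := h2 (k + 1)
    have e3 := h2 k
    simp only [wellPoised, shiftedWellPoised, prod_range_succ] at ih ⊢
    rw [← mul_assoc, ih]
    have r1 : 1 - z ^ (2 * k + 1) * (z * P) = 1 - z ^ (2 * (k + 1)) * P := by ring
    have r2 : 1 - z ^ (2 * k + 1) / (z * P) = 1 - z ^ (2 * k) / P := by
      rw [pow_succ]; field_simp
    have r3 : 1 - z ^ (2 * k + 2) * (z * P) = 1 - z ^ (2 * k + 3) * P := by ring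
    have r4 : 1 - z ^ (2 * k + 2) / (z * P) = 1 - z ^ (2 * k + 1) / P := by
      rw [show 2 * k + 2 = 2 * k + 1 + 1 from rfl, pow_succ]; field_simp
    rw [r1, r2, r3, r4]
    rw [show 2 * (k + 1) + 1 = 2 * k + 3 by ring] at *
    generalize (∏ j ∈ range k, ((1 - z ^ (2 * j) * P) * (1 - z ^ (2 * j) / P)) /
    ((1 - z ^ (2 * j + 3) * P) * (1 - z ^ (2 * j + 3) / P))) = H
    generalize 1 - z ^ (2 * k + 3) * P = a1 at *
    generalize 1 - z ^ (2 * k + 3) / P = a2 at *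
    generalize 1 - z ^ (2 * k + 1) / P = a3 at *
    field_simp

theorem wellPoised_div_mul_eq_shiftedWellPoised {z P : K} (hz : z ≠ 0) (hP : P ≠ 0)
    (h1 : ∀ j : ℕ, 1 - z ^ (2 * j + 1) * P ≠ 0) (h2 : ∀ j : ℕ, 1 - z ^ (2 * j + 1) / P ≠ 0)
    (k : ℕ) :
    (1 - 1 / P) * (1 - z * P) * wellPoised z (P / z) k =
      shiftedWellPoised z P k * ((1 - z ^ (2 * k) / P) * (1 - z ^ (2 * k + 1) * P)) := by
  induction k with
  | zero => simp [wellPoised, shiftedWellPoised]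
  | succ k ih =>
    have e1 := h1 (k + 1)
    have e2 := h2 (k + 1)
    have e3 := h1 k
    simp only [wellPoised, shiftedWellPoised, prod_range_succ] at ih ⊢
    rw [← mul_assoc, ih]
    have r1 : 1 - z ^ (2 * k + 1) * (P / z) = 1 - z ^ (2 * k) * P := by
      rw [pow_succ]; field_simp
    have r2 : 1 - z ^ (2 * k + 1) / (P / z) = 1 - z ^ (2 * (k + 1)) / P := by
      field_simp; ring
    have r3 : 1 - z ^ (2 * k + 2) * (P / z) = 1 - z ^ (2 * k + 1) * P := by
      rw [show 2 * k + 2 = 2 * k + 1 + 1 from rfl, pow_succ]; field_simp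
    have r4 : 1 - z ^ (2 * k + 2) / (P / z) = 1 - z ^ (2 * k + 3) / P := by
      field_simp; ring
    rw [r1, r2, r3, r4]
    rw [show 2 * (k + 1) + 1 = 2 * k + 3 by ring] at *
    generalize (∏ j ∈ range k, ((1 - z ^ (2 * j) * P) * (1 - z ^ (2 * j) / P)) /
    ((1 - z ^ (2 * j + 3) * P) * (1 - z ^ (2 * j + 3) / P))) = H
    generalize 1 - z ^ (2 * k + 3) * P = a1 at *
    generalize 1 - z ^ (2 * k + 3) / P = a2 at *
    generalize 1 - z ^ (2 * k + 1) * P = a3 at *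
    field_simp

theorem sum_shiftedWellPoised_mul_wellPoised {z P b : K} (hP : P ≠ 0) (hb : b ≠ 0)
    (h1 : ∀ j : ℕ, 1 - z ^ (2 * j + 1) * P ≠ 0) (h2 : ∀ j : ℕ, 1 - z ^ (2 * j + 1) / P ≠ 0)
    (h3 : ∀ j : ℕ, 1 - z ^ (2 * j + 2) * b ≠ 0) (h4 : ∀ j : ℕ, 1 - z ^ (2 * j + 2) / b ≠ 0)
    (N : ℕ) :
    (1 - z) * (b + 1 / b - P - 1 / P) * ∑ k ∈ range N, (1 - z ^ (4 * k + 1)) * z ^ (2 * k) *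
        (shiftedWellPoised z P k * wellPoised z b k) =
      shiftedWellPoised z P N * wellPoised z b N *
        ((1 - z ^ (2 * N + 1) * P) * (1 - z ^ (2 * N + 1) / P) *
          ((1 - z ^ (2 * N) * b) * (1 - z ^ (2 * N) / b))) -
      (1 - z * P) * (1 - z / P) * ((1 - b) * (1 - 1 / b)) := by
  induction N with
  | zero => simp [wellPoised, shiftedWellPoised]
  | succ k ih =>
    have e1 := h1 (k + 1)
    have e2 := h2 (k + 1)
    have e3 := h3 k
    have e4 := h4 k
    rw [sum_range_succ, mul_add, ih]
    simp only [wellPoised, shiftedWellPoised, prod_range_succ] at ih ⊢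
    rw [show 2 * (k + 1) + 1 = 2 * k + 3 by ring, show 2 * (k + 1) = 2 * k + 2 by ring] at *
    generalize (∏ j ∈ range k, ((1 - z ^ (2 * j) * P) * (1 - z ^ (2 * j) / P)) /
      ((1 - z ^ (2 * j + 3) * P) * (1 - z ^ (2 * j + 3) / P))) = H
    generalize (∏ j ∈ range k, ((1 - z ^ (2 * j + 1) * b) * (1 - z ^ (2 * j + 1) / b)) /
      ((1 - z ^ (2 * j + 2) * b) * (1 - z ^ (2 * j + 2) / b))) = W
    have key : ∀ a1 a2 a3 a4 u v : K, a1 ≠ 0 → a2 ≠ 0 → a3 ≠ 0 → a4 ≠ 0 →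
        H * (u / (a1 * a2)) * (W * (v / (a3 * a4))) * (a1 * a2 * (a3 * a4)) = H * W * (u * v) := by
      intros; field_simp
    rw [key _ _ _ _ _ _ e1 e2 e3 e4]
    field_simp
    ring

/-- A terminating very-well-poised sum evaluated in terms of a single sum. -/
theorem sum_wellPoised_mul_wellPoised {z b : K} (hz0 : z ≠ 0)
    (hz : ∀ m : ℕ, 0 < m → 1 - z ^ m ≠ 0) (hb : b ≠ 0)
    (h3 : ∀ j : ℕ, 1 - z ^ (2 * j + 2) * b ≠ 0) (h4 : ∀ j : ℕ, 1 - z ^ (2 * j + 2) / b ≠ 0)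
    (M : ℕ) :
    ∑ k ∈ range (M + 1), (1 - z ^ (4 * k + 1)) *
        (wellPoised z (z ^ (2 * M + 1)) k * wellPoised z b k) =
      (1 - z ^ (2 * M + 1)) / z ^ M * (1 - (b + 1 / b - 2) * ∑ i ∈ range M,
        z ^ (i + 1) * (1 + z ^ (2 * i + 2)) /
          ((1 - z ^ (2 * i + 2) * b) * (1 - z ^ (2 * i + 2) / b))) := by
  induction M with
  | zero => simp [wellPoised]
  | succ M ih =>
    obtain ⟨P, hPdef⟩ : ∃ P, P = z ^ (2 * M + 2) := ⟨_, rfl⟩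
    have hP : P ≠ 0 := hPdef ▸ pow_ne_zero _ hz0
    have h1 : ∀ j : ℕ, 1 - z ^ (2 * j + 1) * P ≠ 0 := fun j => by
      rw [hPdef, ← pow_add]; exact hz _ (by omega)
    have h2 : ∀ j : ℕ, 1 - z ^ (2 * j + 1) / P ≠ 0 := fun j => by
      rw [hPdef]; exact one_sub_pow_div_pow_ne_zero hz0 hz (by omega)
    have hsum := sum_shiftedWellPoised_mul_wellPoised hP hb h1 h2 h3 h4 (M + 2)
    have hvan : shiftedWellPoised z P (M + 2) = 0 := by
      rw [shiftedWellPoised, prod_range_succ, show 2 * (M + 1) = 2 * M + 2 by ring, ← hPdef,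
        div_self hP]
      simp
    rw [hvan, zero_mul, zero_mul, zero_sub] at hsum
    have hx1 : z ^ (2 * (M + 1) + 1) = z * P := by rw [hPdef]; ring
    have hx0 : z ^ (2 * M + 1) = P / z := by rw [hPdef]; field_simp; ring
    rw [hx0] at ih
    rw [hx1]
    have hlast : ∑ k ∈ range (M + 2), (1 - z ^ (4 * k + 1)) *
        (wellPoised z (P / z) k * wellPoised z b k) =
        ∑ k ∈ range (M + 1), (1 - z ^ (4 * k + 1)) *
        (wellPoised z (P / z) k * wellPoised z b k) := by
      rw [sum_range_succ _ (M + 1)]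
      have : wellPoised z (P / z) (M + 1) = 0 := by
        rw [wellPoised, prod_range_succ, hx0, div_self (div_ne_zero hP hz0)]
        simp
      rw [this]; ring
    rw [← hlast] at ih
    have hcomb : (1 - P) * (1 - z / P) * ∑ k ∈ range (M + 2), (1 - z ^ (4 * k + 1)) *
        (wellPoised z (z * P) k * wellPoised z b k) -
        (1 - 1 / P) * (1 - z * P) * ∑ k ∈ range (M + 2), (1 - z ^ (4 * k + 1)) *
        (wellPoised z (P / z) k * wellPoised z b k) =
        (1 - z) * (1 / P - P) * ∑ k ∈ range (M + 2), (1 - z ^ (4 * k + 1)) * z ^ (2 * k) *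
        (shiftedWellPoised z P k * wellPoised z b k) := by
      rw [mul_sum, mul_sum, mul_sum, ← sum_sub_distrib]
      refine sum_congr rfl fun k _ => ?_
      have a1 := wellPoised_mul_eq_shiftedWellPoised hz0 hP h1 h2 k
      have a2 := wellPoised_div_mul_eq_shiftedWellPoised hz0 hP h1 h2 k
      have a3 : ((1 - z ^ (2 * k) * P) * (1 - z ^ (2 * k + 1) / P)) -
        ((1 - z ^ (2 * k) / P) * (1 - z ^ (2 * k + 1) * P)) =
          (1 - z) * (1 / P - P) * z ^ (2 * k) := by
        field_simp; ring
      linear_combination (1 - z ^ (4 * k + 1)) * wellPoised z b k * (a1 - a2 +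
        shiftedWellPoised z P k * a3)
    rw [ih] at hcomb
    rw [sum_range_succ _ M, ← hPdef]
    generalize (∑ k ∈ range (M + 2), (1 - z ^ (4 * k + 1)) *
        (wellPoised z (z * P) k * wellPoised z b k)) = S at *
    generalize (∑ k ∈ range (M + 2), (1 - z ^ (4 * k + 1)) * z ^ (2 * k) *
        (shiftedWellPoised z P k * wellPoised z b k)) = Q at *
    generalize (∑ i ∈ range M, z ^ (i + 1) * (1 + z ^ (2 * i + 2)) /
          ((1 - z ^ (2 * i + 2) * b) * (1 - z ^ (2 * i + 2) / b))) = V at *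
    have n1 : 1 - P ≠ 0 := hPdef ▸ hz _ (by omega)
    have n2 : 1 - z / P ≠ 0 := by simpa using h2 0
    have n2' : P - z ≠ 0 := by
      intro h; apply n2; rw [sub_eq_zero.mp h, div_self hz0, sub_self]
    have n3 : 1 - z ≠ 0 := by simpa using hz 1
    have n4 : 1 - P * b ≠ 0 := by simpa [hPdef] using h3 M
    have n5 : 1 - P / b ≠ 0 := by simpa [hPdef] using h4 M
    have n5' : b - P ≠ 0 := by
      intro h; apply n5; rw [sub_eq_zero.mp h, div_self hP, sub_self]
    have hzM : z ^ M ≠ 0 := pow_ne_zero _ hz0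
    have fac : b + 1 / b - P - 1 / P = - ((1 - P * b) * (1 - P / b)) / P := by
      field_simp; ring
    rw [fac] at hsum
    have hQ : Q = P * ((1 - z * P) * (1 - z / P) * ((1 - b) * (1 - 1 / b))) /
        ((1 - z) * ((1 - P * b) * (1 - P / b))) := by
      field_simp
      field_simp at hsum
      linear_combination -hsum
    rw [hQ] at hcomb
    apply mul_left_cancel₀ (mul_ne_zero n1 n2)
    rw [sub_eq_iff_eq_add.mp hcomb, pow_succ z M]
    field_simp
    ring

/-- The quotient `(z²; z²)_k (z/P; z²)_k / ((z³; z²)_k (z²/P; z²)_k)`. -/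
def balancedRatio (z P : K) (k : ℕ) : K :=
  ∏ j ∈ range k, ((1 - z ^ (2 * j + 2)) * (1 - z ^ (2 * j + 1) / P)) /
    ((1 - z ^ (2 * j + 3)) * (1 - z ^ (2 * j + 2) / P))

/-- The quotient `(z²; z²)_k (z³/P; z²)_k / ((z³; z²)_k (z²/P; z²)_k)`. -/
def shiftedBalancedRatio (z P : K) (k : ℕ) : K :=
  ∏ j ∈ range k, ((1 - z ^ (2 * j + 2)) * (1 - z ^ (2 * j + 3) / P)) /
    ((1 - z ^ (2 * j + 3)) * (1 - z ^ (2 * j + 2) / P))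

theorem balancedRatio_mul_eq_shiftedBalancedRatio (z P : K) (k : ℕ) :
    balancedRatio z P k * (1 - z ^ (2 * k + 1) / P) = (1 - z / P) * shiftedBalancedRatio z P k := by
  induction k with
  | zero => simp [balancedRatio, shiftedBalancedRatio]
  | succ k ih =>
    simp only [balancedRatio, shiftedBalancedRatio, prod_range_succ] at ih ⊢
    rw [show 2 * (k + 1) + 1 = 2 * k + 3 by ring]
    linear_combination ((1 - z ^ (2 * k + 2)) * (1 - z ^ (2 * k + 3) / P)) /
      ((1 - z ^ (2 * k + 3)) * (1 - z ^ (2 * k + 2) / P)) * ih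

theorem balancedRatio_div_mul_eq_shiftedBalancedRatio {z P : K} {M : ℕ}
    (h : ∀ j < M, 1 - z ^ (2 * j + 2) / P ≠ 0) {k : ℕ} (hk : k < M) :
    balancedRatio z (P / z ^ 2) k * (1 - z ^ (2 * k + 2) / P) =
      (1 - z ^ 2 / P) * shiftedBalancedRatio z P k := by
  induction k with
  | zero => simp [balancedRatio, shiftedBalancedRatio]
  | succ k ih =>
    have e1 := h _ hk
    have e2 := h k (by omega)
    specialize ih (by omega)
    simp only [balancedRatio, shiftedBalancedRatio, prod_range_succ] at ih ⊢
    have r1 : 1 - z ^ (2 * k + 1) / (P / z ^ 2) = 1 - z ^ (2 * k + 3) / P := by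
      field_simp; ring
    have r2 : 1 - z ^ (2 * k + 2) / (P / z ^ 2) = 1 - z ^ (2 * (k + 1) + 2) / P := by
      field_simp; ring
    rw [r1, r2, mul_comm (1 - z ^ (2 * k + 3)) (1 - z ^ (2 * (k + 1) + 2) / P), ← div_div,
      mul_comm (1 - z ^ (2 * k + 3)) (1 - z ^ (2 * k + 2) / P), ← div_div,
      mul_div_assoc, ← mul_assoc]
    generalize 1 - z ^ (2 * (k + 1) + 2) / P = a at *
    generalize 1 - z ^ (2 * k + 2) / P = b at *
    generalize 1 - z ^ (2 * k + 3) / P = c at *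
    generalize ∏ j ∈ range k, ((1 - z ^ (2 * j + 2)) * (1 - z ^ (2 * j + 1) / (P / z ^ 2))) /
      ((1 - z ^ (2 * j + 3)) * (1 - z ^ (2 * j + 2) / (P / z ^ 2))) = A at *
    rw [← ih]
    field_simp

theorem prod_range_one_sub_pow_div (z : K) (hz : ∀ m : ℕ, 0 < m → 1 - z ^ m ≠ 0) (M : ℕ) :
    ∏ j ∈ range M, z * (1 - z ^ (2 * j + 1)) / (1 - z ^ (2 * j + 3)) =
      z ^ M * (1 - z) / (1 - z ^ (2 * M + 1)) := by
  induction M with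
  | zero => simp [div_self (show 1 - z ≠ 0 by simpa using hz 1)]
  | succ M ih =>
    rw [prod_range_succ, ih]
    have := hz (2 * M + 1) (by omega)
    have := hz (2 * M + 3) (by omega)
    rw [show 2 * (M + 1) + 1 = 2 * M + 3 by ring, pow_succ z M]
    field_simp

theorem shiftedBalancedRatio_pow {z : K} (hz0 : z ≠ 0)
    (hz : ∀ m : ℕ, 0 < m → 1 - z ^ m ≠ 0) (M : ℕ) :
    shiftedBalancedRatio z (z ^ (2 * M + 2)) M = z ^ M * (1 - z) / (1 - z ^ (2 * M + 1)) := by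
  have h : ∏ j ∈ range M, (1 - z ^ (2 * j + 3) / z ^ (2 * M + 2)) /
      (1 - z ^ (2 * j + 2) / z ^ (2 * M + 2)) =
      ∏ j ∈ range M, z * (1 - z ^ (2 * j + 1)) / (1 - z ^ (2 * j + 2)) := by
    rw [← prod_range_reflect]
    refine prod_congr rfl fun j hj => ?_
    rw [mem_range] at hj
    obtain ⟨c, rfl⟩ := Nat.exists_eq_add_of_lt hj
    rw [show j + c + 1 - 1 - j = c by omega]
    have n1 := hz (2 * j + 2) (by omega)
    have n2 : 1 - z ^ (2 * c + 2) / z ^ (2 * (j + c + 1) + 2) ≠ 0 :=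
      one_sub_pow_div_pow_ne_zero hz0 hz (by omega)
    rw [div_eq_div_iff n2 n1]
    have h1 : z ^ (2 * c + 3) / z ^ (2 * (j + c + 1) + 2) = 1 / z ^ (2 * j + 1) := by
      field_simp; ring
    have h2 : z ^ (2 * c + 2) / z ^ (2 * (j + c + 1) + 2) = 1 / z ^ (2 * j + 2) := by
      field_simp; ring
    rw [h1, h2]
    field_simp
    ring
  rw [← prod_range_one_sub_pow_div z hz]
  simp only [shiftedBalancedRatio, mul_div_mul_comm, prod_mul_distrib]
  rw [h, ← prod_mul_distrib]
  refine prod_congr rfl fun j _ => ?_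
  have := hz (2 * j + 2) (by omega)
  field_simp

theorem sum_balancedRatio_sub {z P : K} (hz0 : z ≠ 0) (hz : ∀ m : ℕ, 0 < m → 1 - z ^ m ≠ 0)
    {M : ℕ} (hPdef : P = z ^ (2 * M + 2)) {N : ℕ} (hN : N ≤ M) :
    (1 - z * P) * (z / (1 - P) ^ 2) * ∑ k ∈ range N, z ^ (2 * k) *
        (balancedRatio z P k * ((1 - 1 / P) / (1 - z ^ (2 * k) / P))) -
      (1 - P / z) * (1 / (1 - P / z ^ 2) ^ 2) * ∑ k ∈ range N, z ^ (2 * k) *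
        (balancedRatio z (P / z ^ 2) k *
          ((1 - 1 / (P / z ^ 2)) / (1 - z ^ (2 * k) / (P / z ^ 2)))) =
      (z - P) * z / (1 - P) ^ 2 * ((1 - z ^ (2 * N) / P ^ 2) * shiftedBalancedRatio z P N *
        (1 - z ^ (2 * N + 1)) / ((1 - z ^ (2 * N + 1) / P) * (1 - z ^ (2 * N) / P))) +
      (1 - z) * z * (P + 1) / (1 - P) ^ 2 := by
  have hP : P ≠ 0 := hPdef ▸ pow_ne_zero _ hz0
  have n1 : 1 - P ≠ 0 := hPdef ▸ hz _ (by omega)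
  have h2 : ∀ a, a ≠ 2 * M + 2 → 1 - z ^ a / P ≠ 0 := fun a ha => by
    rw [hPdef]; exact one_sub_pow_div_pow_ne_zero hz0 hz ha
  induction N with
  | zero =>
    have m1 := h2 1 (by omega)
    have m2 : 1 - 1 / P ≠ 0 := by simpa using h2 0 (by omega)
    simp only [range_zero, sum_empty, shiftedBalancedRatio, prod_empty, mul_zero, pow_zero,
      zero_add, pow_one, sub_self] at *
    have m1' : P - z ≠ 0 := by
      intro h; apply m1; rw [sub_eq_zero.mp h, div_self hz0, sub_self]
    have m2' : P - 1 ≠ 0 := by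
      intro h; apply n1; linear_combination -h
    field_simp
    ring
  | succ k ih =>
    have n2 : 1 - P / z ^ 2 ≠ 0 := by
      rw [hPdef, pow_add, mul_div_assoc, div_self (pow_ne_zero _ hz0), mul_one]
      exact hz _ (by omega)
    have e1 := h2 (2 * k + 1) (by omega)
    have e2 := h2 (2 * k + 2) (by omega)
    have e3 := h2 (2 * k + 3) (by omega)
    have e4 := h2 (2 * k) (by omega)
    have e5 := hz (2 * k + 3) (by omega)
    have b1 := balancedRatio_mul_eq_shiftedBalancedRatio z P k
    have b2 := balancedRatio_div_mul_eq_shiftedBalancedRatio (M := M) (P := P)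
      (fun j hj => h2 _ (by omega)) (show k < M by omega)
    rw [← eq_div_iff e1] at b1
    rw [← eq_div_iff e2] at b2
    rw [sum_range_succ, sum_range_succ, mul_add, mul_add, add_sub_add_comm, ih (by omega), b1, b2]
    have hw : shiftedBalancedRatio z P (k + 1) = shiftedBalancedRatio z P k *
      (((1 - z ^ (2 * k + 2)) * (1 - z ^ (2 * k + 3) / P)) /
      ((1 - z ^ (2 * k + 3)) * (1 - z ^ (2 * k + 2) / P))) := by
      simp only [shiftedBalancedRatio, prod_range_succ]
    rw [hw, show 2 * (k + 1) + 1 = 2 * k + 3 by ring, show 2 * (k + 1) = 2 * k + 2 by ring]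
    generalize shiftedBalancedRatio z P k = w
    have e2' : 1 - z ^ (2 * k) / (P / z ^ 2) = 1 - z ^ (2 * k + 2) / P := by
      field_simp; ring
    rw [e2']
    have p1 : z ^ (2 * k + 1) = z ^ (2 * k) * z := by ring
    have p2 : z ^ (2 * k + 2) = z ^ (2 * k) * z ^ 2 := by ring
    have p3 : z ^ (2 * k + 3) = z ^ (2 * k) * z ^ 3 := by ring
    rw [p1] at e1 ⊢
    rw [p2] at e2 ⊢
    rw [p3] at e3 e5 ⊢
    clear b1 b2 hw e2' p1 p2 p3 ih h2
    generalize z ^ (2 * k) = y at *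
    have d1 : P - y * z ≠ 0 := by
      intro h; apply e1; rw [← sub_eq_zero.mp h, div_self hP, sub_self]
    have d2 : P - y * z ^ 2 ≠ 0 := by
      intro h; apply e2; rw [← sub_eq_zero.mp h, div_self hP, sub_self]
    have d3 : P - y * z ^ 3 ≠ 0 := by
      intro h; apply e3; rw [← sub_eq_zero.mp h, div_self hP, sub_self]
    have d4 : P - y ≠ 0 := by
      intro h; apply e4; rw [← sub_eq_zero.mp h, div_self hP, sub_self]
    have d5 : z ^ 2 - P ≠ 0 := by
      intro h; apply n2; rw [← sub_eq_zero.mp h, div_self (pow_ne_zero _ hz0), sub_self]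
    rw [mul_comm y] at d1 d2 d3 e5
    field_simp
    ring

theorem sum_div_sub_div_eq_sum_balancedRatio {z : K} (hz0 : z ≠ 0)
    (hz : ∀ m : ℕ, 0 < m → 1 - z ^ m ≠ 0) (M : ℕ) :
    ∑ i ∈ range M, (z ^ (i + 1) / (1 - z ^ (i + 1)) ^ 2 -
        z ^ (2 * i + 2) / (1 - z ^ (2 * i + 2)) ^ 2) =
      (1 - z ^ (2 * M + 1)) * z ^ M / ((1 - z) * (1 - z ^ (2 * M)) ^ 2) *
        ∑ k ∈ range M, z ^ (2 * k) * (balancedRatio z (z ^ (2 * M)) k *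
          ((1 - 1 / z ^ (2 * M)) / (1 - z ^ (2 * k) / z ^ (2 * M)))) := by
  induction M with
  | zero => simp
  | succ M ih =>
    obtain ⟨P, hPdef⟩ : ∃ P, P = z ^ (2 * M + 2) := ⟨_, rfl⟩
    have hP : P ≠ 0 := hPdef ▸ pow_ne_zero _ hz0
    have key := sum_balancedRatio_sub hz0 hz hPdef le_rfl
    have n1 : 1 - P ≠ 0 := hPdef ▸ hz _ (by omega)
    have n2 : 1 - z ≠ 0 := by simpa using hz 1
    have n3 : 1 - z * P ≠ 0 := by
      have := hz (2 * M + 3) (by omega)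
      rwa [show 2 * M + 3 = 1 + (2 * M + 2) by ring, pow_add, ← hPdef, pow_one] at this
    have n4 : 1 - z ^ 2 ≠ 0 := hz 2 (by omega)
    have n5 := hz (M + 1) (by omega)
    have x1 : z ^ (2 * (M + 1) + 1) = z * P := by rw [hPdef]; ring
    have x2 : z ^ (2 * (M + 1)) = P := by rw [hPdef]; ring
    have x3 : z ^ (2 * M) = P / z ^ 2 := by rw [hPdef]; field_simp; ring
    have x4 : z ^ (2 * M + 1) = P / z := by rw [hPdef]; field_simp; ring
    have n6 : 1 - z ^ (2 * M + 1) / P ≠ 0 := by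
      rw [hPdef]; exact one_sub_pow_div_pow_ne_zero hz0 hz (by omega)
    have hw := shiftedBalancedRatio_pow hz0 hz M
    have n7 := hz (2 * M + 1) (by omega)
    have hb := balancedRatio_mul_eq_shiftedBalancedRatio z P M
    rw [← eq_div_iff n6] at hb
    rw [← hPdef] at hw
    rw [sum_range_succ, sum_range_succ, ih, x1, x2, ← hPdef, hb]
    rw [hw] at key ⊢
    rw [x3, x4] at key ⊢
    rw [x4] at n6 n7
    have hPy : P = (z ^ (M + 1)) ^ 2 := by rw [hPdef]; ring
    have hy : z ^ (M + 1) = z ^ M * z := pow_succ _ _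
    generalize ∑ k ∈ range M, z ^ (2 * k) * (balancedRatio z P k *
      ((1 - 1 / P) / (1 - z ^ (2 * k) / P))) = S at *
    have n9 : P - z ≠ 0 := by
      intro h; apply hz (2 * M + 1) (by omega); rw [x4, sub_eq_zero.mp h, div_self hz0, sub_self]
    generalize ∑ k ∈ range M, z ^ (2 * k) * (balancedRatio z (P / z ^ 2) k *
      ((1 - 1 / (P / z ^ 2)) / (1 - z ^ (2 * k) / (P / z ^ 2)))) = T at *
    have hm : z ^ M ≠ 0 := pow_ne_zero _ hz0
    have hD : (1 - P / z) * z ^ M / ((1 - z) * (1 - P / z ^ 2) ^ 2) * T =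
        z ^ M / (1 - z) * ((1 - P / z) * (1 / (1 - P / z ^ 2) ^ 2) * T) := by
      rw [mul_comm (1 - P / z), mul_div_mul_comm]
      ring
    rw [hD]
    generalize (1 - P / z) * (1 / (1 - P / z ^ 2) ^ 2) * T = D at *
    rw [hy] at n5 hPy ⊢
    clear hPdef hb hw x1 x2 x3 x4 hy ih n6 n9 hD
    generalize z ^ M = m at *
    subst hPy
    have r1 : (m * z) ^ 2 / z = m ^ 2 * z := by field_simp
    have r2 : (m * z) ^ 2 / z ^ 2 = m ^ 2 := by field_simp
    have r3 : m ^ 2 / ((m * z) ^ 2) ^ 2 = 1 / (m ^ 2 * z ^ 4) := by field_simp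
    have r4 : m ^ 2 / (m * z) ^ 2 = 1 / z ^ 2 := by field_simp
    have r5 : m ^ 2 * z / (m * z) ^ 2 = 1 / z := by field_simp
    rw [r1] at n7
    rw [r1, r2, r3, r4, r5] at key
    rw [r1, r2, r4, r5]
    have n3' : z - 1 ≠ 0 := fun h => n2 (by linear_combination -h)
    have n4' : z ^ 2 - 1 ≠ 0 := fun h => n4 (by linear_combination -h)
    have n6 : 1 + m * z ≠ 0 := fun h => n1 (by linear_combination (1 - m * z) * h)
    have n9 : 1 - (m * z) ^ 2 = (1 - m * z) * (1 + m * z) := by ring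
    rw [n9] at key ⊢
    rw [sub_eq_iff_eq_add'] at key
    have hD : D = (1 - z * (m * z) ^ 2) * (z / ((1 - m * z) * (1 + m * z)) ^ 2) * S -
      ((z - (m * z) ^ 2) * z / ((1 - m * z) * (1 + m * z)) ^ 2 *
        ((1 - 1 / (m ^ 2 * z ^ 4)) * (m * (1 - z) / (1 - m ^ 2 * z)) * (1 - m ^ 2 * z) /
          ((1 - 1 / z) * (1 - 1 / z ^ 2))) +
      (1 - z) * z * ((m * z) ^ 2 + 1) / ((1 - m * z) * (1 + m * z)) ^ 2) := by
      linear_combination -key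
    rw [hD]
    field_simp
    ring

/-- The quotient `(z; z²)_k / (z²; z²)_k`. -/
def oddEvenRatio (z : K) (k : ℕ) : K :=
  ∏ j ∈ range k, (1 - z ^ (2 * j + 1)) / (1 - z ^ (2 * j + 2))

/-- The difference of the sums of `z^m / (1 - z^m)²` over the odd and the even `m ≤ 2k`. -/
def oddEvenSum (z : K) (k : ℕ) : K :=
  ∑ j ∈ range k, (z ^ (2 * j + 1) / (1 - z ^ (2 * j + 1)) ^ 2 -
    z ^ (2 * j + 2) / (1 - z ^ (2 * j + 2)) ^ 2)

theorem pow_div_one_sub_pow_sq_of_mul_eq_one {u v : K} (h : u * v = 1) :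
    u / (1 - u) ^ 2 = v / (1 - v) ^ 2 := by
  have hu : u ≠ 0 := left_ne_zero_of_mul_eq_one h
  have hv : v ≠ 0 := right_ne_zero_of_mul_eq_one h
  have h1 : (1 - u) ^ 2 = u ^ 2 * (1 - v) ^ 2 := by
    linear_combination (2 * u - u * v - 1) * h
  rw [h1]
  by_cases h0 : (1 - v) ^ 2 = 0
  · simp [h0]
  · have h2 : 1 - v ≠ 0 := fun h3 => h0 (by rw [h3]; ring)
    field_simp
    linear_combination -h

theorem oddEvenRatio_succ (z : K) (k : ℕ) : oddEvenRatio z (k + 1) =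
    oddEvenRatio z k * ((1 - z ^ (2 * k + 1)) / (1 - z ^ (2 * k + 2))) :=
  prod_range_succ _ k

theorem wellPoised_succ (z b : K) (k : ℕ) : wellPoised z b (k + 1) = wellPoised z b k *
    (((1 - z ^ (2 * k + 1) * b) * (1 - z ^ (2 * k + 1) / b)) /
      ((1 - z ^ (2 * k + 2) * b) * (1 - z ^ (2 * k + 2) / b))) :=
  prod_range_succ _ k

theorem wellPoised_one (z : K) (k : ℕ) : wellPoised z 1 k = oddEvenRatio z k ^ 2 := by
  simp only [wellPoised, oddEvenRatio, mul_one, div_one, ← prod_pow]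
  exact prod_congr rfl fun j _ => by rw [div_pow, sq, sq]

theorem sum_oddEvenRatio_pow_four_sub_eq {z : K} (hz0 : z ≠ 0)
    (hz : ∀ m : ℕ, 0 < m → 1 - z ^ m ≠ 0) (M : ℕ) {x t N : K} (hx : x = z ^ (2 * M + 1))
    (ht : t = 1 - x) (hN : N = (1 - z ^ (2 * M + 1)) / (1 - z)) :
    ∑ k ∈ range (M + 1), (1 - z ^ (4 * k + 1)) / (1 - z) * oddEvenRatio z k ^ 4 -
      (1 / z ^ M * (N - (N ^ 3 + N ^ 4 * (1 - z)) *
        ∑ k ∈ range M, z ^ (2 * k + 2) / ((1 - z ^ (2 * k + 2)) / (1 - z)) ^ 2) +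
      N ^ 4 * ∑ k ∈ range M, z ^ (2 * k + 2) /
        (((1 - z ^ (2 * k + 1)) / (1 - z)) ^ 3 * oddEvenRatio z k ^ 2)) =
    t ^ 4 * ((∑ k ∈ range (M + 1), (1 - z ^ (4 * k + 1)) / (1 - z) *
        ((oddEvenRatio z k ^ 2 - wellPoised z x k) / (t ^ 2 / x)) ^ 2) / x ^ 2 +
      t * (1 / (z ^ M * (1 - z)) * ((∑ i ∈ range M, z ^ (i + 1) * (1 + z ^ (2 * i + 2)) *
          z ^ (2 * i + 2) / ((1 - z ^ (2 * i + 2)) ^ 2 * ((1 - z ^ (2 * i + 2) * x) *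
            (1 - z ^ (2 * i + 2) / x)))) / x ^ 2 -
        (∑ i ∈ range M, z ^ (2 * i + 2) / (1 - z ^ (2 * i + 2)) ^ 2) / x)) +
      1 / (x * (1 - z) ^ 2) * (1 / z ^ M * (z ^ M / (1 - z ^ (2 * M)) ^ 2 *
          ∑ k ∈ range M, z ^ (2 * k) * (balancedRatio z (z ^ (2 * M)) k *
            ((1 - 1 / z ^ (2 * M)) / (1 - z ^ (2 * k) / z ^ (2 * M))))) -
        x * (∑ k ∈ range M, z ^ (2 * k + 2) /
          (((1 - z ^ (2 * k + 1)) / (1 - z)) ^ 3 * oddEvenRatio z k ^ 2)) / (1 - z) ^ 2)) := by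
  have hx0 : x ≠ 0 := hx ▸ pow_ne_zero _ hz0
  have ht0 : t ≠ 0 := by rw [ht, hx]; exact hz _ (by omega)
  have h1 : 1 - z ≠ 0 := by simpa using hz 1
  have hzM : z ^ M ≠ 0 := pow_ne_zero _ hz0
  have h2 : ∀ j : ℕ, 1 - z ^ (2 * j + 2) ≠ 0 := fun j => hz _ (by omega)
  have h3 : ∀ j : ℕ, 1 - z ^ (2 * j + 2) * x ≠ 0 := fun j => by
    rw [hx, ← pow_add]; exact hz _ (by omega)
  have h4 : ∀ j : ℕ, 1 - z ^ (2 * j + 2) / x ≠ 0 := fun j => by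
    rw [hx]; exact one_sub_pow_div_pow_ne_zero hz0 hz (by omega)
  have S1 := sum_wellPoised_mul_wellPoised hz0 hz (b := 1) one_ne_zero
    (by simpa using h2) (by simpa using h2) M
  have Sx := sum_wellPoised_mul_wellPoised hz0 hz (b := x) hx0 h3 h4 M
  have D := sum_div_sub_div_eq_sum_balancedRatio hz0 hz M
  rw [← hx, ← ht] at S1 Sx D
  rw [← hx, ← ht] at hN
  rw [show (1 : K) + 1 / 1 - 2 = 0 by norm_num, zero_mul, sub_zero, mul_one] at S1
  have hX : x + 1 / x - 2 = t ^ 2 / x := by rw [ht]; field_simp; ring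
  rw [hX] at Sx
  have hL : ∑ k ∈ range (M + 1), (1 - z ^ (4 * k + 1)) / (1 - z) * oddEvenRatio z k ^ 4 =
      (t ^ 2 / x) ^ 2 * ∑ k ∈ range (M + 1), (1 - z ^ (4 * k + 1)) / (1 - z) *
        ((oddEvenRatio z k ^ 2 - wellPoised z x k) / (t ^ 2 / x)) ^ 2 +
      (1 - z)⁻¹ * (2 * ∑ k ∈ range (M + 1), (1 - z ^ (4 * k + 1)) *
        (wellPoised z x k * wellPoised z 1 k) - ∑ k ∈ range (M + 1), (1 - z ^ (4 * k + 1)) *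
        (wellPoised z x k * wellPoised z x k)) := by
    simp only [mul_sum, ← sum_sub_distrib, ← sum_add_distrib]
    refine sum_congr rfl fun k _ => ?_
    rw [wellPoised_one]
    field_simp
    ring
  have hA : ∑ i ∈ range M, z ^ (i + 1) * (1 + z ^ (2 * i + 2)) /
      ((1 - z ^ (2 * i + 2) * x) * (1 - z ^ (2 * i + 2) / x)) =
      ∑ i ∈ range M, (z ^ (i + 1) / (1 - z ^ (i + 1)) ^ 2 -
        z ^ (2 * i + 2) / (1 - z ^ (2 * i + 2)) ^ 2) -
      ∑ i ∈ range M, z ^ (2 * i + 2) / (1 - z ^ (2 * i + 2)) ^ 2 +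
      t ^ 2 / x * ∑ i ∈ range M, z ^ (i + 1) * (1 + z ^ (2 * i + 2)) *
          z ^ (2 * i + 2) / ((1 - z ^ (2 * i + 2)) ^ 2 * ((1 - z ^ (2 * i + 2) * x) *
            (1 - z ^ (2 * i + 2) / x))) := by
    simp only [mul_sum, ← sum_sub_distrib, ← sum_add_distrib]
    refine sum_congr rfl fun i _ => ?_
    have e1 := h2 i
    have e2 := h3 i
    have e3 := h4 i
    have e4 := hz (i + 1) (by omega)
    have hu : z ^ (2 * i + 2) = (z ^ (i + 1)) ^ 2 := by ring
    rw [hu] at e1 e2 e3 ⊢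
    clear hu
    generalize z ^ (i + 1) = u at *
    have e5 : 1 + u ≠ 0 := fun h => e1 (by linear_combination (1 - u) * h)
    have e6 : x - u ^ 2 ≠ 0 := by
      intro h; apply e3; rw [← sub_eq_zero.mp h, div_self hx0, sub_self]
    rw [← hX, show 1 - u ^ 2 = (1 - u) * (1 + u) by ring,
      show 1 - u ^ 2 / x = (x - u ^ 2) / x by field_simp]
    field_simp
    ring
  have hh : ∑ k ∈ range M, z ^ (2 * k + 2) / ((1 - z ^ (2 * k + 2)) / (1 - z)) ^ 2 =
      (1 - z) ^ 2 * ∑ k ∈ range M, z ^ (2 * k + 2) / (1 - z ^ (2 * k + 2)) ^ 2 := by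
    rw [mul_sum]
    refine sum_congr rfl fun k _ => ?_
    have := h2 k
    field_simp
  have hΘ : ∑ i ∈ range M, (z ^ (i + 1) / (1 - z ^ (i + 1)) ^ 2 -
        z ^ (2 * i + 2) / (1 - z ^ (2 * i + 2)) ^ 2) = N * (z ^ M / (1 - z ^ (2 * M)) ^ 2 *
          ∑ k ∈ range M, z ^ (2 * k) * (balancedRatio z (z ^ (2 * M)) k *
            ((1 - 1 / z ^ (2 * M)) / (1 - z ^ (2 * k) / z ^ (2 * M))))) := by
    rw [D, hN, mul_div_mul_comm, mul_assoc]
  rw [hA, hΘ] at Sx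
  rw [hL, S1, Sx, hh]
  have hx' : x = 1 - t := by rw [ht]; ring
  generalize z ^ M / (1 - z ^ (2 * M)) ^ 2 * ∑ k ∈ range M, z ^ (2 * k) *
    (balancedRatio z (z ^ (2 * M)) k * ((1 - 1 / z ^ (2 * M)) /
      (1 - z ^ (2 * k) / z ^ (2 * M)))) = Θ
  generalize ∑ k ∈ range M, z ^ (2 * k + 2) / (1 - z ^ (2 * k + 2)) ^ 2 = H
  generalize ∑ k ∈ range M, z ^ (2 * k + 2) /
    (((1 - z ^ (2 * k + 1)) / (1 - z)) ^ 3 * oddEvenRatio z k ^ 2) = T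
  generalize ∑ i ∈ range M, z ^ (i + 1) * (1 + z ^ (2 * i + 2)) *
          z ^ (2 * i + 2) / ((1 - z ^ (2 * i + 2)) ^ 2 * ((1 - z ^ (2 * i + 2) * x) *
            (1 - z ^ (2 * i + 2) / x))) = Q
  generalize ∑ k ∈ range (M + 1), (1 - z ^ (4 * k + 1)) / (1 - z) *
        ((oddEvenRatio z k ^ 2 - wellPoised z x k) / (t ^ 2 / x)) ^ 2 = R
  rw [hN]
  clear hx hN ht S1 Sx D hX hL hA hh hΘ h2 h3 h4
  generalize z ^ M = m at *
  rw [hx'] at hx0 ⊢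
  field_simp
  ring

variable {ζ : K} {M : ℕ}

theorem one_sub_pow_ne_zero_of_lt {n : ℕ} (hζ : IsPrimitiveRoot ζ n) {m : ℕ} (h0 : m ≠ 0)
    (h : m < n) : 1 - ζ ^ m ≠ 0 :=
  sub_ne_zero.mpr (hζ.pow_ne_one_of_pos_of_lt h0 h).symm

theorem oddEvenRatio_reflect (hζ : IsPrimitiveRoot ζ (2 * M + 1)) (k : ℕ) :
    ∀ j, k + j = M → oddEvenRatio ζ j = oddEvenRatio ζ M * ζ ^ k * oddEvenRatio ζ k := by
  induction k with
  | zero => intro j hj; simp at hj; simp [hj, oddEvenRatio]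
  | succ k ih =>
    intro j hj
    have h := ih (j + 1) (by omega)
    rw [oddEvenRatio, prod_range_succ] at h
    rw [oddEvenRatio, oddEvenRatio, oddEvenRatio, prod_range_succ _ k]
    rw [oddEvenRatio, oddEvenRatio] at h
    have h1 := one_sub_pow_ne_zero_of_lt hζ (m := 2 * j + 1) (by omega) (by omega)
    have h2 := one_sub_pow_ne_zero_of_lt hζ (m := 2 * j + 2) (by omega) (by omega)
    have h3 := one_sub_pow_ne_zero_of_lt hζ (m := 2 * k + 2) (by omega) (by omega)
    have h4 : ζ ^ (2 * k + 1) * ζ ^ (2 * j + 2) = 1 := by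
      rw [← pow_add, ← hζ.pow_eq_one]; congr 1; omega
    have h5 : ζ ^ (2 * k + 2) * ζ ^ (2 * j + 1) = 1 := by
      rw [← pow_add, ← hζ.pow_eq_one]; congr 1; omega
    have h6 : (1 - ζ ^ (2 * j + 2)) * (1 - ζ ^ (2 * k + 2)) =
        ζ * ((1 - ζ ^ (2 * j + 1)) * (1 - ζ ^ (2 * k + 1))) := by
      linear_combination h5 * ζ - h4
    rw [mul_div_assoc', div_eq_iff h2] at h
    apply mul_right_cancel₀ h1
    rw [h, pow_succ]
    field_simp
    linear_combination (∏ j ∈ range M, (1 - ζ ^ (2 * j + 1)) / (1 - ζ ^ (2 * j + 2))) * ζ ^ k *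
      (∏ j ∈ range k, (1 - ζ ^ (2 * j + 1)) / (1 - ζ ^ (2 * j + 2))) * h6

theorem oddEvenRatio_pow_four (hζ : IsPrimitiveRoot ζ (2 * M + 1)) : oddEvenRatio ζ M ^ 4 = ζ := by
  have h := oddEvenRatio_reflect hζ M 0 (by omega)
  have h0 : oddEvenRatio ζ 0 = 1 := by simp [oddEvenRatio]
  rw [h0] at h
  have h1 := hζ.pow_eq_one
  have h2 : oddEvenRatio ζ M ^ 4 * ζ ^ (2 * M) = 1 := by
    calc _ = (oddEvenRatio ζ M * ζ ^ M * oddEvenRatio ζ M) ^ 2 := by ring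
      _ = 1 := by rw [← h]; ring
  calc _ = oddEvenRatio ζ M ^ 4 * ζ ^ (2 * M + 1) := by rw [h1, mul_one]
    _ = (oddEvenRatio ζ M ^ 4 * ζ ^ (2 * M)) * ζ := by ring
    _ = ζ := by rw [h2, one_mul]

variable [CharZero K]

theorem oddEvenSum_reflect (hζ : IsPrimitiveRoot ζ (2 * M + 1)) {k j : ℕ} (hkj : k + j = M) :
    oddEvenSum ζ j = oddEvenSum ζ k := by
  have main : ∀ k j, k + j = M → oddEvenSum ζ j = oddEvenSum ζ M + oddEvenSum ζ k := by
    intro k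
    induction k with
    | zero => intro j hj; simp at hj; simp [hj, oddEvenSum]
    | succ k ih =>
      intro j hj
      have h := ih (j + 1) (by omega)
      have h4 : ζ ^ (2 * k + 1) * ζ ^ (2 * j + 2) = 1 := by
        rw [← pow_add, ← hζ.pow_eq_one]; congr 1; omega
      have h5 : ζ ^ (2 * k + 2) * ζ ^ (2 * j + 1) = 1 := by
        rw [← pow_add, ← hζ.pow_eq_one]; congr 1; omega
      have h6 := pow_div_one_sub_pow_sq_of_mul_eq_one h4
      have h7 := pow_div_one_sub_pow_sq_of_mul_eq_one h5
      have s : ∀ i, oddEvenSum ζ (i + 1) = oddEvenSum ζ i +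
        (ζ ^ (2 * i + 1) / (1 - ζ ^ (2 * i + 1)) ^ 2 -
          ζ ^ (2 * i + 2) / (1 - ζ ^ (2 * i + 2)) ^ 2) := fun i => sum_range_succ _ _
      rw [s] at h ⊢
      linear_combination h - h6 + h7
  have h0 := main M 0 (by omega)
  have h1 : oddEvenSum ζ 0 = 0 := by simp [oddEvenSum]
  rw [h1] at h0
  have h2 : oddEvenSum ζ M = 0 := by
    have : (2 : K) * oddEvenSum ζ M = 0 := by linear_combination -h0
    simpa using this
  rw [main k j hkj, h2, zero_add]

theorem sum_oddEvenRatio_pow_four_mul_eq_zero (hζ : IsPrimitiveRoot ζ (2 * M + 1)) (w : ℕ → K)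
    (hw : ∀ k j, k + j = M → w j = w k) :
    ∑ k ∈ range (M + 1), (1 - ζ ^ (4 * k + 1)) * oddEvenRatio ζ k ^ 4 * w k = 0 := by
  have key : ∑ k ∈ range (M + 1), (1 - ζ ^ (4 * k + 1)) * oddEvenRatio ζ k ^ 4 * w k =
      -∑ k ∈ range (M + 1), (1 - ζ ^ (4 * k + 1)) * oddEvenRatio ζ k ^ 4 * w k := by
    conv_lhs => rw [← sum_range_reflect]
    rw [← sum_neg_distrib]
    refine sum_congr rfl fun k hk => ?_
    rw [mem_range] at hk
    obtain ⟨j, hj⟩ : ∃ j, k + j = M := ⟨M - k, by omega⟩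
    rw [show M + 1 - 1 - k = j by omega, oddEvenRatio_reflect hζ k j hj, hw k j hj, mul_pow,
      mul_pow, oddEvenRatio_pow_four hζ]
    have h5 : ζ ^ (4 * k + 1) * ζ ^ (4 * j + 1) = 1 := by
      rw [← pow_add, show 4 * k + 1 + (4 * j + 1) = (2 * M + 1) * 2 by omega, pow_mul,
        hζ.pow_eq_one, one_pow]
    have h6 : ζ * (ζ ^ k) ^ 4 = ζ ^ (4 * k + 1) := by ring
    linear_combination ((1 - ζ ^ (4 * j + 1)) * oddEvenRatio ζ k ^ 4 * w k) * h6 -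
      oddEvenRatio ζ k ^ 4 * w k * h5
  have : (2 : K) * ∑ k ∈ range (M + 1), (1 - ζ ^ (4 * k + 1)) * oddEvenRatio ζ k ^ 4 * w k = 0 := by
    linear_combination key
  simpa using this

end Field

/-- The rational function `A` is regular at `ζ` with value `v`. -/
def EvalsTo (ζ : ℂ) (A : RatFunc ℚ) (v : ℂ) : Prop :=
  ∃ c e : ℚ[X], aeval ζ e ≠ 0 ∧
    A * algebraMap ℚ[X] (RatFunc ℚ) e = algebraMap ℚ[X] (RatFunc ℚ) c ∧
    v * aeval ζ e = aeval ζ c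

namespace EvalsTo

variable {ζ v w : ℂ} {A B : RatFunc ℚ}

theorem congr (h : EvalsTo ζ A v) (hA : A = B) (hv : v = w) : EvalsTo ζ B w := by
  rwa [← hA, ← hv]

theorem polynomial (c : ℚ[X]) : EvalsTo ζ (algebraMap ℚ[X] (RatFunc ℚ) c) (aeval ζ c) :=
  ⟨c, 1, by simp, by simp, by simp⟩

theorem X : EvalsTo ζ RatFunc.X ζ := by simpa using polynomial (ζ := ζ) Polynomial.X

theorem one : EvalsTo ζ 1 1 := by simpa using polynomial (ζ := ζ) 1

theorem zero : EvalsTo ζ 0 0 := by simpa using polynomial (ζ := ζ) 0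

theorem add (hA : EvalsTo ζ A v) (hB : EvalsTo ζ B w) : EvalsTo ζ (A + B) (v + w) := by
  obtain ⟨c, e, he, h1, h2⟩ := hA
  obtain ⟨c', e', he', h1', h2'⟩ := hB
  refine ⟨c * e' + c' * e, e * e', by simp [he, he'], ?_, ?_⟩
  · simp only [map_mul, map_add, ← h1, ← h1']; ring
  · simp only [map_mul, map_add, ← h2, ← h2']; ring

theorem mul (hA : EvalsTo ζ A v) (hB : EvalsTo ζ B w) : EvalsTo ζ (A * B) (v * w) := by
  obtain ⟨c, e, he, h1, h2⟩ := hA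
  obtain ⟨c', e', he', h1', h2'⟩ := hB
  refine ⟨c * c', e * e', by simp [he, he'], ?_, ?_⟩
  · simp only [map_mul, ← h1, ← h1']; ring
  · simp only [map_mul, ← h2, ← h2']; ring

theorem neg (hA : EvalsTo ζ A v) : EvalsTo ζ (-A) (-v) := by
  obtain ⟨c, e, he, h1, h2⟩ := hA
  refine ⟨-c, e, he, ?_, ?_⟩
  · simp only [map_neg, ← h1]; ring
  · simp only [map_neg, ← h2]; ring

theorem sub (hA : EvalsTo ζ A v) (hB : EvalsTo ζ B w) : EvalsTo ζ (A - B) (v - w) := by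
  rw [sub_eq_add_neg, sub_eq_add_neg]; exact hA.add hB.neg

theorem inv (hA : EvalsTo ζ A v) (hv : v ≠ 0) : EvalsTo ζ A⁻¹ v⁻¹ := by
  obtain ⟨c, e, he, h1, h2⟩ := hA
  have hc : aeval ζ c ≠ 0 := by rw [← h2]; exact mul_ne_zero hv he
  have hc0 : algebraMap ℚ[X] (RatFunc ℚ) c ≠ 0 := by
    rw [Ne, FaithfulSMul.algebraMap_eq_zero_iff]; rintro rfl; simp at hc
  have hA0 : A ≠ 0 := by rintro rfl; apply hc0; rw [← h1, zero_mul]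
  refine ⟨e, c, hc, ?_, ?_⟩
  · rw [← h1]; field_simp
  · rw [← h2]; field_simp

theorem div (hA : EvalsTo ζ A v) (hB : EvalsTo ζ B w) (hw : w ≠ 0) :
    EvalsTo ζ (A / B) (v / w) := by
  rw [div_eq_mul_inv, div_eq_mul_inv]; exact hA.mul (hB.inv hw)

theorem pow (hA : EvalsTo ζ A v) (m : ℕ) : EvalsTo ζ (A ^ m) (v ^ m) := by
  induction m with
  | zero => simpa using one
  | succ m ih => rw [pow_succ, pow_succ]; exact ih.mul hA

theorem sum {s : Finset ℕ} {A : ℕ → RatFunc ℚ} {v : ℕ → ℂ} (h : ∀ i ∈ s, EvalsTo ζ (A i) (v i)) :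
    EvalsTo ζ (∑ i ∈ s, A i) (∑ i ∈ s, v i) := by
  induction s using Finset.induction_on with
  | empty => simpa using zero
  | insert a s ha ih =>
    rw [sum_insert ha, sum_insert ha]
    exact (h a (mem_insert_self a s)).add (ih fun i hi => h i (mem_insert_of_mem hi))

theorem prod {s : Finset ℕ} {A : ℕ → RatFunc ℚ} {v : ℕ → ℂ}
    (h : ∀ i ∈ s, EvalsTo ζ (A i) (v i)) : EvalsTo ζ (∏ i ∈ s, A i) (∏ i ∈ s, v i) := by
  induction s using Finset.induction_on with
  | empty => simpa using one
  | insert a s ha ih =>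
    rw [prod_insert ha, prod_insert ha]
    exact (h a (mem_insert_self a s)).mul (ih fun i hi => h i (mem_insert_of_mem hi))

theorem sum_zero {s : Finset ℕ} {A : ℕ → RatFunc ℚ} (h : ∀ i ∈ s, EvalsTo ζ (A i) 0) :
    EvalsTo ζ (∑ i ∈ s, A i) 0 := by
  simpa using sum h

theorem one_sub_X_pow (m : ℕ) : EvalsTo ζ (1 - RatFunc.X ^ m) (1 - ζ ^ m) := one.sub (X.pow m)

end EvalsTo

/-- `E = P ^ m * c / e` with `e` coprime to `P`. -/
def PowDivides (P : ℚ[X]) (m : ℕ) (E : RatFunc ℚ) : Prop :=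
  ∃ c e : ℚ[X], IsCoprime e P ∧
    E * algebraMap ℚ[X] (RatFunc ℚ) e = algebraMap ℚ[X] (RatFunc ℚ) (P ^ m * c)

theorem PowDivides.mul {P : ℚ[X]} {m l : ℕ} {A B : RatFunc ℚ} (hA : PowDivides P m A)
    (hB : PowDivides P l B) : PowDivides P (m + l) (A * B) := by
  obtain ⟨c, e, he, h⟩ := hA
  obtain ⟨c', e', he', h'⟩ := hB
  refine ⟨c * c', e * e', he.mul_left he', ?_⟩
  rw [show P ^ (m + l) * (c * c') = (P ^ m * c) * (P ^ l * c') by ring, map_mul, map_mul _ (P ^ m * c),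
    ← h, ← h']
  ring

theorem PowDivides.pow {P : ℚ[X]} {A : RatFunc ℚ} (hA : PowDivides P 1 A) (k : ℕ) :
    PowDivides P k (A ^ k) := by
  induction k with
  | zero => exact ⟨1, 1, isCoprime_one_left, by simp⟩
  | succ k ih => rw [pow_succ]; exact ih.mul hA

theorem EvalsTo.powDivides {ζ : ℂ} {d : ℕ} (hζ : IsPrimitiveRoot ζ d) (hd : 0 < d)
    {A : RatFunc ℚ} (h : EvalsTo ζ A 0) : PowDivides (cyclotomic d ℚ) 1 A := by
  obtain ⟨c, e, he, h1, h2⟩ := h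
  rw [zero_mul] at h2
  have hmin := cyclotomic_eq_minpoly_rat hζ hd
  obtain ⟨c', rfl⟩ : cyclotomic d ℚ ∣ c := hmin ▸ minpoly.dvd ℚ ζ h2.symm
  refine ⟨c', e, ?_, by rw [h1, pow_one]⟩
  refine ((cyclotomic.irreducible_rat hd).coprime_iff_not_dvd.mpr fun hdvd => he ?_).symm
  obtain ⟨r, rfl⟩ := hdvd
  rw [hmin]; simp

theorem PowDivides.dvd_num {P : ℚ[X]} {m : ℕ} {E : RatFunc ℚ}
    (h : PowDivides P m E) : P ^ m ∣ E.num ∧ IsCoprime E.denom (P ^ m) := by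
  obtain ⟨c, e, he, h⟩ := h
  have hE := RatFunc.num_div_denom E
  have hd : algebraMap ℚ[X] (RatFunc ℚ) E.denom ≠ 0 := by
    simpa [FaithfulSMul.algebraMap_eq_zero_iff] using E.denom_ne_zero
  have h2 : E.num * e = P ^ m * c * E.denom := by
    apply FaithfulSMul.algebraMap_injective ℚ[X] (RatFunc ℚ)
    rw [map_mul, map_mul _ (P ^ m * c), ← h]
    nth_rewrite 2 [← hE]
    field_simp
  have hcop := E.isCoprime_num_denom
  refine ⟨(he.symm.pow_left (m := m)).dvd_of_dvd_mul_right ⟨c * E.denom, by rw [h2]; ring⟩, ?_⟩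
  have : E.denom ∣ e := hcop.symm.dvd_of_dvd_mul_left ⟨P ^ m * c, by rw [h2]; ring⟩
  exact (he.of_isCoprime_of_dvd_left this).pow_right

theorem exists_eq_div_of_powDivides {n : ℕ} (hn : 0 < n) (hn1 : n ≠ 1) {E : RatFunc ℚ}
    (h5 : PowDivides (cyclotomic n ℚ) 5 E)
    (h1 : ∀ d ∈ n.divisors, d ≠ 1 → d ≠ n → PowDivides (cyclotomic d ℚ) 1 E) :
    ∃ c e : ℚ[X], IsCoprime e (qintPoly n * cyclotomic n ℚ ^ 4) ∧
      E = algebraMap ℚ[X] (RatFunc ℚ) (qintPoly n * cyclotomic n ℚ ^ 4 * c) /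
        algebraMap ℚ[X] (RatFunc ℚ) e := by
  classical
  have hP : qintPoly n * cyclotomic n ℚ ^ 4 =
      ∏ d ∈ n.divisors.erase 1, cyclotomic d ℚ ^ (if d = n then 5 else 1) := by
    have hmem : n ∈ n.divisors.erase 1 := by simp [hn1, hn.ne']
    rw [qintPoly, ← prod_cyclotomic_eq_geom_sum hn, ← mul_prod_erase _ _ hmem,
      ← mul_prod_erase _ (fun d => cyclotomic d ℚ ^ (if d = n then 5 else 1)) hmem, if_pos rfl,
      prod_congr rfl (g := fun d => cyclotomic d ℚ ^ (if d = n then 5 else 1)) fun d hd => by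
        rw [if_neg (ne_of_mem_erase hd), pow_one]]
    ring
  have hall : ∀ d ∈ n.divisors.erase 1, cyclotomic d ℚ ^ (if d = n then 5 else 1) ∣ E.num ∧
      IsCoprime E.denom (cyclotomic d ℚ ^ (if d = n then 5 else 1)) := by
    intro d hd
    apply PowDivides.dvd_num
    split_ifs with h
    · rwa [h]
    · exact h1 d (mem_of_mem_erase hd) (ne_of_mem_erase hd) h
  have hdvd : qintPoly n * cyclotomic n ℚ ^ 4 ∣ E.num := by
    rw [hP]
    refine Finset.prod_dvd_of_coprime (fun a _ b _ hab => ?_) fun d hd => (hall d hd).1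
    exact (cyclotomic.isCoprime_rat hab).pow
  obtain ⟨c, hc⟩ := hdvd
  refine ⟨c, E.denom, ?_, ?_⟩
  · rw [hP]
    exact IsCoprime.prod_right fun d hd => (hall d hd).2
  · rw [← hc, RatFunc.num_div_denom]

/-- The rational function `A` has order exactly `m` in `1 - X ^ d` at `ζ`. -/
def HasOrder (ζ : ℂ) (d : ℕ) (A : RatFunc ℚ) (m : ℤ) : Prop :=
  ∃ v ≠ 0, EvalsTo ζ (A / (1 - RatFunc.X ^ d) ^ m) v

theorem one_sub_X_pow_ne_zero (m : ℕ) (hm : 0 < m) : (1 : RatFunc ℚ) - RatFunc.X ^ m ≠ 0 := by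
  intro h
  have h1 : (RatFunc.X : RatFunc ℚ) ^ m = 1 := (sub_eq_zero.mp h).symm
  rw [← RatFunc.algebraMap_X, ← map_pow, ← map_one (algebraMap ℚ[X] (RatFunc ℚ))] at h1
  have h2 := FaithfulSMul.algebraMap_injective ℚ[X] (RatFunc ℚ) h1
  have h3 := congrArg natDegree h2
  simp at h3
  omega

namespace HasOrder

variable {ζ : ℂ} {d : ℕ} {A B : RatFunc ℚ} {m l : ℤ}

theorem mul (hd : 0 < d) (hA : HasOrder ζ d A m) (hB : HasOrder ζ d B l) :
    HasOrder ζ d (A * B) (m + l) := by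
  obtain ⟨v, hv, h⟩ := hA
  obtain ⟨w, hw, h'⟩ := hB
  refine ⟨v * w, mul_ne_zero hv hw, ?_⟩
  rw [zpow_add₀ (one_sub_X_pow_ne_zero d hd), mul_div_mul_comm]
  exact h.mul h'

theorem inv (hA : HasOrder ζ d A m) : HasOrder ζ d A⁻¹ (-m) := by
  obtain ⟨v, hv, h⟩ := hA
  refine ⟨v⁻¹, inv_ne_zero hv, (h.inv hv).congr ?_ rfl⟩
  rw [zpow_neg, inv_div, div_inv_eq_mul, div_eq_mul_inv, mul_comm]

theorem div (hd : 0 < d) (hA : HasOrder ζ d A m) (hB : HasOrder ζ d B l) :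
    HasOrder ζ d (A / B) (m - l) := by
  rw [div_eq_mul_inv, sub_eq_add_neg]; exact hA.mul hd hB.inv

theorem of_evalsTo {v : ℂ} (hA : EvalsTo ζ A v) (hv : v ≠ 0) : HasOrder ζ d A 0 :=
  ⟨v, hv, by simpa using hA⟩

theorem one_sub_X_pow (hζ : IsPrimitiveRoot ζ d) (hd : 0 < d) {i : ℕ} (hi : 0 < i) :
    HasOrder ζ d (1 - RatFunc.X ^ i) (if d ∣ i then 1 else 0) := by
  split_ifs with h
  · obtain ⟨c, rfl⟩ := h
    have hc : c ≠ 0 := by rintro rfl; simp at hi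
    refine ⟨c, by exact_mod_cast hc, ?_⟩
    refine (EvalsTo.sum (s := range c) fun j _ => (EvalsTo.X.pow d).pow j).congr ?_ ?_
    · rw [zpow_one, eq_div_iff (one_sub_X_pow_ne_zero d hd), pow_mul]
      exact geom_sum_mul_neg _ _
    · simp [hζ.pow_eq_one]
  · refine of_evalsTo (EvalsTo.one_sub_X_pow i) (sub_ne_zero.mpr fun h1 => h ?_)
    exact hζ.dvd_of_pow_eq_one i h1.symm

theorem oddEvenRatio (hζ : IsPrimitiveRoot ζ d) {h : ℕ} (hd : d = 2 * h + 1) (k : ℕ) :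
    HasOrder ζ d (oddEvenRatio RatFunc.X k) (((k + h) / d : ℕ) - (k / d : ℕ)) := by
  have hd0 : 0 < d := by omega
  induction k with
  | zero =>
    rw [zero_add, Nat.div_eq_of_lt (by omega), Nat.zero_div]
    simpa [_root_.oddEvenRatio] using of_evalsTo (d := d) (ζ := ζ) EvalsTo.one one_ne_zero
  | succ k ih =>
    rw [_root_.oddEvenRatio, prod_range_succ]
    have h1 : d ∣ 2 * k + 1 ↔ d ∣ k + h + 1 := by
      rw [← (Nat.Coprime.dvd_mul_left (k := d) (m := 2) (n := k + h + 1)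
        (by rw [hd]; simp)), ← Nat.dvd_add_self_right,
        show 2 * k + 1 + d = 2 * (k + h + 1) by omega]
    have h2 : d ∣ 2 * k + 2 ↔ d ∣ k + 1 := by
      rw [← (Nat.Coprime.dvd_mul_left (k := d) (m := 2) (n := k + 1)
        (by rw [hd]; simp)), show 2 * k + 2 = 2 * (k + 1) by ring]
    have := ih.mul hd0 ((one_sub_X_pow hζ hd0 (i := 2 * k + 1) (by omega)).div hd0
      (one_sub_X_pow hζ hd0 (i := 2 * k + 2) (by omega)))
    rw [_root_.oddEvenRatio] at this
    convert this using 1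
    rw [show k + 1 + h = k + h + 1 by ring, Nat.succ_div, Nat.succ_div]
    simp only [h1, h2]
    push_cast
    ring

theorem evalsTo_zero (hd : 0 < d) (hζ : IsPrimitiveRoot ζ d) (hA : HasOrder ζ d A m) (hm : 0 < m) :
    EvalsTo ζ A 0 := by
  obtain ⟨v, hv, h⟩ := hA
  obtain ⟨a, rfl⟩ := Int.eq_ofNat_of_zero_le hm.le
  refine (h.mul ((EvalsTo.one_sub_X_pow d).pow a)).congr ?_ ?_
  · rw [zpow_natCast, div_mul_cancel₀]
    exact pow_ne_zero _ (one_sub_X_pow_ne_zero d hd)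
  · rw [hζ.pow_eq_one, sub_self, zero_pow (by omega), mul_zero]

theorem exists_evalsTo (hd : 0 < d) (hA : HasOrder ζ d A m) (hm : 0 ≤ m) :
    ∃ v, EvalsTo ζ A v := by
  obtain ⟨v, hv, h⟩ := hA
  obtain ⟨a, rfl⟩ := Int.eq_ofNat_of_zero_le hm
  refine ⟨_, (h.mul ((EvalsTo.one_sub_X_pow d).pow a)).congr ?_ rfl⟩
  rw [zpow_natCast, div_mul_cancel₀]
  exact pow_ne_zero _ (one_sub_X_pow_ne_zero d hd)

end HasOrder

section ProperDivisor

variable {ζ : ℂ} {d h : ℕ}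

theorem evalsTo_sum_block (hζ : IsPrimitiveRoot ζ d) (hd : d = 2 * h + 1) (h0 : 0 < h) (a : ℕ) :
    EvalsTo ζ (∑ r ∈ range (h + 1), (1 - RatFunc.X ^ (4 * (a * d + r) + 1)) / (1 - RatFunc.X) *
      oddEvenRatio RatFunc.X (a * d + r) ^ 4) 0 := by
  have hd0 : 0 < d := by omega
  have hc : ∃ v, EvalsTo ζ (oddEvenRatio RatFunc.X (a * d)) v := by
    refine (HasOrder.oddEvenRatio hζ hd (a * d)).exists_evalsTo hd0 ?_
    have : a * d / d ≤ (a * d + h) / d := Nat.div_le_div_right (by omega)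
    omega
  obtain ⟨v, hv⟩ := hc
  have hpow : ∀ i, ζ ^ (a * d + i) = ζ ^ i := fun i => by
    rw [pow_add, mul_comm a, pow_mul, hζ.pow_eq_one, one_pow, one_mul]
  have hratio : ∀ r ≤ h, EvalsTo ζ (oddEvenRatio RatFunc.X (a * d + r))
      (v * oddEvenRatio ζ r) := by
    intro r hr
    rw [oddEvenRatio, prod_range_add]
    refine hv.mul (EvalsTo.prod fun j hj => ?_)
    rw [mem_range] at hj
    refine ((EvalsTo.one_sub_X_pow (2 * (a * d + j) + 1)).div
      (EvalsTo.one_sub_X_pow (2 * (a * d + j) + 2)) ?_).congr rfl ?_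
    · rw [show 2 * (a * d + j) + 2 = a * d + (a * d + (2 * j + 2)) by ring, hpow, hpow]
      exact one_sub_pow_ne_zero_of_lt hζ (by omega) (by omega)
    · rw [show 2 * (a * d + j) + 2 = a * d + (a * d + (2 * j + 2)) by ring, hpow, hpow,
        show 2 * (a * d + j) + 1 = a * d + (a * d + (2 * j + 1)) by ring, hpow, hpow]
  have h1 : 1 - ζ ≠ 0 := by
    simpa using one_sub_pow_ne_zero_of_lt hζ (m := 1) (by omega) (by omega)
  refine (EvalsTo.sum fun r hr => ((EvalsTo.one_sub_X_pow _).div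
    (EvalsTo.one.sub EvalsTo.X) h1).mul ((hratio r ?_).pow 4)).congr rfl ?_
  · rw [mem_range] at hr; omega
  · subst hd
    have key := sum_oddEvenRatio_pow_four_mul_eq_zero hζ (fun _ => 1) fun _ _ _ => rfl
    rw [← mul_zero (v ^ 4 / (1 - ζ)), ← key, mul_sum]
    refine sum_congr rfl fun r _ => ?_
    rw [show 4 * (a * (2 * h + 1) + r) + 1 = a * (2 * h + 1) + (a * (2 * h + 1) +
      (a * (2 * h + 1) + (a * (2 * h + 1) + (4 * r + 1)))) by ring, hpow, hpow, hpow, hpow]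
    field_simp

theorem evalsTo_sum_blocks (hζ : IsPrimitiveRoot ζ d) (hd : d = 2 * h + 1) (h0 : 0 < h) (a : ℕ) :
    EvalsTo ζ (∑ k ∈ range (a * d), (1 - RatFunc.X ^ (4 * k + 1)) / (1 - RatFunc.X) *
      oddEvenRatio RatFunc.X k ^ 4) 0 := by
  have hd0 : 0 < d := by omega
  have h1 : 1 - ζ ≠ 0 := by
    simpa using one_sub_pow_ne_zero_of_lt hζ (m := 1) (by omega) (by omega)
  induction a with
  | zero => simpa using EvalsTo.zero
  | succ a ih =>
    rw [show (a + 1) * d = a * d + (h + 1) + h by rw [add_mul, hd]; ring, sum_range_add,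
      sum_range_add]
    refine ((ih.add (evalsTo_sum_block hζ hd h0 a)).add
      (EvalsTo.sum_zero fun r hr => ?_)).congr rfl (by ring)
    rw [mem_range] at hr
    have hc : EvalsTo ζ (oddEvenRatio RatFunc.X (a * d + (h + 1) + r)) 0 := by
      refine (HasOrder.oddEvenRatio hζ hd _).evalsTo_zero hd0 hζ ?_
      have e1 : (a * d + (h + 1) + r) / d = a := by
        rw [Nat.div_eq_iff hd0]; constructor <;> lia
      have e2 : (a * d + (h + 1) + r + h) / d = a + 1 := by
        rw [Nat.div_eq_iff hd0]; constructor <;> lia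
      rw [e1, e2]
      push_cast; linarith
    exact (((EvalsTo.one_sub_X_pow _).div (EvalsTo.one.sub EvalsTo.X) h1).mul
      (hc.pow 4)).congr rfl (by simp)

variable {M m : ℕ}

theorem evalsTo_sum_oddEvenRatio_pow_four (hζ : IsPrimitiveRoot ζ d) (hd1 : d ≠ 1)
    (hdM : 2 * M + 1 = d * m) :
    EvalsTo ζ (∑ k ∈ range (M + 1), (1 - RatFunc.X ^ (4 * k + 1)) / (1 - RatFunc.X) *
      oddEvenRatio RatFunc.X k ^ 4) 0 := by
  have hodd : Odd (d * m) := ⟨M, hdM.symm⟩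
  obtain ⟨h, hd⟩ := (Nat.odd_mul.mp hodd).1
  obtain ⟨a, hm⟩ := (Nat.odd_mul.mp hodd).2
  have hM : M + 1 = a * d + (h + 1) := by
    rw [hm] at hdM
    have : d * (2 * a + 1) = 2 * (a * d) + d := by ring
    omega
  rw [hM, sum_range_add]
  simpa using (evalsTo_sum_blocks hζ hd (by omega) a).add
    (evalsTo_sum_block hζ hd (by omega) a)

theorem evalsTo_closedForm (hζ : IsPrimitiveRoot ζ d) (hd1 : d ≠ 1) (hdM : 2 * M + 1 = d * m) :
    EvalsTo ζ (1 / RatFunc.X ^ M * ((1 - RatFunc.X ^ (2 * M + 1)) / (1 - RatFunc.X) -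
      (((1 - RatFunc.X ^ (2 * M + 1)) / (1 - RatFunc.X)) ^ 3 +
        ((1 - RatFunc.X ^ (2 * M + 1)) / (1 - RatFunc.X)) ^ 4 * (1 - RatFunc.X)) *
        ∑ k ∈ range M, RatFunc.X ^ (2 * k + 2) /
          ((1 - RatFunc.X ^ (2 * k + 2)) / (1 - RatFunc.X)) ^ 2) +
      ((1 - RatFunc.X ^ (2 * M + 1)) / (1 - RatFunc.X)) ^ 4 *
        ∑ k ∈ range M, RatFunc.X ^ (2 * k + 2) /
          (((1 - RatFunc.X ^ (2 * k + 1)) / (1 - RatFunc.X)) ^ 3 *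
            oddEvenRatio RatFunc.X k ^ 2)) 0 := by
  have hodd : Odd (d * m) := ⟨M, hdM.symm⟩
  obtain ⟨h, hd⟩ := (Nat.odd_mul.mp hodd).1
  have hd0 : 0 < d := by omega
  have h1 : 1 - ζ ≠ 0 := by
    simpa using one_sub_pow_ne_zero_of_lt hζ (m := 1) (by omega) (by omega)
  have hζ0 : ζ ≠ 0 := hζ.ne_zero hd0.ne'
  have hX1 : HasOrder ζ d (1 - RatFunc.X) 0 :=
    HasOrder.of_evalsTo (EvalsTo.one.sub EvalsTo.X) h1
  have hN : HasOrder ζ d ((1 - RatFunc.X ^ (2 * M + 1)) / (1 - RatFunc.X)) 1 := by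
    have := (HasOrder.one_sub_X_pow hζ hd0 (i := 2 * M + 1) (by omega)).div hd0 hX1
    rwa [if_pos (by rw [hdM]; exact dvd_mul_right d m), sub_zero] at this
  have hNz := hN.evalsTo_zero hd0 hζ one_pos
  obtain ⟨N, hNdef⟩ : ∃ N : RatFunc ℚ, N = (1 - RatFunc.X ^ (2 * M + 1)) / (1 - RatFunc.X) :=
    ⟨_, rfl⟩
  rw [← hNdef] at hN hNz ⊢
  clear hNdef
  have hA : ∀ k, EvalsTo ζ (N ^ 3 * (RatFunc.X ^ (2 * k + 2) /
      ((1 - RatFunc.X ^ (2 * k + 2)) / (1 - RatFunc.X)) ^ 2)) 0 := by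
    intro k
    have o := hN.div hd0 ((HasOrder.one_sub_X_pow hζ hd0 (i := 2 * k + 2) (by omega)).div hd0 hX1)
    obtain ⟨v, hv⟩ := o.exists_evalsTo hd0 (by split_ifs <;> simp)
    refine ((hNz.mul (EvalsTo.X.pow (2 * k + 2))).mul (hv.pow 2)).congr ?_ (by ring)
    rw [div_pow N]
    ring
  have hB : ∀ k, EvalsTo ζ (N ^ 4 * (RatFunc.X ^ (2 * k + 2) /
      (((1 - RatFunc.X ^ (2 * k + 1)) / (1 - RatFunc.X)) ^ 3 *
        oddEvenRatio RatFunc.X k ^ 2))) 0 := by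
    intro k
    have o := (HasOrder.one_sub_X_pow hζ hd0 (i := 2 * k + 1) (by omega)).div hd0 hX1
    have o1 := hN.div hd0 o
    have o2 := hN.div hd0 (o.mul hd0 (HasOrder.oddEvenRatio hζ hd k))
    have h2 : d ∣ 2 * k + 1 ↔ d ∣ k + h + 1 := by
      rw [← (Nat.Coprime.dvd_mul_left (k := d) (m := 2) (n := k + h + 1)
        (by rw [hd]; simp)), ← Nat.dvd_add_self_right,
        show 2 * k + 1 + d = 2 * (k + h + 1) by omega]
    obtain ⟨v, hv⟩ := o1.exists_evalsTo hd0 (by split_ifs <;> simp)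
    obtain ⟨w, hw⟩ := o2.exists_evalsTo hd0 (by
      have h3 := Nat.succ_div (a := k + h) (b := d)
      have h4 : (k + h + 1) / d ≤ (k + d) / d := Nat.div_le_div_right (by omega)
      rw [Nat.add_div_right k hd0, h3] at h4
      simp only [h2]
      split_ifs at h4 ⊢ <;> omega)
    refine (((hNz.mul (EvalsTo.X.pow (2 * k + 2))).mul hv).mul (hw.pow 2)).congr ?_ (by ring)
    generalize (1 - RatFunc.X ^ (2 * k + 1) : RatFunc ℚ) / (1 - RatFunc.X) = y
    ring
  have hS1 := EvalsTo.sum_zero (s := range M) fun k _ => hA k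
  have hS2 := EvalsTo.sum_zero (s := range M) fun k _ => hB k
  rw [← mul_sum] at hS1 hS2
  refine (((EvalsTo.one.div (EvalsTo.X.pow M) (pow_ne_zero _ hζ0)).mul (hNz.sub
    ((EvalsTo.one.add (hNz.mul (EvalsTo.one.sub EvalsTo.X))).mul hS1))).add hS2).congr ?_ ?_
  · ring
  · ring

end ProperDivisor

section Primitive

variable {ζ : ℂ} {M : ℕ} {x : RatFunc ℚ}

theorem evalsTo_pow_div (h : EvalsTo ζ x 1) (m : ℕ) : EvalsTo ζ (RatFunc.X ^ m / x) (ζ ^ m) :=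
  ((EvalsTo.X.pow m).div h one_ne_zero).congr rfl (div_one _)

theorem evalsTo_oddEvenRatio (hζ : IsPrimitiveRoot ζ (2 * M + 1)) {k : ℕ} (hk : k ≤ M) :
    EvalsTo ζ (oddEvenRatio RatFunc.X k) (oddEvenRatio ζ k) :=
  EvalsTo.prod fun j hj => (EvalsTo.one_sub_X_pow _).div (EvalsTo.one_sub_X_pow _)
    (one_sub_pow_ne_zero_of_lt hζ (by omega) (by have := mem_range.mp hj; omega))

theorem oddEvenRatio_ne_zero (hζ : IsPrimitiveRoot ζ (2 * M + 1)) {k : ℕ} (hk : k ≤ M) :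
    oddEvenRatio ζ k ≠ 0 :=
  prod_ne_zero_iff.mpr fun j hj => by
    rw [mem_range] at hj
    exact div_ne_zero (one_sub_pow_ne_zero_of_lt hζ (by omega) (by omega))
      (one_sub_pow_ne_zero_of_lt hζ (by omega) (by omega))

theorem evalsTo_wellPoised (hζ : IsPrimitiveRoot ζ (2 * M + 1)) (hx : EvalsTo ζ x 1) {k : ℕ}
    (hk : k ≤ M) : EvalsTo ζ (wellPoised RatFunc.X x k) (oddEvenRatio ζ k ^ 2) := by
  rw [← wellPoised_one]
  refine EvalsTo.prod fun j hj => ?_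
  have hw : 1 - ζ ^ (2 * j + 2) ≠ 0 :=
    one_sub_pow_ne_zero_of_lt hζ (by omega) (by have := mem_range.mp hj; omega)
  simp only [mul_one, div_one]
  have hm : ∀ m, EvalsTo ζ (1 - RatFunc.X ^ m * x) (1 - ζ ^ m) := fun m =>
    (EvalsTo.one.sub ((EvalsTo.X.pow m).mul hx)).congr rfl (by rw [mul_one])
  have hd : ∀ m, EvalsTo ζ (1 - RatFunc.X ^ m / x) (1 - ζ ^ m) := fun m =>
    EvalsTo.one.sub (evalsTo_pow_div hx m)
  exact ((hm _).mul (hd _)).div ((hm _).mul (hd _)) (mul_ne_zero hw hw)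

theorem evalsTo_sub_wellPoised_div (hζ : IsPrimitiveRoot ζ (2 * M + 1)) (hx : EvalsTo ζ x 1)
    (hx0 : x ≠ 0) (hx1 : 1 - x ≠ 0)
    (hxw : ∀ j : ℕ, 1 - RatFunc.X ^ (2 * j + 2) * x ≠ 0)
    (hxd : ∀ j : ℕ, 1 - RatFunc.X ^ (2 * j + 2) / x ≠ 0) {k : ℕ} (hk : k ≤ M) :
    EvalsTo ζ ((oddEvenRatio RatFunc.X k ^ 2 - wellPoised RatFunc.X x k) / ((1 - x) ^ 2 / x))
      (oddEvenRatio ζ k ^ 2 * oddEvenSum ζ k) := by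
  induction k with
  | zero => simpa [oddEvenRatio, wellPoised, oddEvenSum] using EvalsTo.zero
  | succ k ih =>
    have hw : 1 - ζ ^ (2 * k + 2) ≠ 0 := one_sub_pow_ne_zero_of_lt hζ (by omega) (by omega)
    have hD : EvalsTo ζ ((1 - RatFunc.X ^ (2 * k + 2)) ^ 2 * ((1 - RatFunc.X ^ (2 * k + 2) * x) *
        (1 - RatFunc.X ^ (2 * k + 2) / x))) ((1 - ζ ^ (2 * k + 2)) ^ 4) :=
      (((EvalsTo.one_sub_X_pow _).pow 2).mul ((EvalsTo.one.sub ((EvalsTo.X.pow _).mul hx)).mul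
        (EvalsTo.one.sub (evalsTo_pow_div hx _)))).congr rfl (by ring)
    have hu := EvalsTo.one_sub_X_pow (ζ := ζ) (2 * k + 1)
    have hv := EvalsTo.one_sub_X_pow (ζ := ζ) (2 * k + 2)
    have hτ := ((((EvalsTo.X (ζ := ζ)).pow (2 * k + 1)).mul (hv.pow 2)).sub
      (((EvalsTo.X (ζ := ζ)).pow (2 * k + 2)).mul (hu.pow 2))).div hD (pow_ne_zero 4 hw)
    refine (((ih (by omega)).mul ((hu.pow 2).div (hv.pow 2) (pow_ne_zero 2 hw))).add
      ((evalsTo_wellPoised hζ hx (k := k) (by omega)).mul hτ)).congr ?_ ?_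
    · have e1 := one_sub_X_pow_ne_zero (2 * k + 2) (by omega)
      have e2 := hxw k
      have e3 := hxd k
      rw [oddEvenRatio_succ, wellPoised_succ]
      generalize oddEvenRatio (RatFunc.X : RatFunc ℚ) k = f
      generalize wellPoised RatFunc.X x k = g
      generalize (RatFunc.X : RatFunc ℚ) ^ (2 * k + 2) = w at *
      generalize (RatFunc.X : RatFunc ℚ) ^ (2 * k + 1) = u at *
      have e4 : x - w ≠ 0 := by
        intro h; apply e3; rw [← sub_eq_zero.mp h, div_self hx0, sub_self]
      rw [mul_comm w x] at *
      rw [show 1 - w / x = (x - w) / x by field_simp, show 1 - u / x = (x - u) / x by field_simp]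
      field_simp
      ring
    · simp only [oddEvenRatio, oddEvenSum, prod_range_succ, sum_range_succ]
      have hu0 : 1 - ζ ^ (2 * k + 1) ≠ 0 := one_sub_pow_ne_zero_of_lt hζ (by omega) (by omega)
      field_simp

theorem evalsTo_balancedRatio (hζ : IsPrimitiveRoot ζ (2 * M + 1)) {k : ℕ} (hk : k < M) :
    EvalsTo ζ (balancedRatio RatFunc.X (RatFunc.X ^ (2 * M)) k)
      ((1 - ζ) ^ 2 / ((1 - ζ ^ (2 * k + 1)) ^ 2 * oddEvenRatio ζ k ^ 2)) := by
  have hζ0 : ζ ≠ 0 := hζ.ne_zero (by omega)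
  have h1 : ζ ^ (2 * M) * ζ = 1 := by rw [← pow_succ, hζ.pow_eq_one]
  have hd : ∀ m, EvalsTo ζ (1 - RatFunc.X ^ m / RatFunc.X ^ (2 * M)) (1 - ζ ^ (m + 1)) := fun m =>
    (EvalsTo.one.sub ((EvalsTo.X.pow m).div (EvalsTo.X.pow (2 * M)) (pow_ne_zero _ hζ0))).congr
      rfl (by rw [eq_div_of_mul_eq hζ0 h1, pow_succ, div_div_eq_mul_div, div_one])
  induction k with
  | zero =>
    have h0 : 1 - ζ ≠ 0 := by
      simpa using one_sub_pow_ne_zero_of_lt hζ (m := 1) (by omega) (by omega)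
    simpa [balancedRatio, oddEvenRatio, h0] using EvalsTo.one
  | succ k ih =>
    have e1 : 1 - ζ ^ (2 * k + 1) ≠ 0 := one_sub_pow_ne_zero_of_lt hζ (by omega) (by omega)
    have e2 : 1 - ζ ^ (2 * k + 2) ≠ 0 := one_sub_pow_ne_zero_of_lt hζ (by omega) (by omega)
    have e3 : 1 - ζ ^ (2 * k + 3) ≠ 0 := one_sub_pow_ne_zero_of_lt hζ (by omega) (by omega)
    refine ((ih (by omega)).mul (((EvalsTo.one_sub_X_pow (2 * k + 2)).mul (hd (2 * k + 1))).div
      ((EvalsTo.one_sub_X_pow (2 * k + 3)).mul (hd (2 * k + 2))) (mul_ne_zero e3 e3))).congr ?_ ?_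
    · rw [balancedRatio, balancedRatio, prod_range_succ]
    · rw [oddEvenRatio_succ, show 2 * (k + 1) + 1 = 2 * k + 3 by ring]
      have e4 := oddEvenRatio_ne_zero hζ (k := k) (by omega)
      field_simp

theorem evalsTo_sum_balancedRatio (hζ : IsPrimitiveRoot ζ (2 * M + 1)) (hM : 0 < M) :
    EvalsTo ζ (1 / RatFunc.X ^ M * (RatFunc.X ^ M / (1 - RatFunc.X ^ (2 * M)) ^ 2 *
      ∑ k ∈ range M, RatFunc.X ^ (2 * k) * (balancedRatio RatFunc.X (RatFunc.X ^ (2 * M)) k *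
        ((1 - 1 / RatFunc.X ^ (2 * M)) / (1 - RatFunc.X ^ (2 * k) / RatFunc.X ^ (2 * M))))))
      (∑ k ∈ range M, (1 - ζ) * ζ ^ (2 * k + 2) /
        ((1 - ζ ^ (2 * k + 1)) ^ 3 * oddEvenRatio ζ k ^ 2)) := by
  have hζ0 : ζ ≠ 0 := hζ.ne_zero (by omega)
  have h0 : 1 - ζ ≠ 0 := by
    simpa using one_sub_pow_ne_zero_of_lt hζ (m := 1) (by omega) (by omega)
  have h1 : ζ ^ (2 * M) * ζ = 1 := by rw [← pow_succ, hζ.pow_eq_one]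
  have h2 : ζ ^ (2 * M) = ζ⁻¹ := eq_inv_of_mul_eq_one_left h1
  have h3 : 1 - ζ ^ (2 * M) ≠ 0 := one_sub_pow_ne_zero_of_lt hζ (by omega) (by omega)
  have h4 : ζ - 1 ≠ 0 := by rwa [← neg_ne_zero, neg_sub]
  have hd : ∀ m, EvalsTo ζ (1 - RatFunc.X ^ m / RatFunc.X ^ (2 * M)) (1 - ζ ^ (m + 1)) := fun m =>
    (EvalsTo.one.sub ((EvalsTo.X.pow m).div (EvalsTo.X.pow (2 * M)) (pow_ne_zero _ hζ0))).congr
      rfl (by rw [eq_div_of_mul_eq hζ0 h1, pow_succ, div_div_eq_mul_div, div_one])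
  have hd0 := hd 0
  rw [pow_zero, zero_add, pow_one] at hd0
  have hsum := EvalsTo.sum (s := range M) fun k hk => ((EvalsTo.X (ζ := ζ)).pow (2 * k)).mul
    ((evalsTo_balancedRatio hζ (mem_range.mp hk)).mul (hd0.div (hd (2 * k))
      (one_sub_pow_ne_zero_of_lt hζ (by omega) (by have := mem_range.mp hk; omega))))
  refine ((EvalsTo.one.div (EvalsTo.X.pow M) (pow_ne_zero _ hζ0)).mul
    (((EvalsTo.X.pow M).div ((EvalsTo.one_sub_X_pow (2 * M)).pow 2) (pow_ne_zero 2 h3)).mul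
      hsum)).congr rfl ?_
  rw [← mul_assoc, div_mul_div_cancel₀ (pow_ne_zero M hζ0), mul_sum]
  refine sum_congr rfl fun k hk => ?_
  have e1 : 1 - ζ ^ (2 * k + 1) ≠ 0 :=
    one_sub_pow_ne_zero_of_lt hζ (by omega) (by have := mem_range.mp hk; omega)
  rw [h2, pow_succ ζ (2 * k + 1), pow_succ ζ (2 * k)] at *
  rw [show 1 - ζ⁻¹ = (ζ - 1) / ζ by field_simp]
  generalize ζ ^ (2 * k) = u at *
  by_cases hC : oddEvenRatio ζ k = 0
  · simp [hC]
  · field_simp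
    ring


theorem powDivides_sum_sub_closedForm (hζ : IsPrimitiveRoot ζ (2 * M + 1)) (hM : 0 < M) :
    PowDivides (cyclotomic (2 * M + 1) ℚ) 5
      (∑ k ∈ range (M + 1), (1 - RatFunc.X ^ (4 * k + 1)) / (1 - RatFunc.X) *
        oddEvenRatio RatFunc.X k ^ 4 -
      (1 / RatFunc.X ^ M * ((1 - RatFunc.X ^ (2 * M + 1)) / (1 - RatFunc.X) -
      (((1 - RatFunc.X ^ (2 * M + 1)) / (1 - RatFunc.X)) ^ 3 +
        ((1 - RatFunc.X ^ (2 * M + 1)) / (1 - RatFunc.X)) ^ 4 * (1 - RatFunc.X)) *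
        ∑ k ∈ range M, RatFunc.X ^ (2 * k + 2) /
          ((1 - RatFunc.X ^ (2 * k + 2)) / (1 - RatFunc.X)) ^ 2) +
      ((1 - RatFunc.X ^ (2 * M + 1)) / (1 - RatFunc.X)) ^ 4 *
        ∑ k ∈ range M, RatFunc.X ^ (2 * k + 2) /
          (((1 - RatFunc.X ^ (2 * k + 1)) / (1 - RatFunc.X)) ^ 3 *
            oddEvenRatio RatFunc.X k ^ 2))) := by
  have hζ0 : ζ ≠ 0 := hζ.ne_zero (by omega)
  have h0 : 1 - ζ ≠ 0 := by
    simpa using one_sub_pow_ne_zero_of_lt hζ (m := 1) (by omega) (by omega)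
  obtain ⟨x, hx⟩ : ∃ x : RatFunc ℚ, x = RatFunc.X ^ (2 * M + 1) := ⟨_, rfl⟩
  have hxe : EvalsTo ζ x 1 := (EvalsTo.X.pow (2 * M + 1)).congr hx.symm hζ.pow_eq_one
  have hx0 : x ≠ 0 := hx ▸ pow_ne_zero _ RatFunc.X_ne_zero
  have hx1 : 1 - x ≠ 0 := hx ▸ one_sub_X_pow_ne_zero _ (by omega)
  have hxw : ∀ j : ℕ, 1 - RatFunc.X ^ (2 * j + 2) * x ≠ 0 := fun j => by
    rw [hx, ← pow_add]; exact one_sub_X_pow_ne_zero _ (by omega)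
  have hxd : ∀ j : ℕ, 1 - RatFunc.X ^ (2 * j + 2) / x ≠ 0 := fun j => by
    rw [hx]
    exact one_sub_pow_div_pow_ne_zero RatFunc.X_ne_zero one_sub_X_pow_ne_zero (by omega)
  have ht : EvalsTo ζ (1 - x) 0 := (EvalsTo.one.sub hxe).congr rfl (sub_self 1)
  have h1X : EvalsTo ζ (1 - RatFunc.X) (1 - ζ) := EvalsTo.one.sub EvalsTo.X
  rw [sum_oddEvenRatio_pow_four_sub_eq RatFunc.X_ne_zero one_sub_X_pow_ne_zero M hx rfl rfl]
  have hd : 0 < 2 * M + 1 := by omega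
  refine PowDivides.mul (m := 4) (l := 1) ((ht.powDivides hζ hd).pow 4)
    (EvalsTo.powDivides hζ hd ?_)
  have hR := EvalsTo.sum (s := range (M + 1)) fun k hk =>
    ((EvalsTo.one_sub_X_pow (4 * k + 1)).div h1X h0).mul
      ((evalsTo_sub_wellPoised_div hζ hxe hx0 hx1 hxw hxd (k := k)
        (by have := mem_range.mp hk; omega)).pow 2)
  have hw : ∀ i ∈ range M, 1 - ζ ^ (2 * i + 2) ≠ 0 := fun i hi =>
    one_sub_pow_ne_zero_of_lt hζ (by omega) (by have := mem_range.mp hi; omega)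
  have hQ := EvalsTo.sum (s := range M) fun i hi =>
    ((((EvalsTo.X (ζ := ζ)).pow (i + 1)).mul (EvalsTo.one.add (EvalsTo.X.pow (2 * i + 2)))).mul
      (EvalsTo.X.pow (2 * i + 2))).div (((EvalsTo.one_sub_X_pow (2 * i + 2)).pow 2).mul
        ((EvalsTo.one.sub ((EvalsTo.X.pow (2 * i + 2)).mul hxe)).mul
          (EvalsTo.one.sub (evalsTo_pow_div hxe (2 * i + 2)))))
      (mul_ne_zero (pow_ne_zero 2 (hw i hi))
        (mul_ne_zero (by rw [mul_one]; exact hw i hi) (hw i hi)))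
  have hH := EvalsTo.sum (s := range M) fun i hi =>
    ((EvalsTo.X (ζ := ζ)).pow (2 * i + 2)).div ((EvalsTo.one_sub_X_pow (2 * i + 2)).pow 2)
      (pow_ne_zero 2 (hw i hi))
  have hT := EvalsTo.sum (s := range M) fun k hk =>
    ((EvalsTo.X (ζ := ζ)).pow (2 * k + 2)).div
      ((((EvalsTo.one_sub_X_pow (2 * k + 1)).div h1X h0).pow 3).mul
        ((evalsTo_oddEvenRatio hζ (mem_range.mp hk).le).pow 2))
      (mul_ne_zero (pow_ne_zero 3 (div_ne_zero (one_sub_pow_ne_zero_of_lt hζ (by omega)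
        (by have := mem_range.mp hk; omega)) h0))
        (pow_ne_zero 2 (oddEvenRatio_ne_zero hζ (mem_range.mp hk).le)))
  refine (((hR.div (hxe.pow 2) (by simp)).add (ht.mul ((EvalsTo.one.div
    ((EvalsTo.X.pow M).mul h1X) (mul_ne_zero (pow_ne_zero M hζ0) h0)).mul
      ((hQ.div (hxe.pow 2) (by simp)).sub (hH.div hxe one_ne_zero))))).add
    ((EvalsTo.one.div (hxe.mul (h1X.pow 2)) (mul_ne_zero one_ne_zero (pow_ne_zero 2 h0))).mul
      ((evalsTo_sum_balancedRatio hζ hM).sub ((hxe.mul hT).div (h1X.pow 2)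
        (pow_ne_zero 2 h0))))).congr rfl ?_
  have key := sum_oddEvenRatio_pow_four_mul_eq_zero hζ (fun k => oddEvenSum ζ k ^ 2)
    fun k j hkj => by rw [oddEvenSum_reflect hζ hkj]
  have hR0 : ∑ k ∈ range (M + 1), (1 - ζ ^ (4 * k + 1)) / (1 - ζ) *
      (oddEvenRatio ζ k ^ 2 * oddEvenSum ζ k) ^ 2 = 0 := by
    rw [← zero_div (1 - ζ), ← key, sum_div]
    exact sum_congr rfl fun k _ => by ring
  have hΘ : ∑ k ∈ range M, (1 - ζ) * ζ ^ (2 * k + 2) /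
      ((1 - ζ ^ (2 * k + 1)) ^ 3 * oddEvenRatio ζ k ^ 2) =
      1 * (∑ k ∈ range M, ζ ^ (2 * k + 2) /
        (((1 - ζ ^ (2 * k + 1)) / (1 - ζ)) ^ 3 * oddEvenRatio ζ k ^ 2)) / (1 - ζ) ^ 2 := by
    rw [one_mul, sum_div]
    refine sum_congr rfl fun k hk => ?_
    have e1 : 1 - ζ ^ (2 * k + 1) ≠ 0 :=
      one_sub_pow_ne_zero_of_lt hζ (by omega) (by have := mem_range.mp hk; omega)
    have e2 := oddEvenRatio_ne_zero hζ (mem_range.mp hk).le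
    field_simp
  rw [hR0, hΘ]
  ring

end Primitive

theorem qint_natCast (m : ℕ) : qint m = (1 - RatFunc.X ^ m) / (1 - RatFunc.X) := by
  rw [qint, q, zpow_natCast]

theorem qPoch_one_two (k : ℕ) :
    qPoch 1 2 k = ∏ j ∈ range k, (1 - RatFunc.X ^ (2 * j + 1)) := by
  refine prod_congr rfl fun j _ => ?_
  rw [show (1 : ℤ) + 2 * j = ((2 * j + 1 : ℕ) : ℤ) by push_cast; ring, zpow_natCast, q]

theorem qPoch_two_two (k : ℕ) :
    qPoch 2 2 k = ∏ j ∈ range k, (1 - RatFunc.X ^ (2 * j + 2)) := by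
  refine prod_congr rfl fun j _ => ?_
  rw [show (2 : ℤ) + 2 * j = ((2 * j + 2 : ℕ) : ℤ) by push_cast; ring, zpow_natCast, q]

theorem qPoch_div_qPoch (k : ℕ) : qPoch 1 2 k / qPoch 2 2 k = oddEvenRatio RatFunc.X k := by
  rw [qPoch_one_two, qPoch_two_two, oddEvenRatio, prod_div_distrib]

/-- for odd `n`, modulo `[n]Φ_n(q)^4`,
`Σ_{k=0}^{(n-1)/2} [4k+1] (q;q^2)_k^4/(q^2;q^2)_k^4 ≡ q^{(1-n)/2}([n] - ([n]^3+[n]^4(1-q))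
 Σ q^{2k}/[2k]^2) + [n]^4 Σ q^{2k}(q^2;q^2)_{k-1}^2/([2k-1]^3 (q;q^2)_{k-1}^2)`. -/
theorem stmt9 (n : ℕ) (hn : 0 < n) (hodd : Odd n) :
    modCong
      (∑ k ∈ Finset.range ((n - 1) / 2 + 1),
        qint (4 * k + 1) * (qPoch 1 2 k) ^ 4 / (qPoch 2 2 k) ^ 4)
      (q ^ ((1 - (n : ℤ)) / 2) *
        (qint n - ((qint n) ^ 3 + (qint n) ^ 4 * (1 - q)) *
          ∑ k ∈ Finset.Icc 1 ((n - 1) / 2), q ^ (2 * k) / (qint (2 * k)) ^ 2) +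
       (qint n) ^ 4 *
        ∑ k ∈ Finset.Icc 1 ((n - 1) / 2),
          q ^ (2 * k) * (qPoch 2 2 (k - 1)) ^ 2 /
            ((qint (2 * (k : ℤ) - 1)) ^ 3 * (qPoch 1 2 (k - 1)) ^ 2))
      (qintPoly n * (Polynomial.cyclotomic n ℚ) ^ 4) := by
  obtain ⟨M, rfl⟩ := hodd
  have hM : (2 * M + 1 - 1) / 2 = M := by omega
  have hpow : q ^ ((1 - ((2 * M + 1 : ℕ) : ℤ)) / 2) = 1 / RatFunc.X ^ M := by
    rw [show (1 - ((2 * M + 1 : ℕ) : ℤ)) / 2 = -(M : ℤ) by push_cast; omega, zpow_neg,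
      zpow_natCast, q, one_div]
  have hL : ∀ k : ℕ, qint (4 * k + 1) * (qPoch 1 2 k) ^ 4 / (qPoch 2 2 k) ^ 4 =
      (1 - RatFunc.X ^ (4 * k + 1)) / (1 - RatFunc.X) * oddEvenRatio RatFunc.X k ^ 4 := fun k => by
    rw [← qPoch_div_qPoch, ← qint_natCast, div_pow, mul_div_assoc]
    push_cast
    rfl
  have hA : ∑ k ∈ Icc 1 M, q ^ (2 * k) / (qint (2 * k)) ^ 2 =
      ∑ k ∈ range M, RatFunc.X ^ (2 * k + 2) /
        ((1 - RatFunc.X ^ (2 * k + 2)) / (1 - RatFunc.X)) ^ 2 := by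
    rw [range_eq_Ico, ← Ico_add_one_right_eq_Icc, ← sum_Ico_add' _ 0 M 1]
    refine sum_congr rfl fun k _ => ?_
    rw [← qint_natCast, q]
    push_cast
    ring_nf
  have hB : ∑ k ∈ Icc 1 M, q ^ (2 * k) * (qPoch 2 2 (k - 1)) ^ 2 /
        ((qint (2 * (k : ℤ) - 1)) ^ 3 * (qPoch 1 2 (k - 1)) ^ 2) =
      ∑ k ∈ range M, RatFunc.X ^ (2 * k + 2) / (((1 - RatFunc.X ^ (2 * k + 1)) /
        (1 - RatFunc.X)) ^ 3 * oddEvenRatio RatFunc.X k ^ 2) := by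
    rw [range_eq_Ico, ← Ico_add_one_right_eq_Icc, ← sum_Ico_add' _ 0 M 1]
    refine sum_congr rfl fun k _ => ?_
    rw [← qint_natCast, ← qPoch_div_qPoch, Nat.add_sub_cancel, q, div_pow, mul_div_assoc',
      div_div_eq_mul_div, show 2 * ((k + 1 : ℕ) : ℤ) - 1 = ((2 * k + 1 : ℕ) : ℤ) by push_cast; ring,
      mul_add]
  rw [hM, hpow, qint_natCast, sum_congr rfl fun k _ => hL k, hA, hB, q]
  rcases Nat.eq_zero_or_pos M with rfl | hM0
  · refine ⟨0, 1, isCoprime_one_left, ?_⟩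
    have h1 := one_sub_X_pow_ne_zero 1 one_pos
    rw [pow_one] at h1
    simp [oddEvenRatio, h1]
  · refine exists_eq_div_of_powDivides hn (by omega)
      (powDivides_sum_sub_closedForm (Complex.isPrimitiveRoot_exp _ hn.ne') hM0) ?_
    intro d hd hd1 _
    obtain ⟨m, hm⟩ := Nat.dvd_of_mem_divisors hd
    have hd0 := Nat.pos_of_mem_divisors hd
    have hζ := Complex.isPrimitiveRoot_exp d hd0.ne'
    exact (((evalsTo_sum_oddEvenRatio_pow_four hζ hd1 hm).sub
      (evalsTo_closedForm hζ hd1 hm)).congr rfl (sub_zero 0)).powDivides hζ hd0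
end

section
/- Let n, d be positive integers with gcd(n,d) = 1, and r an integer with n + d - nd ≤ r ≤ n, n ≡ r (mod d), and let M = (n-r)/d. Then modulo [n]Φ_n(q)^4: Σ_{k=0}^{M} [2dk+r] (q^r;q^d)_k^4/(q^d;q^d)_k^4 q^{(d-2r)k} ≡ q^{r(r-n)/d} (q^{2r};q^d)_{(n-r)/d}/(q^d;q^d)_{(n-r)/d} · ([n] - ([n]^3 + [n]^4(1-q)) Σ_{k=1}^{(n-r)/d} q^{kd}/[kd]^2) + [n]^4 Σ_{k=1}^{(n-r)/d} q^{(kd-d-2n+2r)(d-n)/d} (q^d;q^d)_{k-1}(q^{2r};q^d)_{k-1} / ([dk-d+r]^3 (q^r;q^d)_{k-1}^2). -/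
open Finset Polynomial

/-- The shifted factorial `(a; p)_k` in a field. -/
def shiftedFactorial {K : Type*} [Field K] (a p : K) (k : ℕ) : K :=
  ∏ i ∈ range k, (1 - a * p ^ i)

section Telescoping

variable {K : Type*} [Field K]

local notation "φ" => shiftedFactorial

lemma shiftedFactorial_succ (a p : K) (k : ℕ) : φ a p (k + 1) = φ a p k * (1 - a * p ^ k) :=
  prod_range_succ _ _

lemma shiftedFactorial_succ' (a p : K) (k : ℕ) :
    φ a p (k + 1) = (1 - a) * φ (a * p) p k := by
  simp only [shiftedFactorial, prod_range_succ', pow_zero, mul_one]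
  rw [mul_comm]
  congr 1
  exact prod_congr rfl fun i _ ↦ by ring

lemma shiftedFactorial_add (a p : K) (k l : ℕ) :
    φ a p (k + l) = φ a p k * φ (a * p ^ k) p l := by
  simp only [shiftedFactorial, prod_range_add]
  congr 1
  exact prod_congr rfl fun i _ ↦ by ring

lemma shiftedFactorial_ne_zero {a p : K} (h : ∀ i : ℕ, 1 - a * p ^ i ≠ 0) (k : ℕ) :
    φ a p k ≠ 0 :=
  prod_ne_zero_iff.mpr fun i _ ↦ h i

/-- The coefficient produced by `j` contiguous shifts of the last numerator parameter. -/
def contiguousCoeff (a p : K) (j : ℕ) : K :=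
  ∏ i ∈ range j, (-p ^ i * (1 - a ^ 2 * p ^ i) / (1 - a * p ^ i) ^ 2)

/-- The `k`-th term of the very-well-poised series with parameters `a, a, a, a p ^ j`,
normalised so that it stays finite. -/
def wellPoisedTerm (a p : K) (j k : ℕ) : K :=
  (1 - a * p ^ (2 * k)) * φ a p k ^ 3 * φ (a * p ^ j) p k / (φ p p k ^ 3 * φ p p (k - j)) *
    (p / (a ^ 2 * p ^ j)) ^ k * contiguousCoeff a p j

/-- The antidifference, at `k + 1`, of the contiguous relation between the series of
index `j` and `j + 1`. -/
def boundaryTerm (a p : K) (j k : ℕ) : K :=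
  contiguousCoeff a p j * (a ^ 2 * p ^ (2 * j)) / (1 - a * p ^ j) ^ 3 *
    (φ a p (k + 1) ^ 3 * φ (a * p ^ j) p (k + 1) / (φ p p k ^ 3 * φ p p (k - j))) *
    (1 / (a ^ 2 * p ^ j)) ^ (k + 1)

lemma boundaryTerm_self {a p : K} (ha : a ≠ 0) (hp : p ≠ 0)
    (h : ∀ i : ℕ, 1 - a * p ^ i ≠ 0) (hpp : ∀ i : ℕ, 1 - p * p ^ i ≠ 0) (j : ℕ) :
    boundaryTerm a p j j = wellPoisedTerm a p j j := by
  have h1 := h j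
  have h2 := shiftedFactorial_ne_zero hpp j
  have h3 := shiftedFactorial_ne_zero hpp (j - j)
  rw [boundaryTerm, wellPoisedTerm, shiftedFactorial_succ, shiftedFactorial_succ,
    div_pow p, div_pow, pow_succ (a ^ 2 * p ^ j), mul_pow (a ^ 2)]
  field_simp
  ring

lemma boundaryTerm_sub {a p : K} (ha : a ≠ 0) (hp : p ≠ 0)
    (h : ∀ i : ℕ, 1 - a * p ^ i ≠ 0) (hpp : ∀ i : ℕ, 1 - p * p ^ i ≠ 0) (j l : ℕ) :
    boundaryTerm a p j (j + l + 1) - boundaryTerm a p j (j + l) =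
      wellPoisedTerm a p j (j + l + 1) - wellPoisedTerm a p (j + 1) (j + l + 1) := by
  have h1 := h j
  have h2 := shiftedFactorial_ne_zero hpp (j + l)
  have h3 := shiftedFactorial_ne_zero hpp l
  have h4 := hpp (j + l)
  have h5 := hpp l
  have e1 : j + l + 1 - j = l + 1 := by omega
  have e2 : j + l - j = l := by omega
  have e3 : j + l + 1 - (j + 1) = l := by omega
  have e4 : contiguousCoeff a p (j + 1) = contiguousCoeff a p j *
      (-p ^ j * (1 - a ^ 2 * p ^ j) / (1 - a * p ^ j) ^ 2) := prod_range_succ _ _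
  have e5 : φ (a * p ^ (j + 1)) p (j + l + 1) =
      φ (a * p ^ (j + 1)) p (j + l) * (1 - a * p ^ (j + 1) * p ^ (j + l)) :=
    shiftedFactorial_succ _ _ _
  have e6 : φ (a * p ^ j) p (j + l + 1) = (1 - a * p ^ j) * φ (a * p ^ (j + 1)) p (j + l) := by
    rw [shiftedFactorial_succ', pow_succ, mul_assoc]
  have e7 : φ (a * p ^ j) p (j + l + 1 + 1) = (1 - a * p ^ j) *
      (φ (a * p ^ (j + 1)) p (j + l) * (1 - a * p ^ (j + 1) * p ^ (j + l))) := by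
    rw [shiftedFactorial_succ', mul_assoc a, ← pow_succ, shiftedFactorial_succ]
  have e8 : φ a p (j + l + 1 + 1) = φ a p (j + l + 1) * (1 - a * p ^ (j + l + 1)) :=
    shiftedFactorial_succ _ _ _
  have e9 : (p / (a ^ 2 * p ^ j)) ^ (j + l + 1) =
      p ^ (j + l + 1) * (1 / (a ^ 2 * p ^ j)) ^ (j + l + 1) := by
    rw [← mul_pow, mul_one_div]
  have e10 : (p / (a ^ 2 * p ^ (j + 1))) ^ (j + l + 1) =
      (1 / (a ^ 2 * p ^ j)) ^ (j + l + 1) := by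
    congr 1
    field_simp
    ring
  have e11 : (1 / (a ^ 2 * p ^ j)) ^ (j + l + 1 + 1) =
      (1 / (a ^ 2 * p ^ j)) ^ (j + l + 1) * (1 / (a ^ 2 * p ^ j)) := pow_succ _ _
  rw [boundaryTerm, boundaryTerm, wellPoisedTerm, wellPoisedTerm, e1, e2, e3, e4, e8, e7, e5, e6,
    e9, e10, e11, shiftedFactorial_succ p p, shiftedFactorial_succ p p]
  generalize (1 / (a ^ 2 * p ^ j)) ^ (j + l + 1) = z
  generalize φ a p (j + l + 1) = A
  generalize φ (a * p ^ (j + 1)) p (j + l) = B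
  generalize φ p p (j + l) = C at *
  generalize φ p p l = D at *
  generalize contiguousCoeff a p j = E
  have hj : p ^ j ≠ 0 := pow_ne_zero _ hp
  simp only [pow_add, pow_mul', pow_one] at *
  generalize p ^ j = w at *
  generalize p ^ l = t at *
  replace h4 : 1 - w * t * p ≠ 0 := by rwa [mul_comm]
  replace h5 : 1 - t * p ≠ 0 := by rwa [mul_comm]
  clear e4 e5 e6 e7 e8 e9 e10 e11
  field_simp
  ring

/-- The truncated series is the sum of the boundary terms. -/
theorem sum_wellPoisedTerm {a p : K} (ha : a ≠ 0) (hp : p ≠ 0)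
    (h : ∀ i : ℕ, 1 - a * p ^ i ≠ 0) (hpp : ∀ i : ℕ, 1 - p * p ^ i ≠ 0) (M : ℕ) :
    ∑ k ∈ range (M + 1), wellPoisedTerm a p 0 k = ∑ j ∈ range (M + 1), boundaryTerm a p j M := by
  induction M with
  | zero => simp [boundaryTerm_self ha hp h hpp]
  | succ M ih =>
    have key : ∀ j ∈ range (M + 1), boundaryTerm a p j (M + 1) = boundaryTerm a p j M +
        (wellPoisedTerm a p j (M + 1) - wellPoisedTerm a p (j + 1) (M + 1)) := fun j hj ↦ by
      obtain ⟨l, rfl⟩ := Nat.exists_eq_add_of_le (Nat.lt_succ_iff.mp (mem_range.mp hj))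
      rw [← boundaryTerm_sub ha hp h hpp]
      ring
    rw [sum_range_succ, ih, sum_range_succ _ (M + 1), sum_congr rfl key, sum_add_distrib,
      sum_range_sub', boundaryTerm_self ha hp h hpp]
    ring

end Telescoping

section ClosedForm

variable {K : Type*} [Field K]

local notation "φ" => shiftedFactorial

lemma shiftedFactorial_reverse {x p : K} (hx : x ≠ 0) (hp : p ≠ 0) (l : ℕ) :
    φ (x / p ^ l) p l = (-x) ^ l / p ^ (∑ i ∈ range (l + 1), i) * φ (p / x) p l := by
  induction l with
  | zero => simp [shiftedFactorial]
  | succ l ih =>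
    have e : x / p ^ (l + 1) * p = x / p ^ l := by field_simp; ring
    rw [shiftedFactorial_succ', e, ih, shiftedFactorial_succ, sum_range_succ _ (l + 1), pow_add p,
      pow_succ (-x)]
    field_simp
    ring

lemma contiguousCoeff_eq (a p : K) (j : ℕ) :
    contiguousCoeff a p j =
      (-1) ^ j * p ^ (∑ i ∈ range j, i) * φ (a ^ 2) p j / φ a p j ^ 2 := by
  simp only [contiguousCoeff, shiftedFactorial, prod_div_distrib, prod_mul_distrib, prod_pow,
    ← prod_pow_eq_pow_sum, neg_eq_neg_one_mul (p ^ _), prod_const, card_range]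

lemma boundaryTerm_monomial {x p : K} (hx : x ≠ 0) (hp : p ≠ 0) (j l : ℕ) :
    (-1) ^ j * p ^ (∑ i ∈ range j, i) * ((x / p ^ (j + l)) ^ 2 * p ^ (2 * j)) *
      (1 / ((x / p ^ (j + l)) ^ 2 * p ^ j)) ^ (j + l + 1) *
      ((-x) ^ (j + l) / p ^ (∑ i ∈ range (j + l + 1), i)) ^ 3 *
      ((-x) ^ l / p ^ (∑ i ∈ range (l + 1), i)) = (x / p) ^ (j + 2 * l) := by
  have t1 := sum_range_id_mul_two j
  have t2 := sum_range_id_mul_two (j + l + 1)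
  have t3 := sum_range_id_mul_two (l + 1)
  have t1' : (∑ i ∈ range j, i) * 2 + j = j * j := by
    rw [t1]
    cases j
    · simp
    · simp
      ring
  rw [Nat.add_sub_cancel] at t2 t3
  generalize ∑ i ∈ range j, i = u at *
  generalize ∑ i ∈ range (j + l + 1), i = v at *
  generalize ∑ i ∈ range (l + 1), i = w at *
  have hs : ((-1 : K) ^ j * ((-1) ^ (j + l)) ^ 3 * (-1) ^ l) = 1 := by
    rw [← pow_mul, ← pow_add, ← pow_add]
    exact Even.neg_one_pow ⟨2 * j + 2 * l, by ring⟩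
  have he : u + 2 * j + (j + 2 * l) * (j + l + 1) + (j + 2 * l) = 2 * (j + l) + 3 * v + w := by
    nlinarith
  have hb : 1 / ((x / p ^ (j + l)) ^ 2 * p ^ j) = p ^ (j + 2 * l) / x ^ 2 := by
    rw [div_pow, ← pow_mul, div_eq_div_iff (by positivity) (by positivity)]
    field_simp
    ring
  have hm : p ^ u * p ^ (2 * j) * (p ^ (j + 2 * l)) ^ (j + l + 1) * p ^ (j + 2 * l) =
      (p ^ (j + l)) ^ 2 * (p ^ v) ^ 3 * p ^ w := by
    simp only [← pow_mul, ← pow_add]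
    congr 1
    linarith
  rw [hb, neg_pow x (j + l), neg_pow x l]
  calc _ = ((-1 : K) ^ j * ((-1) ^ (j + l)) ^ 3 * (-1) ^ l) *
        (p ^ u * p ^ (2 * j) * (p ^ (j + 2 * l)) ^ (j + l + 1) * p ^ (j + 2 * l)) /
        ((p ^ (j + l)) ^ 2 * (p ^ v) ^ 3 * p ^ w) *
        (x ^ 2 * (x ^ (j + l)) ^ 3 * x ^ l / (x ^ 2) ^ (j + l + 1)) / p ^ (j + 2 * l) := by
        rw [div_pow _ (x ^ 2)]
        field_simp
    _ = _ := by
        rw [hs, hm]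
        have : x ^ 2 * (x ^ (j + l)) ^ 3 * x ^ l = (x ^ 2) ^ (j + l + 1) * x ^ (j + 2 * l) := by
          ring
        rw [this, div_pow]
        field_simp

/-- Closed form of the boundary terms when `a = x p ^ (-M)`, `M = j + l`. -/
theorem boundaryTerm_eq {x p : K} (hx : x ≠ 0) (hp : p ≠ 0)
    (hpp : ∀ i : ℕ, 1 - p * p ^ i ≠ 0) (j l : ℕ) {a : K} (ha : a = x / p ^ (j + l))
    (h : ∀ i : ℕ, 1 - a * p ^ i ≠ 0) :
    boundaryTerm a p j (j + l) = (1 - x) ^ 4 * ((x / p) ^ (j + 2 * l) *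
      (φ p p j * φ (a ^ 2) p j) / ((1 - a * p ^ j) ^ 3 * φ a p j ^ 2)) *
      ((φ (p / x) p (j + l) / φ p p (j + l)) ^ 3 * (φ (p / x) p l / φ p p l) *
        (φ (x * p) p j / φ p p j)) := by
  have hx1 : a * p ^ (j + l) = x := by rw [ha]; field_simp
  have hx2 : a * p ^ j = x / p ^ l := by rw [ha, pow_add]; field_simp
  have e1 : φ a p (j + l + 1) = φ (x / p ^ (j + l)) p (j + l) * (1 - x) := by
    rw [shiftedFactorial_succ, hx1, ha]
  have e2 : φ (a * p ^ j) p (j + l + 1) = φ (x / p ^ l) p l * ((1 - x) * φ (x * p) p j) := by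
    have : a * p ^ j * p ^ l = x := by rw [mul_assoc, ← pow_add, hx1]
    rw [show j + l + 1 = l + (j + 1) by ring, shiftedFactorial_add, shiftedFactorial_succ',
      this, hx2]
  have hm := boundaryTerm_monomial hx hp j l
  have h1 := h j
  have h2 := shiftedFactorial_ne_zero hpp (j + l)
  have h3 := shiftedFactorial_ne_zero hpp l
  have h4 := shiftedFactorial_ne_zero hpp j
  have h5 := shiftedFactorial_ne_zero h j
  rw [boundaryTerm, contiguousCoeff_eq, e1, e2, shiftedFactorial_reverse hx hp,
    shiftedFactorial_reverse hx hp, Nat.add_sub_cancel_left]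
  rw [← ha] at hm
  rw [← hm]
  generalize (1 / (a ^ 2 * p ^ j)) ^ (j + l + 1) = z
  generalize (-x) ^ (j + l) / p ^ (∑ i ∈ range (j + l + 1), i) = z₁
  generalize (-x) ^ l / p ^ (∑ i ∈ range (l + 1), i) = z₂
  generalize (-1) ^ j * p ^ (∑ i ∈ range j, i) = z₃
  generalize a ^ 2 * p ^ (2 * j) = z₄
  generalize 1 - a * p ^ j = D at *
  generalize φ p p j = A at *
  generalize φ p p l = B at *
  generalize φ p p (j + l) = C at *
  generalize φ a p j = E at *
  field_simp

end ClosedForm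

section LastTerm

variable {K : Type*} [Field K]

local notation "φ" => shiftedFactorial

lemma shiftedFactorial_zero (a p : K) : φ a p 0 = 1 := by
  simp [shiftedFactorial]

lemma boundaryTerm_last {x p : K} (hx : x ≠ 0) (hx1 : 1 - x ≠ 0) (hp : p ≠ 0)
    (hpp : ∀ i : ℕ, 1 - p * p ^ i ≠ 0) (M : ℕ) {a : K} (ha : a = x / p ^ M)
    (h : ∀ i : ℕ, 1 - a * p ^ i ≠ 0) :
    boundaryTerm a p M M = (1 - x) * (p ^ (M * M) / x ^ M * (φ (a ^ 2) p M / φ p p M)) *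
      (φ (p / x) p M / φ p p M * (φ (x * p) p M / φ p p M)) := by
  have hb := boundaryTerm_eq hx hp hpp M 0 ha h
  have hax : a * p ^ M = x := by rw [ha]; field_simp
  have h1 := shiftedFactorial_ne_zero hpp M
  have h2 := shiftedFactorial_ne_zero h M
  have hr : φ a p M = (-x) ^ M / p ^ (∑ i ∈ range (M + 1), i) * φ (p / x) p M := by
    rw [ha, shiftedFactorial_reverse hx hp]
  have h3 : φ (p / x) p M ≠ 0 := fun h0 ↦ h2 (by rw [hr, h0, mul_zero])
  have t := sum_range_id_mul_two (M + 1)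
  rw [Nat.add_sub_cancel] at t
  have hs : ((-x) ^ M / p ^ (∑ i ∈ range (M + 1), i)) ^ 2 = (x ^ M) ^ 2 / p ^ (M * M + M) := by
    rw [div_pow, ← pow_mul, mul_comm M 2, pow_mul, neg_sq, ← pow_mul p, t]
    ring
  simp only [mul_zero, add_zero] at hb
  rw [hb, hax, hr, mul_pow, hs, pow_add, div_pow, shiftedFactorial_zero, shiftedFactorial_zero]
  generalize φ (p / x) p M = A at *
  generalize φ p p M = B at *
  field_simp

lemma shiftedFactorial_pair {x p : K} (hx : x ≠ 0)
    (hpp : ∀ i : ℕ, 1 - p * p ^ i ≠ 0) (M : ℕ) :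
    φ (p / x) p M / φ p p M * (φ (x * p) p M / φ p p M) =
      ∏ i ∈ range M, (1 - (1 - x) ^ 2 / x * (p * p ^ i / (1 - p * p ^ i) ^ 2)) := by
  simp only [shiftedFactorial, ← prod_div_distrib, ← prod_mul_distrib]
  refine prod_congr rfl fun i _ ↦ ?_
  have := hpp i
  rw [mul_assoc x, div_mul_eq_mul_div p x]
  generalize p * p ^ i = u at *
  field_simp
  ring

end LastTerm

section Valuation

variable {K Γ : Type*} [Field K] [LinearOrderedCommGroupWithZero Γ] (v : Valuation K Γ)

lemma Valuation.map_prod_sub_one_le {ι : Type*} {θ : Γ} (hθ : θ ≤ 1) (s : Finset ι) (f : ι → K)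
    (hf : ∀ i ∈ s, v (f i - 1) ≤ θ) : v (∏ i ∈ s, f i - 1) ≤ θ := by
  classical
  induction s using Finset.induction_on with
  | empty => simp
  | insert i s hi ih =>
    rw [prod_insert hi, show f i * ∏ x ∈ s, f x - 1 =
      (f i - 1) * (∏ x ∈ s, f x - 1) + ((f i - 1) + (∏ x ∈ s, f x - 1)) by ring]
    have h1 := hf i (mem_insert_self i s)
    have h2 := ih fun j hj ↦ hf j (mem_insert_of_mem hj)
    refine v.map_add_le ?_ (v.map_add_le h1 h2)
    rw [v.map_mul]
    exact mul_le_of_le_one_right' (h2.trans hθ) |>.trans h1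

lemma Valuation.map_mul_sub_one_le {θ : Γ} (hθ : θ ≤ 1) {f g : K} (hf : v (f - 1) ≤ θ)
    (hg : v (g - 1) ≤ θ) : v (f * g - 1) ≤ θ := by
  have := v.map_prod_sub_one_le hθ univ ![f, g] (by simp [hf, hg])
  simpa using this

lemma Valuation.map_pow_sub_one_le {θ : Γ} (hθ : θ ≤ 1) {f : K} (hf : v (f - 1) ≤ θ) (n : ℕ) :
    v (f ^ n - 1) ≤ θ := by
  simpa using v.map_prod_sub_one_le hθ (range n) (fun _ ↦ f) fun _ _ ↦ hf

lemma Valuation.map_prod_one_sub_le {ι : Type*} {t : K} (ht : v t ≤ 1) (s : Finset ι) (w : ι → K)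
    (hw : ∀ i ∈ s, v (w i) ≤ 1) :
    v (∏ i ∈ s, (1 - t * w i) - 1 + t * ∑ i ∈ s, w i) ≤ v t ^ 2 := by
  classical
  induction s using Finset.induction_on with
  | empty => simp
  | insert i s hi ih =>
    have hwt : ∀ j ∈ insert i s, v (t * w j) ≤ v t := fun j hj ↦ by
      rw [v.map_mul]
      exact mul_le_of_le_one_right' (hw j hj)
    have h2 := ih fun j hj ↦ hw j (mem_insert_of_mem hj)
    have h3 := v.map_prod_sub_one_le ht s (fun j ↦ 1 - t * w j) fun j hj ↦ by
      rw [sub_sub_cancel_left, v.map_neg]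
      exact hwt j (mem_insert_of_mem hj)
    rw [prod_insert hi, sum_insert hi, show (1 - t * w i) * ∏ x ∈ s, (1 - t * w x) - 1 +
      t * (w i + ∑ x ∈ s, w x) = (∏ x ∈ s, (1 - t * w x) - 1 + t * ∑ x ∈ s, w x) -
        t * w i * (∏ x ∈ s, (1 - t * w x) - 1) by ring]
    refine v.map_sub_le h2 ?_
    rw [v.map_mul, sq]
    exact mul_le_mul' (hwt i (mem_insert_self i s)) h3

end Valuation

/-- A valuation for which `1 - q ^ j` has the value `θ < 1` if `m ∣ j` and is a unit otherwise,
as happens for the valuation of the cyclotomic polynomial `Φ_m`. -/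
structure IsCyclotomicValuation {Γ : Type*} [LinearOrderedCommGroupWithZero Γ]
    (v : Valuation (RatFunc ℚ) Γ) (θ : Γ) (m : ℕ) : Prop where
  one_lt : 1 < m
  pos : 0 < θ
  lt_one : θ < 1
  map_q : v q = 1
  map_of_not_dvd : ∀ j : ℤ, ¬ (m : ℤ) ∣ j → v (1 - q ^ j) = 1
  map_of_dvd : ∀ j : ℤ, j ≠ 0 → (m : ℤ) ∣ j → v (1 - q ^ j) = θ

lemma q_ne_zero : q ≠ 0 := RatFunc.X_ne_zero

lemma one_sub_q_zpow_ne_zero {j : ℤ} (hj : j ≠ 0) : 1 - q ^ j ≠ 0 := by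
  have key : ∀ i : ℕ, i ≠ 0 → q ^ i ≠ 1 := fun i hi h ↦ by
    have h1 : algebraMap ℚ[X] (RatFunc ℚ) (X ^ i) = algebraMap ℚ[X] (RatFunc ℚ) 1 := by
      simpa [q] using h
    have h2 := congr_arg natDegree (RatFunc.algebraMap_injective ℚ h1)
    simp at h2
    exact hi h2
  intro h
  have h' : q ^ j = 1 := (sub_eq_zero.mp h).symm
  obtain ⟨i, rfl | rfl⟩ := j.eq_nat_or_neg
  · exact key i (by simpa using hj) (by simpa using h')
  · exact key i (by simpa using hj) (by simpa using h')

lemma qPoch_eq (s d : ℤ) (k : ℕ) : qPoch s d k = shiftedFactorial (q ^ s) (q ^ d) k := by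
  refine prod_congr rfl fun i _ ↦ ?_
  rw [zpow_add₀ q_ne_zero, zpow_mul, zpow_natCast]

lemma exists_dvd_add_mul_iff_modEq {m : ℕ} (hm : 0 < m) {d : ℤ} (hd : IsCoprime (m : ℤ) d) (s : ℤ) :
    ∃ c : ℕ, ∀ i : ℕ, (m : ℤ) ∣ s + d * i ↔ i ≡ c [MOD m] := by
  obtain ⟨a, b, hab⟩ := hd
  have hm' : (m : ℤ) ≠ 0 := by exact_mod_cast hm.ne'
  have hc : (m : ℤ) ∣ s + d * ((-s * b) % m).toNat := by
    rw [Int.toNat_of_nonneg (Int.emod_nonneg _ hm'), Int.emod_def]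
    exact ⟨s * a - d * (-s * b / m), by linear_combination (-s) * hab⟩
  refine ⟨((-s * b) % m).toNat, fun i ↦ ?_⟩
  rw [Nat.modEq_iff_dvd]
  generalize ((-s * b) % m).toNat = c at *
  constructor
  · intro h
    have := dvd_sub hc h
    rw [show s + d * c - (s + d * i) = d * (c - i) by ring] at this
    exact IsCoprime.dvd_of_dvd_mul_left ⟨a, b, hab⟩ this
  · intro h
    have := dvd_sub hc (h.mul_left d)
    rwa [show s + d * c - d * (c - i) = s + d * i by ring] at this

namespace IsCyclotomicValuation

variable {Γ : Type*} [LinearOrderedCommGroupWithZero Γ] {v : Valuation (RatFunc ℚ) Γ} {θ : Γ}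
  {m : ℕ}

lemma map_q_zpow (hv : IsCyclotomicValuation v θ m) (j : ℤ) : v (q ^ j) = 1 := by
  rw [map_zpow₀, hv.map_q, one_zpow]

lemma map_one_sub_le (hv : IsCyclotomicValuation v θ m) (j : ℤ) :
    v (1 - q ^ j) ≤ if (m : ℤ) ∣ j then θ else 1 := by
  split_ifs with h
  · rcases eq_or_ne j 0 with rfl | hj
    · simp
    · exact (hv.map_of_dvd j hj h).le
  · exact (hv.map_of_not_dvd j h).le

lemma map_one_sub (hv : IsCyclotomicValuation v θ m) {j : ℤ} (hj : j ≠ 0) :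
    v (1 - q ^ j) = if (m : ℤ) ∣ j then θ else 1 := by
  split_ifs with h
  · exact hv.map_of_dvd j hj h
  · exact hv.map_of_not_dvd j h

lemma le_map_one_sub (hv : IsCyclotomicValuation v θ m) {j : ℤ} (hj : j ≠ 0) :
    θ ≤ v (1 - q ^ j) := by
  rw [hv.map_one_sub hj]
  split_ifs
  exacts [le_rfl, hv.lt_one.le]

lemma prod_ite_dvd (s d : ℤ) (k : ℕ) {c : ℕ} (hc : ∀ i : ℕ, (m : ℤ) ∣ s + d * i ↔ i ≡ c [MOD m]) :
    ∏ i ∈ range k, (if (m : ℤ) ∣ s + d * i then θ else 1) =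
      θ ^ k.count (· ≡ c [MOD m]) := by
  simp only [hc, prod_ite, prod_const, one_pow, mul_one, Nat.count_eq_card_filter_range]

lemma map_qPoch_le (hv : IsCyclotomicValuation v θ m) {d : ℤ} (hd : IsCoprime (m : ℤ) d) (s : ℤ)
    (k : ℕ) : v (qPoch s d k) ≤ θ ^ (k / m) := by
  have hm : 0 < m := zero_lt_one.trans hv.one_lt
  obtain ⟨c, hc⟩ := exists_dvd_add_mul_iff_modEq hm hd s
  rw [qPoch, map_prod]
  refine (prod_le_prod' fun i _ ↦ hv.map_one_sub_le _).trans ?_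
  rw [prod_ite_dvd s d k hc, Nat.count_modEq_card k hm]
  exact pow_le_pow_right_of_le_one' hv.lt_one.le (Nat.le_add_right _ _)

lemma map_qPoch_eq (hv : IsCyclotomicValuation v θ m) {s d : ℤ} (k : ℕ)
    (h : ∀ i : ℕ, s + d * i ≠ 0) {c : ℕ} (hc : ∀ i : ℕ, (m : ℤ) ∣ s + d * i ↔ i ≡ c [MOD m]) :
    v (qPoch s d k) = θ ^ (k / m + if c % m < k % m then 1 else 0) := by
  rw [qPoch, map_prod, prod_congr rfl fun i _ ↦ hv.map_one_sub (h i), prod_ite_dvd s d k hc,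
    Nat.count_modEq_card k (zero_lt_one.trans hv.one_lt)]

lemma map_qPoch_self (hv : IsCyclotomicValuation v θ m) {d : ℕ} (hd0 : 0 < d)
    (hd : IsCoprime (m : ℤ) d) (k : ℕ) : v (qPoch d d k) = θ ^ (k / m) := by
  have hm : 0 < m := zero_lt_one.trans hv.one_lt
  have hc : ∀ i : ℕ, (m : ℤ) ∣ (d : ℤ) + d * i ↔ i ≡ m - 1 [MOD m] := fun i ↦ by
    rw [Nat.modEq_iff_dvd, Nat.cast_sub hm, show (d : ℤ) + d * i = d * (i + 1) by ring]
    rw [show ((m : ℤ) - (1 : ℕ) - i) = m - (i + 1) by push_cast; ring, dvd_sub_right dvd_rfl]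
    exact ⟨hd.dvd_of_dvd_mul_left, fun h ↦ h.mul_left _⟩
  rw [hv.map_qPoch_eq k (fun i ↦ by positivity) hc, if_neg, add_zero]
  rw [Nat.mod_eq_of_lt (Nat.sub_lt hm one_pos)]
  have := Nat.mod_lt k hm
  omega

lemma le_map_qPoch_succ (hv : IsCyclotomicValuation v θ m) {s d : ℤ} (hd : IsCoprime (m : ℤ) d)
    (h : ∀ i : ℕ, s + d * i ≠ 0) (k : ℕ) : θ ^ (k / m + 1) ≤ v (qPoch s d (k + 1)) := by
  have hm : 0 < m := zero_lt_one.trans hv.one_lt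
  obtain ⟨c, hc⟩ := exists_dvd_add_mul_iff_modEq hm hd s
  rw [hv.map_qPoch_eq _ h hc]
  refine pow_le_pow_right_of_le_one' hv.lt_one.le ?_
  rw [Nat.succ_div]
  split_ifs with h1 h2 h2
  · rw [Nat.mod_eq_zero_of_dvd h1] at h2
    omega
  · omega
  · omega
  · omega

end IsCyclotomicValuation

section Cyclotomic

open IsDedekindDomain

/-- The prime of `ℚ[X]` generated by the cyclotomic polynomial `Φ_m`. -/
noncomputable def cyclotomicPrime (m : ℕ) (hm : 0 < m) : HeightOneSpectrum ℚ[X] where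
  asIdeal := Ideal.span {cyclotomic m ℚ}
  isPrime := (Ideal.span_singleton_prime (cyclotomic_ne_zero m ℚ)).mpr
    (cyclotomic.irreducible_rat hm).prime
  ne_bot := by simpa using cyclotomic_ne_zero m ℚ

lemma intValuation_cyclotomic {m : ℕ} (hm : 0 < m) (i : ℕ) :
    (cyclotomicPrime m hm).intValuation (cyclotomic i ℚ) =
      if i = m then WithZero.exp (-1) else 1 := by
  split_ifs with h
  · subst h
    exact HeightOneSpectrum.intValuation_singleton _ (cyclotomic_ne_zero _ ℚ) rfl
  · rw [HeightOneSpectrum.intValuation_eq_one_iff]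
    intro hmem
    have hdvd := Ideal.mem_span_singleton.mp hmem
    exact (cyclotomic.irreducible_rat hm).not_isUnit
      ((cyclotomic.isCoprime_rat (Ne.symm h)).isUnit_of_dvd' dvd_rfl hdvd)

lemma intValuation_X_pow_sub_one {m : ℕ} (hm : 0 < m) {j : ℕ} (hj : 0 < j) :
    (cyclotomicPrime m hm).intValuation (X ^ j - 1) =
      if m ∣ j then WithZero.exp (-1) else 1 := by
  rw [← prod_cyclotomic_eq_X_pow_sub_one hj ℚ, map_prod,
    prod_congr rfl fun i _ ↦ intValuation_cyclotomic hm i, prod_ite_eq']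
  simp [hj.ne']

theorem isCyclotomicValuation {m : ℕ} (hm : 1 < m) :
    IsCyclotomicValuation ((cyclotomicPrime m (zero_lt_one.trans hm)).valuation (RatFunc ℚ))
      (WithZero.exp (-1)) m := by
  have hm0 : 0 < m := zero_lt_one.trans hm
  have hq : (cyclotomicPrime m hm0).valuation (RatFunc ℚ) q = 1 := by
    rw [q, ← RatFunc.algebraMap_X]
    refine (HeightOneSpectrum.valuation_of_algebraMap _ _).trans ?_
    rw [HeightOneSpectrum.intValuation_eq_one_iff]
    intro h
    have h0 := Ideal.mem_span_singleton.mp h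
    have h1 := (cyclotomic.irreducible_rat hm0).dvd_symm irreducible_X h0
    rw [X_dvd_iff, cyclotomic_coeff_zero _ hm] at h1
    exact one_ne_zero h1
  have key : ∀ i : ℕ, 0 < i → (cyclotomicPrime m hm0).valuation (RatFunc ℚ) (1 - q ^ i) =
      if m ∣ i then WithZero.exp (-1) else 1 := fun i hi ↦ by
    rw [← intValuation_X_pow_sub_one hm0 hi, ← Valuation.map_neg,
      ← HeightOneSpectrum.valuation_of_algebraMap (K := RatFunc ℚ)]
    congr 1
    simp [q]
  have key' : ∀ j : ℤ, j ≠ 0 → (cyclotomicPrime m hm0).valuation (RatFunc ℚ) (1 - q ^ j) =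
      if (m : ℤ) ∣ j then WithZero.exp (-1) else 1 := fun j hj ↦ by
    obtain ⟨i, rfl | rfl⟩ := j.eq_nat_or_neg
    · rw [zpow_natCast, key i (by omega)]
      simp only [Int.natCast_dvd_natCast]
    · have : 1 - q ^ (-(i : ℤ)) = -(q ^ (-(i : ℤ)) * (1 - q ^ i)) := by
        rw [zpow_neg, zpow_natCast]
        have := q_ne_zero
        field_simp
        ring
      rw [this, Valuation.map_neg, map_mul, map_zpow₀, hq, one_zpow, one_mul, key i (by omega)]
      simp only [dvd_neg, Int.natCast_dvd_natCast]
  refine ⟨hm, by simp, ?_, hq, fun j hj ↦ ?_, fun j hj hd ↦ ?_⟩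
  · rw [← WithZero.exp_zero, WithZero.exp_lt_exp]
    simp
  · rw [key' j (by rintro rfl; simp at hj), if_neg hj]
  · rw [key' j hj, if_pos hd]

/-- A rational function of valuation at most `exp (-k)` at `Φ_m`, `k ≥ 1`, has numerator divisible
by `Φ_m ^ k` and denominator coprime to `Φ_m`. -/
lemma pow_dvd_num_of_valuation_le {m : ℕ} (hm : 0 < m) {k : ℕ} (hk : k ≠ 0) {f : RatFunc ℚ}
    (hf : (cyclotomicPrime m hm).valuation (RatFunc ℚ) f ≤ WithZero.exp (-(k : ℤ))) :
    cyclotomic m ℚ ^ k ∣ f.num ∧ IsCoprime f.denom (cyclotomic m ℚ) := by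
  have hd : algebraMap ℚ[X] (RatFunc ℚ) f.denom ≠ 0 := by
    simpa using f.denom_ne_zero
  have hfd : f * algebraMap ℚ[X] (RatFunc ℚ) f.denom = algebraMap ℚ[X] (RatFunc ℚ) f.num := by
    nth_rewrite 1 [← f.num_div_denom]
    field_simp
  have hnum : cyclotomic m ℚ ^ k ∣ f.num := by
    rw [← Ideal.mem_span_singleton, ← Ideal.span_singleton_pow]
    refine ((cyclotomicPrime m hm).intValuation_le_pow_iff_mem f.num k).mp ?_
    rw [← HeightOneSpectrum.valuation_of_algebraMap (K := RatFunc ℚ)]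
    refine (congr_arg _ hfd).symm.le.trans ?_
    rw [map_mul]
    exact (mul_le_of_le_one_right' (HeightOneSpectrum.valuation_le_one _ _)).trans hf
  refine ⟨hnum, ?_⟩
  exact (f.isCoprime_num_denom.symm).of_isCoprime_of_dvd_right ((dvd_pow_self _ hk).trans hnum)

end Cyclotomic

section Defect

variable {K : Type*} [Field K]

local notation "φ" => shiftedFactorial

/-- The quotient `(c p; p)_k / (p; p)_k`. -/
def shiftRatio (c p : K) (k : ℕ) : K :=
  φ (c * p) p k / φ p p k

/-- The coefficient of `1 - x` in the last boundary term, to lowest order in `1 - x`. -/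
def lastWeight (x p a : K) (M : ℕ) : K :=
  p ^ (M * M) / x ^ M * (φ (a ^ 2) p M / φ p p M)

/-- The coefficient of `(1 - x) ^ 4` in the `j`-th boundary term, to lowest order in `1 - x`. -/
def sideWeight (x p a : K) (M j : ℕ) : K :=
  (x / p) ^ (j + 2 * (M - j)) * (φ p p j * φ (a ^ 2) p j) / ((1 - a * p ^ j) ^ 3 * φ a p j ^ 2)

/-- The difference between the sum of the boundary terms and its approximation. -/
def boundaryDefect (x p a : K) (M : ℕ) : K :=
  ∑ j ∈ range (M + 1), boundaryTerm a p j M -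
    ((1 - x) * lastWeight x p a M * (1 - ((1 - x) ^ 2 + (1 - x) ^ 3) *
        ∑ i ∈ range M, p * p ^ i / (1 - p * p ^ i) ^ 2) +
      (1 - x) ^ 4 * ∑ j ∈ range M, sideWeight x p a M j)

/-- Lowest order expansion, in `1 - x`, of the sum of the boundary terms. -/
lemma boundaryDefect_eq {x p : K} (hx : x ≠ 0) (hx1 : 1 - x ≠ 0) (hp : p ≠ 0)
    (hpp : ∀ i : ℕ, 1 - p * p ^ i ≠ 0) (M : ℕ) {a : K} (ha : a = x / p ^ M)
    (h : ∀ i : ℕ, 1 - a * p ^ i ≠ 0) :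
    boundaryDefect x p a M =
      (1 - x) * lastWeight x p a M * ((shiftRatio x⁻¹ p M * shiftRatio x p M - 1 +
          (1 - x) ^ 2 / x * ∑ i ∈ range M, p * p ^ i / (1 - p * p ^ i) ^ 2) -
        (1 - x) ^ 4 / x * ∑ i ∈ range M, p * p ^ i / (1 - p * p ^ i) ^ 2) +
      ∑ j ∈ range M, (1 - x) ^ 4 * sideWeight x p a M j *
        (shiftRatio x⁻¹ p M ^ 3 * shiftRatio x⁻¹ p (M - j) * shiftRatio x p j - 1) := by
  have hlast : boundaryTerm a p M M = (1 - x) * lastWeight x p a M *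
      (shiftRatio x⁻¹ p M * shiftRatio x p M) := by
    rw [boundaryTerm_last hx hx1 hp hpp M ha h, lastWeight, shiftRatio, shiftRatio, ← div_eq_inv_mul]
  have hside : ∀ j ∈ range M, boundaryTerm a p j M = (1 - x) ^ 4 * sideWeight x p a M j *
      (shiftRatio x⁻¹ p M ^ 3 * shiftRatio x⁻¹ p (M - j) * shiftRatio x p j) := fun j hj ↦ by
    obtain ⟨l, rfl⟩ := Nat.exists_eq_add_of_le (mem_range.mp hj).le
    rw [boundaryTerm_eq hx hp hpp j l ha h, Nat.add_sub_cancel_left, sideWeight, shiftRatio,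
      shiftRatio, shiftRatio, ← div_eq_inv_mul, Nat.add_sub_cancel_left]
  rw [boundaryDefect, sum_range_succ, hlast, sum_congr rfl hside, mul_sum (range M) (sideWeight x p a M)]
  simp only [mul_sub_one, sum_sub_distrib]
  generalize ∑ j ∈ range M, (1 - x) ^ 4 * sideWeight x p a M j = S
  generalize ∑ j ∈ range M, (1 - x) ^ 4 * sideWeight x p a M j *
    (shiftRatio x⁻¹ p M ^ 3 * shiftRatio x⁻¹ p (M - j) * shiftRatio x p j) = S'
  generalize ∑ i ∈ range M, p * p ^ i / (1 - p * p ^ i) ^ 2 = W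
  field_simp
  ring

end Defect

lemma one_sub_zpow_mul_pow (s d : ℤ) (i : ℕ) :
    1 - q ^ s * (q ^ d) ^ i = 1 - q ^ (s + d * i) := by
  rw [zpow_add₀ q_ne_zero, zpow_mul, zpow_natCast]

lemma one_sub_zpow_mul_pow_ne_zero {s d : ℤ} (h : ∀ i : ℕ, s + d * i ≠ 0) (i : ℕ) :
    1 - q ^ s * (q ^ d) ^ i ≠ 0 := by
  rw [one_sub_zpow_mul_pow]
  exact one_sub_q_zpow_ne_zero (h i)

lemma q_zpow_eq_div {n d M : ℕ} {r : ℤ} (hnr : (n : ℤ) = r + d * M) :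
    q ^ r = q ^ (n : ℤ) / (q ^ (d : ℤ)) ^ M := by
  have := zpow_ne_zero (d * M : ℤ) q_ne_zero
  rw [hnr, zpow_add₀ q_ne_zero, ← zpow_natCast, ← zpow_mul]
  field_simp

lemma shiftRatio_eq_prod (s : ℤ) (d : ℕ) (k : ℕ) :
    shiftRatio (q ^ s) (q ^ (d : ℤ)) k =
      ∏ i ∈ range k, ((1 - q ^ (s + (d + d * i : ℤ))) / (1 - q ^ (d + d * i : ℤ))) := by
  rw [shiftRatio, ← zpow_add₀ q_ne_zero, ← qPoch_eq, ← qPoch_eq, qPoch, qPoch, prod_div_distrib]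
  simp only [add_assoc]

namespace IsCyclotomicValuation

variable {Γ : Type*} [LinearOrderedCommGroupWithZero Γ] {v : Valuation (RatFunc ℚ) Γ} {θ : Γ}
  {m : ℕ}

lemma map_shiftRatio_le (hv : IsCyclotomicValuation v θ m) {s : ℤ} (hs : (m : ℤ) ∣ s) {d : ℕ}
    (hd : 0 < d) (k : ℕ) : v (shiftRatio (q ^ s) (q ^ (d : ℤ)) k) ≤ 1 := by
  rw [shiftRatio_eq_prod, map_prod]
  refine prod_le_one' fun i _ ↦ ?_
  have hi : (d + d * i : ℤ) ≠ 0 := by positivity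
  rw [map_div₀]
  refine div_le_one_of_le₀ ?_ zero_le
  rw [hv.map_one_sub hi]
  simpa only [dvd_add_right hs] using hv.map_one_sub_le (s + (d + d * i : ℤ))

lemma map_shiftRatio_sub_one_le (hv : IsCyclotomicValuation v θ m) {s : ℤ} (hs : (m : ℤ) ∣ s)
    {d : ℕ} (hd : 0 < d) (k : ℕ) (hk : ∀ i < k, ¬ (m : ℤ) ∣ d + d * i) :
    v (shiftRatio (q ^ s) (q ^ (d : ℤ)) k - 1) ≤ θ := by
  rw [shiftRatio_eq_prod]
  refine v.map_prod_sub_one_le hv.lt_one.le _ _ fun i hi ↦ ?_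
  have h1 := one_sub_q_zpow_ne_zero (j := (d + d * i : ℤ)) (by positivity)
  rw [show (1 - q ^ (s + (d + d * i : ℤ))) / (1 - q ^ (d + d * i : ℤ)) - 1 =
      q ^ (d + d * i : ℤ) * (1 - q ^ s) / (1 - q ^ (d + d * i : ℤ)) by
    rw [zpow_add₀ q_ne_zero s]
    field_simp
    ring]
  rw [map_div₀, map_mul, hv.map_q_zpow, one_mul,
    hv.map_of_not_dvd _ (hk i (mem_range.mp hi)), div_one]
  simpa [hs] using hv.map_one_sub_le s

lemma map_lastWeight_le (hv : IsCyclotomicValuation v θ m) {d : ℕ} (hd : 0 < d)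
    (hmd : IsCoprime (m : ℤ) d) (n r : ℤ) (M : ℕ) :
    v (lastWeight (q ^ n) (q ^ (d : ℤ)) (q ^ r) M) ≤ 1 := by
  rw [lastWeight, ← zpow_natCast (q ^ r), ← zpow_mul, ← qPoch_eq, ← qPoch_eq]
  simp only [map_mul, map_div₀, map_pow, hv.map_q_zpow, one_pow, div_one, one_mul]
  refine div_le_one_of_le₀ ?_ zero_le
  rw [hv.map_qPoch_self hd hmd]
  exact hv.map_qPoch_le hmd _ _

lemma map_sideWeight (hv : IsCyclotomicValuation v θ m) (n r : ℤ) (d M j : ℕ) :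
    v (sideWeight (q ^ n) (q ^ (d : ℤ)) (q ^ r) M j) = v (qPoch d d j) * v (qPoch (2 * r) d j) /
      (v (1 - q ^ (r + d * j)) * v (qPoch r d (j + 1)) ^ 2) := by
  have h2 : (q ^ r) ^ 2 = q ^ (2 * r) := by rw [mul_comm, zpow_mul]; rfl
  have h1 : qPoch r d (j + 1) = qPoch r d j * (1 - q ^ (r + d * j)) := prod_range_succ _ _
  rw [sideWeight, h2, ← qPoch_eq, ← qPoch_eq, ← qPoch_eq, one_sub_zpow_mul_pow, h1]
  simp only [map_mul, map_div₀, map_pow, hv.map_q_zpow, one_pow, div_one, one_mul]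
  rw [mul_pow, mul_left_comm, ← pow_succ', mul_comm (v (qPoch r d j) ^ 2)]

lemma map_sideWeight_mul_le (hv : IsCyclotomicValuation v θ m) {d : ℕ}
    (hmd : IsCoprime (m : ℤ) d) (n : ℤ) {r : ℤ} (hr : ∀ i : ℕ, r + d * i ≠ 0) (M j : ℕ) :
    θ ^ 4 * v (sideWeight (q ^ n) (q ^ (d : ℤ)) (q ^ r) M j) ≤ θ := by
  have hnum := mul_le_mul' (hv.map_qPoch_le hmd d j) (hv.map_qPoch_le hmd (2 * r) j)
  have hden := mul_le_mul' (hv.le_map_one_sub (hr j))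
    (pow_le_pow_left' (hv.le_map_qPoch_succ hmd hr j) 2)
  rw [hv.map_sideWeight, ← mul_div_assoc]
  refine div_le_of_le_mul₀ zero_le zero_le ?_
  refine (mul_le_mul_right hnum _).trans (le_trans (le_of_eq ?_) (mul_le_mul_right hden _))
  simp only [← pow_add, ← pow_mul, ← pow_succ']
  congr 1
  ring

lemma map_sideWeight_le_one (hv : IsCyclotomicValuation v θ m) {d : ℕ}
    (hmd : IsCoprime (m : ℤ) d) (n : ℤ) {r : ℤ} (M : ℕ) {j : ℕ}
    (hj : ∀ i < j + 1, ¬ (m : ℤ) ∣ r + d * i) :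
    v (sideWeight (q ^ n) (q ^ (d : ℤ)) (q ^ r) M j) ≤ 1 := by
  have h1 : v (qPoch r d (j + 1)) = 1 := by
    rw [qPoch, map_prod]
    exact prod_eq_one fun i hi ↦ hv.map_of_not_dvd _ (hj i (mem_range.mp hi))
  rw [hv.map_sideWeight, h1, hv.map_of_not_dvd _ (hj j (Nat.lt_succ_self j)), one_pow, one_mul,
    div_one]
  have hle : ∀ s : ℤ, v (qPoch s d j) ≤ 1 := fun s ↦
    (hv.map_qPoch_le hmd s j).trans (pow_le_one' hv.lt_one.le _)
  exact mul_le_one' (hle _) (hle _)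

lemma map_sq_mul_le (hv : IsCyclotomicValuation v θ m) {d : ℕ} (hd : 0 < d) (i : ℕ) :
    θ ^ 2 * v (q ^ (d : ℤ) * (q ^ (d : ℤ)) ^ i /
      (1 - q ^ (d : ℤ) * (q ^ (d : ℤ)) ^ i) ^ 2) ≤ 1 := by
  rw [one_sub_zpow_mul_pow]
  simp only [map_mul, map_div₀, map_pow, hv.map_q_zpow, one_pow, one_mul]
  rw [← mul_div_assoc, mul_one]
  refine div_le_one_of_le₀ ?_ zero_le
  exact pow_le_pow_left' (hv.le_map_one_sub (by positivity)) 2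

lemma map_div_sq_eq_one (hv : IsCyclotomicValuation v θ m) {d i : ℕ}
    (hi : ¬ (m : ℤ) ∣ d + d * i) :
    v (q ^ (d : ℤ) * (q ^ (d : ℤ)) ^ i / (1 - q ^ (d : ℤ) * (q ^ (d : ℤ)) ^ i) ^ 2) = 1 := by
  rw [one_sub_zpow_mul_pow]
  simp only [map_mul, map_div₀, map_pow, hv.map_q_zpow, one_pow, one_mul, hv.map_of_not_dvd _ hi,
    div_one]

variable {n d M : ℕ} {r : ℤ}

/-- At a prime `Φ_m`, `m ∣ n`, the defect vanishes. -/
theorem map_boundaryDefect_le (hv : IsCyclotomicValuation v θ m) (hn : 0 < n) (hd : 0 < d)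
    (hmn : (m : ℤ) ∣ n) (hmd : IsCoprime (m : ℤ) d) (hnr : (n : ℤ) = r + d * M)
    (hr : ∀ i : ℕ, r + d * i ≠ 0) :
    v (boundaryDefect (q ^ (n : ℤ)) (q ^ (d : ℤ)) (q ^ r) M) ≤ θ := by
  have hx := hv.map_of_dvd n (by positivity) hmn
  have hθ := hv.lt_one.le
  have hF := hv.map_shiftRatio_le ((dvd_neg (a := (m : ℤ))).mpr hmn) hd
  have hE := hv.map_shiftRatio_le hmn hd
  rw [boundaryDefect_eq (zpow_ne_zero _ q_ne_zero) (one_sub_q_zpow_ne_zero (by positivity))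
    (zpow_ne_zero _ q_ne_zero) (one_sub_zpow_mul_pow_ne_zero fun i ↦ by positivity) M
    (q_zpow_eq_div hnr) (one_sub_zpow_mul_pow_ne_zero hr), ← zpow_neg]
  have hW : θ ^ 2 * v (∑ i ∈ range M, q ^ (d : ℤ) * (q ^ (d : ℤ)) ^ i /
      (1 - q ^ (d : ℤ) * (q ^ (d : ℤ)) ^ i) ^ 2) ≤ 1 := by
    rw [← hx, ← map_pow, ← map_mul, mul_sum]
    refine v.map_sum_le fun i _ ↦ ?_
    rw [map_mul, map_pow, hx]
    exact hv.map_sq_mul_le hd i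
  generalize ∑ i ∈ range M, q ^ (d : ℤ) * (q ^ (d : ℤ)) ^ i /
      (1 - q ^ (d : ℤ) * (q ^ (d : ℤ)) ^ i) ^ 2 = W at *
  refine v.map_add_le ?_ (v.map_sum_le fun j _ ↦ ?_)
  · rw [map_mul, map_mul, hx, mul_assoc]
    refine mul_le_of_le_one_right' (mul_le_one' (hv.map_lastWeight_le hd hmd n r M) ?_)
    refine v.map_sub_le (v.map_add_le (v.map_sub_le ?_ v.map_one.le) ?_) ?_
    · rw [map_mul]
      exact mul_le_one' (hF M) (hE M)
    · rwa [map_mul, map_div₀, map_pow, hx, hv.map_q_zpow, div_one]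
    · rw [map_mul, map_div₀, map_pow, hx, hv.map_q_zpow, div_one, pow_add θ 2 2, mul_assoc]
      exact mul_le_one' (pow_le_one' hθ 2) hW
  · rw [map_mul, map_mul, map_pow, hx]
    refine mul_le_of_le_of_le_one (hv.map_sideWeight_mul_le hmd n hr M j)
      (v.map_sub_le ?_ v.map_one.le)
    simp only [map_mul, map_pow]
    exact mul_le_one' (mul_le_one' (pow_le_one' (hF M) 3) (hF _)) (hE j)

/-- At the prime `Φ_n` the defect vanishes to order five. -/
theorem map_boundaryDefect_le_pow (hv : IsCyclotomicValuation v θ n) (hd : 0 < d)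
    (hnd : IsCoprime (n : ℤ) d) (hM : M < n) (hnr : (n : ℤ) = r + d * M)
    (hr : ∀ i : ℕ, r + d * i ≠ 0) :
    v (boundaryDefect (q ^ (n : ℤ)) (q ^ (d : ℤ)) (q ^ r) M) ≤ θ ^ 5 := by
  have hn : 0 < n := zero_lt_one.trans hv.one_lt
  have hx := hv.map_of_dvd n (by positivity) dvd_rfl
  have hθ := hv.lt_one.le
  have hdvd : ∀ i : ℕ, 0 < i → i < n → ¬ (n : ℤ) ∣ d * i := fun i h0 hi h ↦
    absurd (Nat.le_of_dvd h0 (Int.natCast_dvd_natCast.mp (hnd.dvd_of_dvd_mul_left h))) hi.not_ge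
  have hdvd1 : ∀ i < M, ¬ (n : ℤ) ∣ d + d * i := fun i hi h ↦
    hdvd (i + 1) (by omega) (by omega) (by push_cast; rwa [mul_add, mul_one, add_comm])
  have hdvd2 : ∀ i < M, ¬ (n : ℤ) ∣ r + d * i := fun i hi h ↦ by
    refine hdvd (M - i) (by omega) (by omega) ?_
    rw [Nat.cast_sub hi.le, show (d : ℤ) * (M - i) = n - (r + d * i) by rw [hnr]; ring]
    exact dvd_sub dvd_rfl h
  have hF := fun k (hk : k ≤ M) ↦ hv.map_shiftRatio_sub_one_le
    ((dvd_neg (a := (n : ℤ))).mpr dvd_rfl) hd k fun i hi ↦ hdvd1 i (hi.trans_le hk)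
  have hE := fun k (hk : k ≤ M) ↦ hv.map_shiftRatio_sub_one_le
    dvd_rfl hd k fun i hi ↦ hdvd1 i (hi.trans_le hk)
  have hp := zpow_ne_zero (n : ℤ) q_ne_zero
  rw [boundaryDefect_eq (zpow_ne_zero _ q_ne_zero) (one_sub_q_zpow_ne_zero (by positivity))
    (zpow_ne_zero _ q_ne_zero) (one_sub_zpow_mul_pow_ne_zero fun i ↦ by positivity) M
    (q_zpow_eq_div hnr) (one_sub_zpow_mul_pow_ne_zero hr), ← zpow_neg]
  have hw : ∀ i ∈ range M, v (q ^ (d : ℤ) * (q ^ (d : ℤ)) ^ i /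
      (1 - q ^ (d : ℤ) * (q ^ (d : ℤ)) ^ i) ^ 2) ≤ 1 := fun i hi ↦
    (hv.map_div_sq_eq_one (hdvd1 i (mem_range.mp hi))).le
  have ht : v ((1 - q ^ (n : ℤ)) ^ 2 / q ^ (n : ℤ)) = θ ^ 2 := by
    rw [map_div₀, map_pow, hx, hv.map_q_zpow, div_one]
  refine v.map_add_le ?_ (v.map_sum_le fun j hj ↦ ?_)
  · rw [map_mul, map_mul, hx, mul_assoc, pow_succ' θ 4]
    refine mul_le_mul_right (mul_le_of_le_one_of_le (hv.map_lastWeight_le hd hnd n r M) ?_) θ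
    refine v.map_sub_le ?_ ?_
    · rw [shiftRatio, zpow_neg, ← div_eq_inv_mul, shiftRatio,
        shiftedFactorial_pair hp (one_sub_zpow_mul_pow_ne_zero fun i ↦ by positivity)]
      refine (v.map_prod_one_sub_le (ht.trans_le (pow_le_one' hθ 2)) _ _ hw).trans ?_
      rw [ht, ← pow_mul]
    · rw [map_mul, map_div₀, map_pow, hx, hv.map_q_zpow, div_one]
      exact mul_le_of_le_one_right' (v.map_sum_le hw)
  · have hjM : j < M := mem_range.mp hj
    have hT := hv.map_sideWeight_le_one hnd n M fun i (hi : i < j + 1) ↦ hdvd2 i (by omega)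
    rw [map_mul, map_mul, map_pow, hx, pow_succ θ 4]
    refine mul_le_mul' (mul_le_of_le_one_right' hT) ?_
    exact v.map_mul_sub_one_le hθ (v.map_mul_sub_one_le hθ
      (v.map_pow_sub_one_le hθ (hF M le_rfl) 3) (hF _ (Nat.sub_le _ _))) (hE j hjM.le)

end IsCyclotomicValuation

section Assembly

variable {n d M : ℕ} {r : ℤ}

lemma one_sub_q_ne_zero : 1 - q ≠ 0 := by
  simpa using one_sub_q_zpow_ne_zero one_ne_zero

lemma one_sub_q_mul_sum_eq (hd : 0 < d) (hr : ∀ i : ℕ, r + d * i ≠ 0) :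
    (1 - q) * (∑ k ∈ range (M + 1),
        qint (2 * d * k + r) * (qPoch r d k) ^ 4 / (qPoch d d k) ^ 4 *
          q ^ (((d : ℤ) - 2 * r) * k)) =
      ∑ j ∈ range (M + 1), boundaryTerm (q ^ r) (q ^ (d : ℤ)) j M := by
  rw [← sum_wellPoisedTerm (zpow_ne_zero _ q_ne_zero) (zpow_ne_zero _ q_ne_zero)
    (one_sub_zpow_mul_pow_ne_zero hr) (one_sub_zpow_mul_pow_ne_zero fun i ↦ by positivity), mul_sum]
  refine sum_congr rfl fun k _ ↦ ?_
  have h1 : q ^ (2 * d * k + r : ℤ) = q ^ r * (q ^ (d : ℤ)) ^ (2 * k) := by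
    rw [← zpow_natCast, ← zpow_mul, ← zpow_add₀ q_ne_zero]
    congr 1
    push_cast
    ring
  have h2 : q ^ (((d : ℤ) - 2 * r) * k) = (q ^ (d : ℤ) / (q ^ r) ^ 2) ^ k := by
    rw [← zpow_natCast, ← zpow_natCast, ← zpow_mul, ← zpow_sub₀ q_ne_zero, ← zpow_mul]
    congr 1
    push_cast
    ring
  have h3 := one_sub_q_ne_zero
  have h4 := shiftedFactorial_ne_zero (K := RatFunc ℚ) (a := q ^ (d : ℤ)) (p := q ^ (d : ℤ))
    (one_sub_zpow_mul_pow_ne_zero fun i ↦ by positivity) k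
  rw [wellPoisedTerm, contiguousCoeff, range_zero, prod_empty, mul_one, pow_zero, mul_one, mul_one,
    Nat.sub_zero, qint, h1, h2, qPoch_eq, qPoch_eq]
  field_simp

lemma sum_Icc_one_eq {N : Type*} [AddCommMonoid N] (f : ℕ → N) (M : ℕ) :
    ∑ k ∈ Icc 1 M, f k = ∑ i ∈ range M, f (i + 1) := by
  rw [range_eq_Ico, sum_Ico_add' f 0 M 1]
  exact sum_congr (by ext; simp) fun _ _ ↦ rfl

lemma one_sub_q_mul_eq (hd : 0 < d) (hnr : (n : ℤ) = r + d * M) :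
    (1 - q) * (q ^ ((r * (r - n)) / d) * (qPoch (2 * r) d M / qPoch d d M) *
        (qint n - ((qint n) ^ 3 + (qint n) ^ 4 * (1 - q)) *
          ∑ k ∈ Finset.Icc 1 M, q ^ (k * d) / (qint (k * d)) ^ 2) +
       (qint n) ^ 4 *
        ∑ k ∈ Finset.Icc 1 M,
          q ^ ((((k : ℤ) * d - d - 2 * n + 2 * r) * ((d : ℤ) - n)) / d) *
            (qPoch d d (k - 1) * qPoch (2 * r) d (k - 1)) /
            ((qint ((d : ℤ) * k - d + r)) ^ 3 * (qPoch r d (k - 1)) ^ 2)) =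
      (1 - q ^ (n : ℤ)) * lastWeight (q ^ (n : ℤ)) (q ^ (d : ℤ)) (q ^ r) M *
        (1 - ((1 - q ^ (n : ℤ)) ^ 2 + (1 - q ^ (n : ℤ)) ^ 3) *
          ∑ i ∈ range M, q ^ (d : ℤ) * (q ^ (d : ℤ)) ^ i /
            (1 - q ^ (d : ℤ) * (q ^ (d : ℤ)) ^ i) ^ 2) +
      (1 - q ^ (n : ℤ)) ^ 4 *
        ∑ j ∈ range M, sideWeight (q ^ (n : ℤ)) (q ^ (d : ℤ)) (q ^ r) M j := by
  have hd' : (d : ℤ) ≠ 0 := by positivity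
  have h1 := one_sub_q_ne_zero
  have h2 : (q ^ r) ^ 2 = q ^ (2 * r) := by rw [mul_comm, zpow_mul]; rfl
  have hw : q ^ ((r * (r - n)) / d) * (qPoch (2 * r) d M / qPoch d d M) =
      lastWeight (q ^ (n : ℤ)) (q ^ (d : ℤ)) (q ^ r) M := by
    rw [lastWeight, h2, ← qPoch_eq, ← qPoch_eq, ← zpow_natCast, ← zpow_natCast, ← zpow_mul,
      ← zpow_mul, ← zpow_sub₀ q_ne_zero, show r * (r - n) = d * (-r * M) by rw [hnr]; ring,
      Int.mul_ediv_cancel_left _ hd']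
    congr 2
    push_cast
    rw [hnr]
    ring
  have hs : ∑ k ∈ Finset.Icc 1 M, q ^ (k * d) / (qint (k * d)) ^ 2 = (1 - q) ^ 2 *
      ∑ i ∈ range M, q ^ (d : ℤ) * (q ^ (d : ℤ)) ^ i /
        (1 - q ^ (d : ℤ) * (q ^ (d : ℤ)) ^ i) ^ 2 := by
    rw [sum_Icc_one_eq, mul_sum]
    refine sum_congr rfl fun i _ ↦ ?_
    have h3 : q ^ ((i + 1) * d) = q ^ (d : ℤ) * (q ^ (d : ℤ)) ^ i := by
      rw [zpow_natCast]
      ring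
    have h4 := one_sub_zpow_mul_pow_ne_zero (s := d) (d := d) (fun i ↦ by positivity) i
    rw [qint, ← Nat.cast_mul, zpow_natCast, h3]
    field_simp
  have ht : ∀ j : ℕ, j < M →
      q ^ (((((j + 1 : ℕ) : ℤ) * d - d - 2 * n + 2 * r) * ((d : ℤ) - n)) / d) *
      (qPoch d d (j + 1 - 1) * qPoch (2 * r) d (j + 1 - 1)) /
      ((qint ((d : ℤ) * (j + 1 : ℕ) - d + r)) ^ 3 * (qPoch r d (j + 1 - 1)) ^ 2) =
      (1 - q) ^ 3 * sideWeight (q ^ (n : ℤ)) (q ^ (d : ℤ)) (q ^ r) M j := fun j hj ↦ by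
    rw [Nat.add_sub_cancel]
    have hexp : q ^ (((((j + 1 : ℕ) : ℤ) * d - d - 2 * n + 2 * r) * ((d : ℤ) - n)) / d) =
        (q ^ (n : ℤ) / q ^ (d : ℤ)) ^ (j + 2 * (M - j)) := by
      rw [← zpow_natCast, ← zpow_sub₀ q_ne_zero, ← zpow_mul,
        show (((j + 1 : ℕ) : ℤ) * d - d - 2 * n + 2 * r) * ((d : ℤ) - n) =
          d * ((j - 2 * M) * (d - n)) by rw [hnr]; push_cast; ring,
        Int.mul_ediv_cancel_left _ hd']
      congr 1
      push_cast [hj.le]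
      ring
    rw [sideWeight, h2, hexp, ← qPoch_eq, ← qPoch_eq, ← qPoch_eq, one_sub_zpow_mul_pow, qint,
      show (d : ℤ) * (j + 1 : ℕ) - d + r = r + d * j by push_cast; ring]
    field_simp
  rw [hw, hs, sum_Icc_one_eq, sum_congr rfl fun j hj ↦ ht j (mem_range.mp hj), ← mul_sum, qint]
  field_simp

lemma modCong_of_cyclotomicPrime (hn : 1 < n) {A B : RatFunc ℚ}
    (h : ∀ m (hm : 1 < m), m ∣ n → (cyclotomicPrime m (zero_lt_one.trans hm)).valuation (RatFunc ℚ)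
      (A - B) ≤ WithZero.exp (-1))
    (h' : (cyclotomicPrime n (zero_lt_one.trans hn)).valuation (RatFunc ℚ)
      (A - B) ≤ WithZero.exp (-1) ^ 5) :
    modCong A B (qintPoly n * cyclotomic n ℚ ^ 4) := by
  have hn0 : n ≠ 0 := by omega
  set e : ℕ → ℕ := fun m ↦ if m = n then 5 else 1 with he
  have hP : qintPoly n * cyclotomic n ℚ ^ 4 =
      ∏ m ∈ n.divisors.erase 1, cyclotomic m ℚ ^ e m := by
    have hmem : n ∈ n.divisors.erase 1 := by simp [hn0, hn.ne']
    rw [qintPoly, ← prod_cyclotomic_eq_geom_sum (by omega), ← mul_prod_erase _ _ hmem,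
      ← mul_prod_erase _ _ hmem, prod_congr (g := fun m ↦ cyclotomic m ℚ ^ e m) rfl fun m hm ↦ by
        simp only [he, if_neg (ne_of_mem_erase hm), pow_one]]
    simp only [he, if_true]
    ring
  have key : ∀ m ∈ n.divisors.erase 1,
      cyclotomic m ℚ ^ e m ∣ (A - B).num ∧ IsCoprime (A - B).denom (cyclotomic m ℚ) := by
    intro m hm
    have hmn : m ∣ n := Nat.dvd_of_mem_divisors (mem_of_mem_erase hm)
    have hm0 := Nat.pos_of_dvd_of_pos hmn (by omega)
    have hm1 : 1 < m := by have := ne_of_mem_erase hm; omega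
    refine pow_dvd_num_of_valuation_le hm0 (by simp only [he]; split_ifs <;> simp) ?_
    simp only [he]
    split_ifs with hmn'
    · subst hmn'
      exact h'.trans_eq (by rw [← WithZero.exp_nsmul]; rfl)
    · exact h m hm1 hmn
  obtain ⟨c, hc⟩ : qintPoly n * cyclotomic n ℚ ^ 4 ∣ (A - B).num := by
    rw [hP]
    exact prod_dvd_of_coprime (fun i _ j _ hij ↦ (cyclotomic.isCoprime_rat hij).pow)
      fun m hm ↦ (key m hm).1
  refine ⟨c, (A - B).denom, ?_, ?_⟩
  · rw [hP]
    exact IsCoprime.prod_right fun m hm ↦ (key m hm).2.pow_right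
  · rw [← hc, RatFunc.num_div_denom]

end Assembly

/-- Theorem 1.1 of the paper, case `M = (n-r)/d`: modulo `[n]Φ_n(q)^4`,
`Σ_{k=0}^{M} [2dk+r](q^r;q^d)_k^4/(q^d;q^d)_k^4 q^{(d-2r)k}
 ≡ q^{r(r-n)/d} (q^{2r};q^d)_M/(q^d;q^d)_M ([n] - ([n]^3+[n]^4(1-q)) Σ_{k=1}^M q^{kd}/[kd]^2)
 + [n]^4 Σ_{k=1}^M q^{(kd-d-2n+2r)(d-n)/d} (q^d;q^d)_{k-1}(q^{2r};q^d)_{k-1}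
   /([dk-d+r]^3 (q^r;q^d)_{k-1}^2)`. -/
theorem stmt10 (n d : ℕ) (hn : 0 < n) (hd : 0 < d) (hnd : Nat.gcd n d = 1) (r : ℤ)
    (hr1 : (n : ℤ) + d - n * d ≤ r) (hr2 : r ≤ (n : ℤ))
    (hmod : (n : ℤ) ≡ r [ZMOD (d : ℤ)]) :
    modCong
      (∑ k ∈ Finset.range ((((n : ℤ) - r) / d).toNat + 1),
        qint (2 * d * k + r) * (qPoch r d k) ^ 4 / (qPoch d d k) ^ 4 *
          q ^ (((d : ℤ) - 2 * r) * k))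
      (q ^ ((r * (r - n)) / d) *
        (qPoch (2 * r) d (((n : ℤ) - r) / d).toNat / qPoch d d (((n : ℤ) - r) / d).toNat) *
        (qint n - ((qint n) ^ 3 + (qint n) ^ 4 * (1 - q)) *
          ∑ k ∈ Finset.Icc 1 (((n : ℤ) - r) / d).toNat, q ^ (k * d) / (qint (k * d)) ^ 2) +
       (qint n) ^ 4 *
        ∑ k ∈ Finset.Icc 1 (((n : ℤ) - r) / d).toNat,
          q ^ ((((k : ℤ) * d - d - 2 * n + 2 * r) * ((d : ℤ) - n)) / d) *
            (qPoch d d (k - 1) * qPoch (2 * r) d (k - 1)) /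
            ((qint ((d : ℤ) * k - d + r)) ^ 3 * (qPoch r d (k - 1)) ^ 2))
      (qintPoly n * (Polynomial.cyclotomic n ℚ) ^ 4) := by
  have hnd' : IsCoprime (n : ℤ) d := Nat.isCoprime_iff_coprime.mpr hnd
  have hd' : (d : ℤ) ≠ 0 := by positivity
  obtain ⟨M, hM, hnr⟩ : ∃ M : ℕ, (((n : ℤ) - r) / d).toNat = M ∧ (n : ℤ) = r + d * M := by
    refine ⟨_, rfl, ?_⟩
    obtain ⟨c, hc⟩ := hmod.symm.dvd
    rw [hc, Int.mul_ediv_cancel_left _ hd', Int.toNat_of_nonneg, ← hc]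
    · ring
    · exact nonneg_of_mul_nonneg_right (by omega : (0 : ℤ) ≤ d * c) (by positivity)
  have hMn : M < n := by
    have : (d : ℤ) * (M + 1) ≤ d * n := by linarith
    have := le_of_mul_le_mul_left this (by positivity)
    omega
  have hr : ∀ i : ℕ, r + d * i ≠ 0 := fun i hi ↦ by
    have hdn : (d : ℤ) ∣ n := ⟨M - i, by linear_combination hnr + hi⟩
    have hd1 : d = 1 :=
      Nat.isUnit_iff.mp (Int.ofNat_isUnit.mp (hnd'.symm.isUnit_of_dvd' dvd_rfl hdn))
    subst hd1
    push_cast at hr1 hi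
    omega
  rw [hM]
  have key := congr_arg₂ (· - ·) (one_sub_q_mul_sum_eq (M := M) hd hr) (one_sub_q_mul_eq hd hnr)
  simp only [← mul_sub] at key
  rcases Nat.eq_or_lt_of_le (Nat.succ_le_of_lt hn) with hn1 | hn1
  · obtain rfl : M = 0 := by omega
    have h0 : boundaryDefect (q ^ (n : ℤ)) (q ^ (d : ℤ)) (q ^ r) 0 = 0 := by
      rw [boundaryDefect_eq (zpow_ne_zero _ q_ne_zero) (one_sub_q_zpow_ne_zero (by positivity))
        (zpow_ne_zero _ q_ne_zero)
        (one_sub_zpow_mul_pow_ne_zero fun i ↦ by positivity) 0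
        (q_zpow_eq_div hnr)
        (one_sub_zpow_mul_pow_ne_zero hr)]
      simp [shiftRatio, shiftedFactorial_zero]
    refine ⟨0, 1, isCoprime_one_left, ?_⟩
    rw [mul_zero, map_zero, zero_div]
    exact (mul_eq_zero.mp (key.trans h0)).resolve_left one_sub_q_ne_zero
  · have hval : ∀ m (hm : 1 < m) {D : RatFunc ℚ},
        (cyclotomicPrime m (zero_lt_one.trans hm)).valuation (RatFunc ℚ) ((1 - q) * D) =
          (cyclotomicPrime m (zero_lt_one.trans hm)).valuation (RatFunc ℚ) D := fun m hm D ↦ by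
      have h1 := (isCyclotomicValuation hm).map_of_not_dvd 1 (by
        rw [← Nat.cast_one, Int.natCast_dvd_natCast, Nat.dvd_one]
        exact hm.ne')
      rw [zpow_one] at h1
      rw [map_mul, h1, one_mul]
    refine modCong_of_cyclotomicPrime hn1 (fun m hm hmn ↦ ?_) ?_
    · rw [← hval m hm, key]
      have hmn' : (m : ℤ) ∣ n := Int.natCast_dvd_natCast.mpr hmn
      exact (isCyclotomicValuation hm).map_boundaryDefect_le hn hd hmn'
        (hnd'.of_isCoprime_of_dvd_left hmn') hnr hr
    · rw [← hval n hn1, key]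
      exact (isCyclotomicValuation hn1).map_boundaryDefect_le_pow hd hnd' hMn hnr hr
end

section
/- Let p ≥ 5 be prime. Then Σ_{k=0}^{(p-1)/2} (4k+1) ((1/2)_k)^4 / (k!)^4 ≡ p (mod p^4), where (1/2)_k denotes the Pochhammer symbol (rising factorial) of 1/2. -/
open Finset

/-- `A ≡ B (mod p^e)` for rational numbers, in the p-adic sense: the difference can be
written as `p^e · a / b` with `b` an integer not divisible by `p`. -/
def ratCongr (A B : ℚ) (p : ℕ) (e : ℕ) : Prop :=
  ∃ a b : ℤ, ¬ (p : ℤ) ∣ b ∧ (A - B) * (b : ℚ) = (p : ℚ) ^ e * (a : ℚ)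

/-- The Pochhammer symbol (rising factorial) `(a)_k = a(a+1)⋯(a+k-1)` for rational `a`. -/
noncomputable def rpoch (a : ℚ) (k : ℕ) : ℚ := (ascPochhammer ℚ k).eval a

/-- The harmonic number of order 2: `H^{(2)}_m = Σ_{j=1}^m 1/j^2`. -/
def H2 (m : ℕ) : ℚ := ∑ j ∈ Finset.Icc 1 m, 1 / (j : ℚ) ^ 2


namespace LongC2

/-- The well-poised quotient `∏_{j<k} ((2j+1)² - z) / ((2j+2)² - z)`; at `z = 0` it equals
`((1/2)_k / k!)²`. -/
def wellPoised (z : ℚ) (k : ℕ) : ℚ :=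
  ∏ j ∈ range k, ((2 * (j : ℚ) + 1) ^ 2 - z) / ((2 * (j : ℚ) + 2) ^ 2 - z)

/-- `∏_{i<r} (x - i) (x + i + 1/2)`, a basis of the polynomials in `x (x + 1/2)`. -/
def lambdaBasis (x : ℚ) (r : ℕ) : ℚ := ∏ i ∈ range r, (x - i) * (x + i + 1 / 2)

/-- The coefficients of `wellPoised z` in the basis `lambdaBasis`. -/
def saalCoeff (z : ℚ) (r : ℕ) : ℚ :=
  ∏ i ∈ range r, -(2 * (2 * (i : ℚ) + 1)) / ((i + 1) * ((2 * (i : ℚ) + 2) ^ 2 - z))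

/-- The moments of the weights `(4k+1) · wellPoised z k` against `lambdaBasis`. -/
def moment (z : ℚ) (n r : ℕ) : ℚ :=
  ∑ k ∈ range (n + 1), (4 * (k : ℚ) + 1) * wellPoised z k * lambdaBasis k r

lemma lambdaBasis_natCast_eq_zero {k r : ℕ} (h : k < r) : lambdaBasis k r = 0 :=
  prod_eq_zero (mem_range.2 h) (by simp)

lemma lambdaBasis_succ_right (x : ℚ) (r : ℕ) :
    lambdaBasis x (r + 1) = (∏ i ∈ range r, (x - i) * (x + i + 3 / 2)) * ((x - r) * (x + 1 / 2)) := by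
  induction r with
  | zero => simp [lambdaBasis]
  | succ r ih =>
    rw [lambdaBasis, prod_range_succ, ← lambdaBasis, ih, prod_range_succ]
    push_cast
    ring

lemma lambdaBasis_add_one (x : ℚ) (r : ℕ) :
    lambdaBasis (x + 1) (r + 1) =
      (∏ i ∈ range r, (x - i) * (x + i + 3 / 2)) * ((x + 1) * (x + r + 3 / 2)) := by
  induction r with
  | zero =>
    simp only [lambdaBasis, zero_add, prod_range_one, range_zero, prod_empty]
    push_cast
    ring
  | succ r ih =>
    rw [lambdaBasis, prod_range_succ, ← lambdaBasis, ih, prod_range_succ]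
    push_cast
    ring

lemma saalCoeff_succ (z : ℚ) (r : ℕ) :
    saalCoeff z (r + 1) =
      saalCoeff z r * (-(2 * (2 * (r : ℚ) + 1)) / ((r + 1) * ((2 * (r : ℚ) + 2) ^ 2 - z))) :=
  prod_range_succ _ _

lemma wellPoised_succ (z : ℚ) (k : ℕ) :
    wellPoised z (k + 1) =
      wellPoised z k * (((2 * (k : ℚ) + 1) ^ 2 - z) / ((2 * (k : ℚ) + 2) ^ 2 - z)) :=
  prod_range_succ _ _

lemma sum_saalCoeff_telescope {z : ℚ} (hz : ∀ j : ℕ, (2 * (j : ℚ) + 2) ^ 2 - z ≠ 0)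
    (x : ℚ) (m : ℕ) :
    ∑ r ∈ range (m + 1), saalCoeff z r * (lambdaBasis (x + 1) r * ((2 * x + 2) ^ 2 - z)
        - lambdaBasis x r * ((2 * x + 1) ^ 2 - z)) =
      (8 * x + 6) * (m + 1 / 2) * saalCoeff z m *
        ∏ i ∈ range m, (x - i) * (x + i + 3 / 2) := by
  induction m with
  | zero => simp [saalCoeff, lambdaBasis]; ring
  | succ m ih =>
    have h : saalCoeff z (m + 1) * (((m : ℚ) + 1) * ((2 * (m : ℚ) + 2) ^ 2 - z)) =
        saalCoeff z m * (-(2 * (2 * (m : ℚ) + 1))) := by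
      rw [saalCoeff_succ, mul_assoc, div_mul_cancel₀ _ (mul_ne_zero (by positivity) (hz m))]
    rw [sum_range_succ, ih, lambdaBasis_add_one, lambdaBasis_succ_right, prod_range_succ]
    push_cast
    linear_combination (8 * x + 6) / 4 * (∏ i ∈ range m, (x - i) * (x + i + 3 / 2)) * h

lemma wellPoised_eq_sum {z : ℚ} (hz : ∀ j : ℕ, (2 * (j : ℚ) + 2) ^ 2 - z ≠ 0) (k : ℕ) :
    ∀ m, k ≤ m → wellPoised z k = ∑ r ∈ range (m + 1), lambdaBasis k r * saalCoeff z r := by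
  induction k with
  | zero =>
    intro m _
    rw [sum_eq_single_of_mem 0 (by simp)]
    · simp [wellPoised, lambdaBasis, saalCoeff]
    · intro r _ hr
      rw [lambdaBasis_natCast_eq_zero (Nat.pos_of_ne_zero hr), zero_mul]
  | succ k ih =>
    intro m hm
    have h := sum_saalCoeff_telescope hz k m
    rw [prod_eq_zero (mem_range.2 (show k < m by omega)) (by simp), mul_zero] at h
    rw [wellPoised_succ, ih m (by omega), mul_div_assoc', div_eq_iff (hz k), ← sub_eq_zero,
      ← neg_eq_zero, ← h, sum_mul, sum_mul, ← sum_sub_distrib, ← sum_neg_distrib]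
    refine sum_congr rfl fun r _ => ?_
    push_cast
    ring

lemma sum_wellPoised_mul {y z : ℚ} (hz : ∀ j : ℕ, (2 * (j : ℚ) + 2) ^ 2 - z ≠ 0) (n : ℕ) :
    ∑ k ∈ range (n + 1), (4 * (k : ℚ) + 1) * wellPoised y k * wellPoised z k =
      ∑ r ∈ range (n + 1), moment y n r * saalCoeff z r := by
  simp_rw [moment, sum_mul]
  rw [sum_comm]
  refine sum_congr rfl fun k hk => ?_
  rw [wellPoised_eq_sum hz k n (by have := mem_range.1 hk; omega), mul_sum]
  exact sum_congr rfl fun r _ => by ring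

lemma wellPoised_succ_mul {z : ℚ} (hz : ∀ j : ℕ, (2 * (j : ℚ) + 2) ^ 2 - z ≠ 0) (k : ℕ) :
    wellPoised z (k + 1) * ((2 * (k : ℚ) + 2) ^ 2 - z) =
      wellPoised z k * ((2 * (k : ℚ) + 1) ^ 2 - z) := by
  rw [wellPoised_succ, mul_assoc, div_mul_cancel₀ _ (hz k)]

lemma moment_zero {z : ℚ} (hz : ∀ j : ℕ, (2 * (j : ℚ) + 2) ^ 2 - z ≠ 0) (n : ℕ) :
    moment z n 0 = z + ((2 * (n : ℚ) + 1) ^ 2 - z) * wellPoised z n := by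
  induction n with
  | zero => simp [moment, wellPoised, lambdaBasis]
  | succ n ih =>
    have h := wellPoised_succ_mul hz n
    rw [moment, sum_range_succ, ← moment, ih]
    simp only [lambdaBasis, range_zero, prod_empty]
    push_cast
    linear_combination -h

lemma moment_recurrence {z : ℚ} (hz : ∀ j : ℕ, (2 * (j : ℚ) + 2) ^ 2 - z ≠ 0) (n r : ℕ) :
    (2 * (r : ℚ) + 3) * moment z n (r + 1) +
        (r + 1) / 2 * ((2 * (r : ℚ) + 1) ^ 2 - z) * moment z n r =
      ((2 * (n : ℚ) + 1) ^ 2 - z) * wellPoised z n *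
        (lambdaBasis n r * ((n + 1) * (n + r + 1 / 2))) := by
  have hP (x : ℚ) (r : ℕ) :
      lambdaBasis x (r + 1) = lambdaBasis x r * ((x - r) * (x + r + 1 / 2)) :=
    prod_range_succ _ _
  have hQ (x : ℚ) : lambdaBasis (x + 1) r * (x + 1 - r) * (x + 1 / 2) =
      lambdaBasis x r * ((x + 1) * (x + r + 1 / 2)) := by
    induction r with
    | zero => simp [lambdaBasis]
    | succ r ih =>
      rw [hP, hP]
      push_cast
      linear_combination (x + r + 3 / 2) * (x - r) * ih
  induction n with
  | zero =>
    simp only [moment, zero_add, sum_range_one, hP]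
    rcases r with _ | r
    · simp [lambdaBasis, wellPoised]; ring
    · have : lambdaBasis ((0 : ℕ) : ℚ) (r + 1) = 0 := lambdaBasis_natCast_eq_zero r.succ_pos
      simp only [this]
      ring
  | succ n ih =>
    have h1 := wellPoised_succ_mul hz n
    have h2 := hQ n
    have hS (s : ℕ) : moment z (n + 1) s = moment z n s +
        (4 * ((n + 1 : ℕ) : ℚ) + 1) * wellPoised z (n + 1) * lambdaBasis (n + 1 : ℕ) s :=
      sum_range_succ _ _
    rw [hS, hS, hP]
    push_cast
    linear_combination ih - (lambdaBasis n r * ((n + 1) * (n + r + 1 / 2))) * h1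
      - wellPoised z (n + 1) * ((2 * (n : ℚ) + 2) ^ 2 - z) * h2

/-- A special case of the Saalschütz summation, proved by the WZ method. -/
lemma sum_prod_div_odd (n : ℕ) :
    ∑ r ∈ range (n + 1), (∏ i ∈ range r, ((i : ℚ) - n) * (i + n + 1) / (i + 1) ^ 2) /
      (2 * (r : ℚ) + 1) = 1 / (2 * (n : ℚ) + 1) := by
  induction n with
  | zero => simp
  | succ n ih =>
    set g : ℕ → ℚ := fun r => ∏ i ∈ range r, ((i : ℚ) - n - 1) * (i + n + 1) / (i + 1) ^ 2
    have hn : (n : ℚ) + 1 ≠ 0 := by positivity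
    have hg (m : ℕ) : g (m + 1) = g m * (((m : ℚ) - n - 1) * (m + n + 1) / (m + 1) ^ 2) :=
      prod_range_succ _ _
    have hsum (m : ℕ) : ∑ r ∈ range m, g r = -(m : ℚ) ^ 2 * g m / (n + 1) ^ 2 := by
      induction m with
      | zero => simp
      | succ m ihm =>
        have : (m : ℚ) + 1 ≠ 0 := by positivity
        rw [sum_range_succ, ihm, hg]
        push_cast
        field_simp
        ring
    have hg0 : g (n + 2) = 0 := prod_eq_zero (i := n + 1) (by simp) (by simp)
    have hf (r : ℕ) : ∏ i ∈ range r, ((i : ℚ) - n) * (i + n + 1) / (i + 1) ^ 2 =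
        g r * (n + 1 - r) / (n + 1) := by
      induction r with
      | zero => simp [g, hn]
      | succ r ihr =>
        rw [prod_range_succ, ihr, hg]
        push_cast
        field_simp
        ring
    have hf' (r : ℕ) : ∏ i ∈ range r, ((i : ℚ) - (n + 1 : ℕ)) * (i + (n + 1 : ℕ) + 1) /
        (i + 1) ^ 2 = g r * (n + 1 + r) / (n + 1) := by
      induction r with
      | zero => simp [g, hn]
      | succ r ihr =>
        rw [prod_range_succ, ihr, hg]
        push_cast
        field_simp
        ring
    have h0 := hsum (n + 2)
    rw [hg0, mul_zero, zero_div] at h0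
    have ih' : ∑ r ∈ range (n + 1 + 1), (∏ i ∈ range r, ((i : ℚ) - n) * (i + n + 1) /
        (i + 1) ^ 2) / (2 * (r : ℚ) + 1) = 1 / (2 * (n : ℚ) + 1) := by
      rw [sum_range_succ, ih, prod_eq_zero (i := n) (by simp) (by simp), zero_div, add_zero]
    have h1 : (2 * (n : ℚ) + 1) ≠ 0 := by positivity
    have h2 : (2 * (n : ℚ) + 3) ≠ 0 := by positivity
    have key : (2 * (n : ℚ) + 3) * ∑ r ∈ range (n + 1 + 1), (∏ i ∈ range r,
        ((i : ℚ) - (n + 1 : ℕ)) * (i + (n + 1 : ℕ) + 1) / (i + 1) ^ 2) / (2 * (r : ℚ) + 1) -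
        (2 * (n : ℚ) + 1) * (1 / (2 * (n : ℚ) + 1)) = 2 * ∑ r ∈ range (n + 2), g r := by
      rw [← ih', mul_sum, mul_sum, mul_sum, ← sum_sub_distrib]
      refine sum_congr rfl fun r _ => ?_
      have : (2 * (r : ℚ) + 1) ≠ 0 := by positivity
      rw [hf, hf']
      field_simp
      ring
    rw [h0, mul_one_div_cancel h1] at key
    push_cast at key ⊢
    rw [eq_div_iff (by positivity)]
    linarith

/-- `p ^ e` divides the rational number `x` in the localization of `ℤ` at `p`. -/
def PowDvd (p e : ℕ) (x : ℚ) : Prop := ratCongr x 0 p e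

lemma powDvd_iff {p e : ℕ} {x : ℚ} :
    PowDvd p e x ↔ ∃ a b : ℤ, ¬ (p : ℤ) ∣ b ∧ x * (b : ℚ) = (p : ℚ) ^ e * (a : ℚ) := by
  simp [PowDvd, ratCongr]

section PowDvd

variable {p e f : ℕ} {x y : ℚ}

lemma PowDvd.add [hp : Fact p.Prime] (hx : PowDvd p e x) (hy : PowDvd p e y) :
    PowDvd p e (x + y) := by
  rw [powDvd_iff] at *
  obtain ⟨a, b, hb, h⟩ := hx
  obtain ⟨c, d, hd, h'⟩ := hy
  refine ⟨a * d + c * b, b * d, (Nat.prime_iff_prime_int.1 hp.out).not_dvd_mul hb hd, ?_⟩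
  push_cast
  linear_combination d * h + b * h'

lemma PowDvd.mul [hp : Fact p.Prime] (hx : PowDvd p e x) (hy : PowDvd p f y) :
    PowDvd p (e + f) (x * y) := by
  rw [powDvd_iff] at *
  obtain ⟨a, b, hb, h⟩ := hx
  obtain ⟨c, d, hd, h'⟩ := hy
  refine ⟨a * c, b * d, (Nat.prime_iff_prime_int.1 hp.out).not_dvd_mul hb hd, ?_⟩
  push_cast
  rw [pow_add]
  linear_combination y * d * h + (p : ℚ) ^ e * a * h'

lemma PowDvd.mul_left [Fact p.Prime] (hx : PowDvd p 0 x) (hy : PowDvd p e y) :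
    PowDvd p e (x * y) := by
  simpa using hx.mul hy

lemma PowDvd.mul_right [Fact p.Prime] (hx : PowDvd p e x) (hy : PowDvd p 0 y) :
    PowDvd p e (x * y) := hx.mul hy

lemma PowDvd.intCast_mul_pow [hp : Fact p.Prime] (a : ℤ) : PowDvd p e ((p : ℚ) ^ e * a) :=
  powDvd_iff.2 ⟨a, 1, (Nat.prime_iff_prime_int.1 hp.out).not_dvd_one, by simp⟩

lemma PowDvd.intCast [Fact p.Prime] (a : ℤ) : PowDvd p 0 a := by
  simpa using intCast_mul_pow (p := p) (e := 0) a

lemma PowDvd.natCast [Fact p.Prime] (a : ℕ) : PowDvd p 0 a := by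
  simpa using intCast (p := p) a

lemma PowDvd.pow_self [Fact p.Prime] : PowDvd p e ((p : ℚ) ^ e) := by
  simpa using intCast_mul_pow (p := p) (e := e) 1

lemma PowDvd.neg [Fact p.Prime] (hx : PowDvd p e x) : PowDvd p e (-x) := by
  simpa using (intCast (-1)).mul_left hx

lemma PowDvd.sub [Fact p.Prime] (hx : PowDvd p e x) (hy : PowDvd p e y) :
    PowDvd p e (x - y) := sub_eq_add_neg x y ▸ hx.add hy.neg

lemma PowDvd.mono (h : e ≤ f) (hx : PowDvd p f x) : PowDvd p e x := by
  rw [powDvd_iff] at *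
  obtain ⟨a, b, hb, hab⟩ := hx
  refine ⟨p ^ (f - e) * a, b, hb, ?_⟩
  rw [hab]
  push_cast
  rw [← mul_assoc, ← pow_add, Nat.add_sub_cancel' h]

lemma PowDvd.sum [Fact p.Prime] {s : Finset ℕ} {g : ℕ → ℚ} (h : ∀ i ∈ s, PowDvd p e (g i)) :
    PowDvd p e (∑ i ∈ s, g i) := by
  refine sum_induction _ _ (fun _ _ => PowDvd.add) ?_ h
  simpa using intCast_mul_pow (p := p) (e := e) 0

lemma PowDvd.inv_intCast {b : ℤ} (hb : ¬ (p : ℤ) ∣ b) : PowDvd p 0 (b : ℚ)⁻¹ := by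
  have : (b : ℚ) ≠ 0 := by
    rintro h
    exact hb (by simp [Int.cast_eq_zero.1 h])
  exact powDvd_iff.2 ⟨1, b, hb, by simp [this]⟩

lemma PowDvd.of_mul_self [hp : Fact p.Prime] (h : PowDvd p (e + 1) (p * x)) : PowDvd p e x := by
  rw [powDvd_iff] at *
  obtain ⟨a, b, hb, hab⟩ := h
  refine ⟨a, b, hb, mul_left_cancel₀ (Nat.cast_ne_zero.2 hp.out.ne_zero) ?_⟩
  rw [← mul_assoc, hab]
  ring

end PowDvd

/-- The second-order harmonic sum over the even numbers below an odd prime `p ≥ 5` vanishes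
modulo `p`. -/
lemma powDvd_sum_inv_even_sq {p n : ℕ} [hp : Fact p.Prime] (hn : p = 2 * n + 1) (h2 : 2 ≤ n) :
    PowDvd p 1 (∑ i ∈ range n, ((2 * (i : ℚ) + 2) ^ 2)⁻¹) := by
  set m := 2 * n - 2 with hm
  have hsum : ∑ i ∈ range n, ((i : ZMod p) + 1) ^ m = 0 := by
    have h0 : ∑ i ∈ range p, (i : ZMod p) ^ m = 0 := by
      rw [← FiniteField.sum_pow_lt_card_sub_one (ZMod p) m (by rw [ZMod.card]; omega)]
      symm
      refine sum_nbij' ZMod.val (fun i : ℕ => (i : ZMod p)) ?_ ?_ ?_ ?_ ?_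
      · intro a _; exact mem_range.2 a.val_lt
      · simp
      · simp
      · intro a ha; exact ZMod.val_cast_of_lt (mem_range.1 ha)
      · simp
    have hp0 : (2 * (n : ZMod p) + 1) = 0 := by
      have : ((2 * n + 1 : ℕ) : ZMod p) = 0 := by rw [← hn, ZMod.natCast_self]
      exact_mod_cast this
    have h1 : ∑ i ∈ range n, ((n + i : ℕ) + 1 : ZMod p) ^ m =
        ∑ i ∈ range n, ((i : ZMod p) + 1) ^ m := by
      rw [← sum_range_reflect]
      refine sum_congr rfl fun i hi => ?_
      have hi := mem_range.1 hi
      have he : Even m := ⟨n - 1, by omega⟩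
      rw [← he.neg_pow]
      congr 1
      have : ((n + (n - 1 - i) : ℕ) : ZMod p) = 2 * n - 1 - i := by
        rw [eq_sub_iff_add_eq, eq_sub_iff_add_eq]
        exact_mod_cast congrArg _ (show n + (n - 1 - i) + i + 1 = 2 * n by omega)
      rw [this]
      linear_combination -hp0
    have hr : range p = range (n + n + 1) := by rw [hn, two_mul]
    rw [hr, sum_range_succ', Nat.cast_zero, zero_pow (by omega), add_zero, sum_range_add] at h0
    push_cast at h0 h1
    rw [h1, ← two_mul] at h0
    refine (mul_eq_zero.1 h0).resolve_left fun h => ?_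
    have h3 : ((2 : ℕ) : ZMod p) = 0 := by exact_mod_cast h
    have := Nat.le_of_dvd two_pos ((ZMod.natCast_eq_zero_iff _ _).1 h3)
    omega
  have hint : PowDvd p 1 (((∑ i ∈ range n, (2 * (i : ℤ) + 2) ^ m : ℤ)) : ℚ) := by
    have : (p : ℤ) ∣ ∑ i ∈ range n, (2 * (i : ℤ) + 2) ^ m := by
      rw [← ZMod.intCast_zmod_eq_zero_iff_dvd]
      push_cast
      rw [← mul_zero ((2 : ZMod p) ^ m), ← hsum, mul_sum]
      exact sum_congr rfl fun i _ => by rw [← mul_pow]; ring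
    obtain ⟨c, hc⟩ := this
    rw [hc]
    push_cast
    simpa using PowDvd.intCast_mul_pow (p := p) (e := 1) c
  have hdiff : PowDvd p 1 (∑ i ∈ range n,
      (((2 * (i : ℚ) + 2) ^ 2)⁻¹ - (2 * (i : ℚ) + 2) ^ m)) := by
    refine PowDvd.sum fun i hi => ?_
    have hi := mem_range.1 hi
    have hnd : ¬ (p : ℤ) ∣ (2 * i + 2 : ℤ) := by
      intro h
      have := Int.le_of_dvd (by positivity) h
      omega
    have hF := Int.ModEq.pow_card_sub_one_eq_one hp.out
      ((Nat.prime_iff_prime_int.1 hp.out).coprime_iff_not_dvd.2 hnd).symm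
    obtain ⟨c, hc⟩ := hF.dvd
    have hinv : PowDvd p 0 (((2 * i + 2) ^ 2 : ℤ) : ℚ)⁻¹ := PowDvd.inv_intCast fun h =>
      hnd ((Nat.prime_iff_prime_int.1 hp.out).dvd_of_dvd_pow h)
    have := hinv.mul_left (PowDvd.intCast_mul_pow (p := p) (e := 1) c)
    convert this using 1
    have hc' : (1 : ℚ) - (2 * i + 2) ^ (p - 1) = p * c := by exact_mod_cast hc
    have hne : (2 * (i : ℚ) + 2) ≠ 0 := by positivity
    rw [pow_one, ← hc', show p - 1 = m + 2 by omega, pow_add]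
    push_cast
    field_simp
  have := hdiff.add hint
  rw [sum_sub_distrib] at this
  push_cast at this
  simpa using this

lemma even_sq_ne_odd_sq (n j : ℕ) : (2 * (j : ℚ) + 2) ^ 2 - (2 * (n : ℚ) + 1) ^ 2 ≠ 0 := by
  have h : (2 * (j : ℤ) + 2) ^ 2 - (2 * (n : ℤ) + 1) ^ 2 ≠ 0 := by
    intro h
    have h' := congrArg (· % 2) h
    have e : (2 * (j : ℤ) + 2) ^ 2 - (2 * (n : ℤ) + 1) ^ 2 =
      2 * (2 * (j + 1) ^ 2 - 2 * n ^ 2 - 2 * n - 1) + 1 := by ring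
    omega
  exact_mod_cast h

lemma even_sq_ne_zero (j : ℕ) : (2 * (j : ℚ) + 2) ^ 2 - 0 ≠ 0 := by
  rw [sub_zero]; positivity

lemma moment_odd_recurrence (n r : ℕ) :
    (2 * (r : ℚ) + 3) * moment ((2 * (n : ℚ) + 1) ^ 2) n (r + 1) =
      -((r + 1) / 2 * ((2 * (r : ℚ) + 1) ^ 2 - (2 * (n : ℚ) + 1) ^ 2)) *
        moment ((2 * (n : ℚ) + 1) ^ 2) n r := by
  linear_combination moment_recurrence (even_sq_ne_odd_sq n) n r

lemma moment_mul_saalCoeff_zero (n r : ℕ) :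
    moment ((2 * (n : ℚ) + 1) ^ 2) n r * saalCoeff 0 r = (2 * (n : ℚ) + 1) ^ 2 *
      ((∏ i ∈ range r, ((i : ℚ) - n) * (i + n + 1) / (i + 1) ^ 2) / (2 * (r : ℚ) + 1)) := by
  induction r with
  | zero => simp [moment_zero (even_sq_ne_odd_sq n), saalCoeff]
  | succ r ih =>
    have h := moment_odd_recurrence n r
    have h1 : (2 * (r : ℚ) + 3) ≠ 0 := by positivity
    have h2 : (2 * (r : ℚ) + 1) ≠ 0 := by positivity
    have h3 : (r : ℚ) + 1 ≠ 0 := by positivity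
    have h4 : (2 * (r : ℚ) + 2) ≠ 0 := by positivity
    rw [eq_comm, ← mul_div_assoc, div_eq_iff h2] at ih
    rw [mul_comm, ← eq_div_iff h1] at h
    rw [saalCoeff_succ, prod_range_succ, h]
    generalize ∏ i ∈ range r, ((i : ℚ) - n) * (i + n + 1) / (i + 1) ^ 2 = F at *
    have h5 : (2 * (n : ℚ) + 1) ^ 2 ≠ 0 := by positivity
    rw [mul_comm, ← eq_div_iff h5] at ih
    push_cast
    rw [ih, sub_zero]
    field_simp
    ring

/-- A terminating very-well-poised `₅F₄` summation. -/
lemma sum_wellPoised_zero_mul_odd (n : ℕ) :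
    ∑ k ∈ range (n + 1), (4 * (k : ℚ) + 1) * wellPoised ((2 * (n : ℚ) + 1) ^ 2) k *
      wellPoised 0 k = 2 * (n : ℚ) + 1 := by
  have h : (2 * (n : ℚ) + 1) ≠ 0 := by positivity
  rw [sum_wellPoised_mul even_sq_ne_zero]
  simp_rw [moment_mul_saalCoeff_zero]
  rw [← mul_sum, sum_prod_div_odd]
  field_simp

lemma wellPoised_zero_eq (k : ℕ) :
    wellPoised 0 k = rpoch (1 / 2) k ^ 2 / (k.factorial : ℚ) ^ 2 := by
  induction k with
  | zero => simp [wellPoised, rpoch]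
  | succ k ih =>
    have h : (k.factorial : ℚ) ≠ 0 := by positivity
    have h1 : (2 * (k : ℚ) + 2) ≠ 0 := by positivity
    have h2 : (k : ℚ) + 1 ≠ 0 := by positivity
    rw [wellPoised_succ, ih, rpoch, rpoch, ascPochhammer_succ_eval, Nat.factorial_succ]
    push_cast
    rw [sub_zero, sub_zero]
    field_simp
    ring

lemma powDvd_zero_natCast_inv {p m : ℕ} (h0 : 0 < m) (h : m < p) : PowDvd p 0 (m : ℚ)⁻¹ := by
  have := PowDvd.inv_intCast (p := p) (b := m)
    (fun h' => absurd (Nat.le_of_dvd h0 (Int.natCast_dvd_natCast.1 h')) (by omega))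
  simpa using this

lemma even_sq_sub_ne_zero {p n : ℕ} (hn : p = 2 * n + 1) (i : ℕ) :
    (2 * (i : ℚ) + 2) ^ 2 - (p : ℚ) ^ 2 ≠ 0 := by
  have := even_sq_ne_odd_sq n i
  rw [hn]
  exact_mod_cast this

section Prime

variable {p n : ℕ} [hp : Fact p.Prime]

lemma powDvd_zero_inv_even_sq (hn : p = 2 * n + 1) {i : ℕ} (hi : i < n) :
    PowDvd p 0 ((2 * (i : ℚ) + 2) ^ 2)⁻¹ := by
  have h := powDvd_zero_natCast_inv (p := p) (m := 2 * i + 2) (by omega) (by omega)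
  have := h.mul_left h
  rw [← mul_inv, ← sq] at this
  exact_mod_cast this

lemma powDvd_zero_inv_even_sq_sub (hn : p = 2 * n + 1) {i : ℕ} (hi : i < n) :
    PowDvd p 0 ((2 * (i : ℚ) + 2) ^ 2 - (p : ℚ) ^ 2)⁻¹ := by
  have h := PowDvd.inv_intCast (p := p) (b := (2 * (i : ℤ) + 2) ^ 2 - (p : ℤ) ^ 2) fun h => by
    have h' := (Nat.prime_iff_prime_int.1 hp.out).dvd_of_dvd_pow
      ((dvd_sub_left (dvd_pow_self (p : ℤ) two_ne_zero)).1 h)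
    have := Int.le_of_dvd (by positivity) h'
    omega
  exact_mod_cast h

lemma powDvd_zero_odd_sq_sub (i : ℕ) : PowDvd p 0 ((2 * (i : ℚ) + 1) ^ 2 - (p : ℚ) ^ 2) := by
  have h := PowDvd.intCast (p := p) ((2 * i + 1) ^ 2 - p ^ 2)
  push_cast at h
  exact h

lemma powDvd_zero_wellPoised (hn : p = 2 * n + 1) {k : ℕ} (hk : k ≤ n) :
    PowDvd p 0 (wellPoised ((p : ℚ) ^ 2) k) := by
  induction k with
  | zero => simpa [wellPoised] using PowDvd.natCast (p := p) 1
  | succ k ih =>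
    rw [wellPoised_succ, div_eq_mul_inv]
    exact (ih (by omega)).mul_left
      ((powDvd_zero_odd_sq_sub k).mul_left (powDvd_zero_inv_even_sq_sub hn hk))

lemma powDvd_two_wellPoised_sub (hn : p = 2 * n + 1) {k : ℕ} (hk : k ≤ n) :
    PowDvd p 2 (wellPoised 0 k - wellPoised ((p : ℚ) ^ 2) k) := by
  induction k with
  | zero => simpa [wellPoised] using PowDvd.intCast_mul_pow (p := p) (e := 2) 0
  | succ k ih =>
    have hA : PowDvd p 0 ((2 * (k : ℚ) + 1) ^ 2) := by
      exact_mod_cast PowDvd.natCast (p := p) ((2 * k + 1) ^ 2)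
    have hBA : PowDvd p 0 ((2 * (k : ℚ) + 2) ^ 2 - (2 * (k : ℚ) + 1) ^ 2) := by
      have h := PowDvd.intCast (p := p) ((2 * k + 2) ^ 2 - (2 * k + 1) ^ 2)
      push_cast at h
      exact h
    have hB := powDvd_zero_inv_even_sq hn hk
    have hBp := powDvd_zero_inv_even_sq_sub hn hk
    have h1 := (ih (by omega)).mul_right (hA.mul_left hB)
    have h2 := (powDvd_zero_wellPoised hn (show k ≤ n by omega)).mul_left
      ((PowDvd.pow_self (p := p) (e := 2)).mul_right (hBA.mul_left (hB.mul_left hBp)))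
    convert h1.add h2 using 1
    have h3 := even_sq_sub_ne_zero hn k
    have h4 : (2 * (k : ℚ) + 2) ^ 2 ≠ 0 := by positivity
    rw [wellPoised_succ, wellPoised_succ, sub_zero, sub_zero]
    generalize (2 * (k : ℚ) + 2) ^ 2 = B at h3 h4 ⊢
    field_simp
    ring

lemma powDvd_zero_saalCoeff (hn : p = 2 * n + 1) {r : ℕ} (hr : r ≤ n) :
    PowDvd p 0 (saalCoeff 0 r) := by
  induction r with
  | zero => simpa [saalCoeff] using PowDvd.natCast (p := p) 1
  | succ r ih =>
    have hg : PowDvd p 0 (-(2 * (2 * (r : ℚ) + 1))) := by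
      exact_mod_cast PowDvd.intCast (p := p) (-(2 * (2 * (r : ℤ) + 1)))
    have hi := powDvd_zero_natCast_inv (p := p) (m := r + 1) (by omega) (by omega)
    have := (ih (by omega)).mul_left
      (hg.mul_left (hi.mul_left (powDvd_zero_inv_even_sq hn hr)))
    rw [saalCoeff_succ, div_eq_mul_inv, mul_inv, sub_zero]
    exact_mod_cast this

/-- The expansion of `saalCoeff z r` at `z = 0` to first order, evaluated at `z = p²`. -/
lemma powDvd_four_saalCoeff_sub (hn : p = 2 * n + 1) {r : ℕ} (hr : r ≤ n) :
    PowDvd p 4 (saalCoeff ((p : ℚ) ^ 2) r - saalCoeff 0 r *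
      (1 + (p : ℚ) ^ 2 * ∑ i ∈ range r, ((2 * (i : ℚ) + 2) ^ 2)⁻¹)) := by
  induction r with
  | zero => simpa [saalCoeff] using PowDvd.intCast_mul_pow (p := p) (e := 4) 0
  | succ r ih =>
    have hg : PowDvd p 0 (-(2 * (2 * (r : ℚ) + 1))) := by
      exact_mod_cast PowDvd.intCast (p := p) (-(2 * (2 * (r : ℤ) + 1)))
    have hi : PowDvd p 0 ((r : ℚ) + 1)⁻¹ := by
      exact_mod_cast powDvd_zero_natCast_inv (p := p) (m := r + 1) (by omega) (by omega)
    have hB := powDvd_zero_inv_even_sq hn hr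
    have hBp := powDvd_zero_inv_even_sq_sub hn hr
    have hH : PowDvd p 0 (∑ i ∈ range r, ((2 * (i : ℚ) + 2) ^ 2)⁻¹) :=
      PowDvd.sum fun i hi => powDvd_zero_inv_even_sq hn (by have := mem_range.1 hi; omega)
    have hs := powDvd_zero_saalCoeff hn (show r ≤ n by omega)
    have hone : PowDvd p 0 1 := by simpa using PowDvd.natCast (p := p) 1
    have h1 := (ih (by omega)).mul_right ((hg.mul_left hi).mul_left hBp)
    have hp2 : PowDvd p 0 ((p : ℚ) ^ 2) := PowDvd.pow_self.mono (Nat.zero_le 2)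
    have h2 := (PowDvd.pow_self (p := p) (e := 4)).mul_right
      (((hg.mul_left hi).mul_left hs).mul_left
        ((hB.mul_left hB).mul_left (((hone.add (hp2.mul_left hH)).mul_left hBp).add hH)))
    convert h1.add h2 using 1
    have h3 := even_sq_sub_ne_zero hn r
    have h4 : (2 * (r : ℚ) + 2) ^ 2 ≠ 0 := by positivity
    have h5 : (r : ℚ) + 1 ≠ 0 := by positivity
    rw [saalCoeff_succ, saalCoeff_succ, sum_range_succ, sub_zero]
    generalize ∑ i ∈ range r, ((2 * (i : ℚ) + 2) ^ 2)⁻¹ = H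
    generalize (2 * (r : ℚ) + 2) ^ 2 = B at h3 h4 ⊢
    field_simp
    ring

lemma powDvd_two_moment (hn : p = 2 * n + 1) {r : ℕ} (hr : r < n) :
    PowDvd p 2 (moment ((p : ℚ) ^ 2) n r) := by
  have hpn : (p : ℚ) = 2 * n + 1 := by exact_mod_cast hn
  induction r with
  | zero =>
    rw [moment_zero (even_sq_sub_ne_zero hn), ← hpn, sub_self, zero_mul, add_zero]
    exact PowDvd.pow_self
  | succ r ih =>
    have h := moment_odd_recurrence n r
    rw [← hpn] at h
    have h3 : (2 * (r : ℚ) + 3) ≠ 0 := by positivity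
    have hi : PowDvd p 0 (2 * (r : ℚ) + 3)⁻¹ := by
      exact_mod_cast powDvd_zero_natCast_inv (p := p) (m := 2 * r + 3) (by omega) (by omega)
    have h2 : PowDvd p 0 ((2 : ℕ) : ℚ)⁻¹ := powDvd_zero_natCast_inv (by omega) (by omega)
    have hr1 : PowDvd p 0 (-((r : ℚ) + 1)) := by
      exact_mod_cast PowDvd.intCast (p := p) (-((r : ℤ) + 1))
    convert (hi.mul_left ((hr1.mul_left h2).mul_left (powDvd_zero_odd_sq_sub r))).mul_left
      (ih (by omega)) using 1
    rw [mul_assoc, eq_inv_mul_iff_mul_eq₀ h3, h]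
    push_cast
    ring

lemma powDvd_one_moment (hn : p = 2 * n + 1) (h1 : 1 ≤ n) :
    PowDvd p 1 (moment ((p : ℚ) ^ 2) n n) := by
  have hpn : (p : ℚ) = 2 * n + 1 := by exact_mod_cast hn
  obtain ⟨r, rfl⟩ := Nat.exists_eq_add_of_le' h1
  have h := moment_odd_recurrence (r + 1) r
  rw [← hpn] at h
  have h2 : PowDvd p 0 ((2 : ℕ) : ℚ)⁻¹ := powDvd_zero_natCast_inv (by omega) (by omega)
  have hr1 : PowDvd p 0 (-((r : ℚ) + 1)) := by
    exact_mod_cast PowDvd.intCast (p := p) (-((r : ℤ) + 1))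
  refine PowDvd.of_mul_self ?_
  convert ((hr1.mul_left h2).mul_left (powDvd_zero_odd_sq_sub r)).mul_left
    (powDvd_two_moment hn (Nat.lt_succ_self r)) using 1
  rw [show (p : ℚ) = 2 * r + 3 by rw [hpn]; push_cast; ring] at h ⊢
  rw [h]
  push_cast
  ring

lemma powDvd_four_moment_mul_saalCoeff_sub (hn : p = 2 * n + 1) (h2 : 2 ≤ n) {r : ℕ}
    (hr : r ≤ n) :
    PowDvd p 4 (moment ((p : ℚ) ^ 2) n r * (saalCoeff ((p : ℚ) ^ 2) r - saalCoeff 0 r)) := by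
  have h4 := powDvd_four_saalCoeff_sub hn hr
  have hs := powDvd_zero_saalCoeff hn hr
  have hdiff {e : ℕ} (he : e ≤ 2)
      (hH : PowDvd p e (∑ i ∈ range r, ((2 * (i : ℚ) + 2) ^ 2)⁻¹)) :
      PowDvd p (2 + e) (saalCoeff ((p : ℚ) ^ 2) r - saalCoeff 0 r) := by
    convert (h4.mono (show 2 + e ≤ 4 by omega)).add
      (hs.mul_left ((PowDvd.pow_self (p := p) (e := 2)).mul hH)) using 1
    ring
  rcases hr.lt_or_eq with hlt | rfl
  · exact (powDvd_two_moment hn hlt).mul (hdiff (e := 0) (by omega) (PowDvd.sum fun i hi =>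
      powDvd_zero_inv_even_sq hn (by have := mem_range.1 hi; omega)))
  · exact (powDvd_one_moment hn (by omega)).mul
      (hdiff (e := 1) (by omega) (powDvd_sum_inv_even_sq hn h2))

lemma powDvd_four_sum_wellPoised_sq_sub (hn : p = 2 * n + 1) (h2 : 2 ≤ n) :
    PowDvd p 4 (∑ k ∈ range (n + 1), (4 * (k : ℚ) + 1) * wellPoised 0 k ^ 2 - p) := by
  have hpn : (p : ℚ) = 2 * n + 1 := by exact_mod_cast hn
  have h0 := sum_wellPoised_zero_mul_odd n
  rw [← hpn] at h0
  have hsq : PowDvd p 4 (∑ k ∈ range (n + 1), (4 * (k : ℚ) + 1) *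
      (wellPoised 0 k - wellPoised ((p : ℚ) ^ 2) k) ^ 2) := by
    refine PowDvd.sum fun k hk => ?_
    have h := powDvd_two_wellPoised_sub hn (show k ≤ n by have := mem_range.1 hk; omega)
    have hk : PowDvd p 0 (4 * (k : ℚ) + 1) := by
      exact_mod_cast PowDvd.natCast (p := p) (4 * k + 1)
    rw [sq]
    exact hk.mul_left (h.mul h)
  have hmom : PowDvd p 4 (∑ r ∈ range (n + 1),
      moment ((p : ℚ) ^ 2) n r * (saalCoeff ((p : ℚ) ^ 2) r - saalCoeff 0 r)) :=
    PowDvd.sum fun r hr => powDvd_four_moment_mul_saalCoeff_sub hn h2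
      (by have := mem_range.1 hr; omega)
  simp_rw [mul_sub] at hmom
  rw [sum_sub_distrib, ← sum_wellPoised_mul (even_sq_sub_ne_zero hn),
    ← sum_wellPoised_mul even_sq_ne_zero, h0] at hmom
  convert hsq.sub hmom using 1
  have : ∑ k ∈ range (n + 1), (4 * (k : ℚ) + 1) *
      (wellPoised 0 k - wellPoised ((p : ℚ) ^ 2) k) ^ 2 =
      ∑ k ∈ range (n + 1), (4 * (k : ℚ) + 1) * wellPoised 0 k ^ 2 -
      2 * ∑ k ∈ range (n + 1), (4 * (k : ℚ) + 1) * wellPoised ((p : ℚ) ^ 2) k * wellPoised 0 k +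
      ∑ k ∈ range (n + 1), (4 * (k : ℚ) + 1) * wellPoised ((p : ℚ) ^ 2) k *
        wellPoised ((p : ℚ) ^ 2) k := by
    rw [mul_sum, ← sum_sub_distrib, ← sum_add_distrib]
    exact sum_congr rfl fun k _ => by ring
  rw [this, h0]
  ring

end Prime

end LongC2

/-- Long: for primes `p ≥ 5`,
`Σ_{k=0}^{(p-1)/2} (4k+1) (1/2)_k^4/k!^4 ≡ p (mod p^4)`. -/
theorem stmt11 (p : ℕ) (hp : p.Prime) (hp5 : 5 ≤ p) :
    ratCongr
      (∑ k ∈ Finset.range ((p - 1) / 2 + 1),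
        (4 * (k : ℚ) + 1) * (rpoch (1 / 2) k) ^ 4 / ((k.factorial : ℚ)) ^ 4)
      (p : ℚ) p 4 := by
  have : Fact p.Prime := ⟨hp⟩
  obtain ⟨n, hn⟩ := hp.odd_of_ne_two (by omega)
  have h := LongC2.powDvd_four_sum_wellPoised_sq_sub hn (by omega)
  rw [show (p - 1) / 2 = n by omega]
  have hsum : ∑ k ∈ range (n + 1), (4 * (k : ℚ) + 1) * rpoch (1 / 2) k ^ 4 /
      (k.factorial : ℚ) ^ 4 = ∑ k ∈ range (n + 1), (4 * (k : ℚ) + 1) *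
        LongC2.wellPoised 0 k ^ 2 :=
    sum_congr rfl fun k _ => by rw [LongC2.wellPoised_zero_eq]; ring
  rw [hsum]
  exact LongC2.powDvd_iff.1 h
end
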